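/- (S-arithmetic analogue of Schmidt's counting theorem, first assertion) Assume d = m + n ≥ 3. Let ψ = (ψ_p)_{p∈S} be a collection of approximating functions, N ∈ ℕ_S, v_d ∈ ℤ_S^d, and define ψ' = (ψ'_p) by ψ'_∞(t) = ψ_∞(N^n t)/N^m and ψ'_p = ψ_p for p ∈ S_f; for T = (T_p)_{p∈S} set T' = (T'_p) with T'_∞ = T_∞/N^n and T'_p = T_p for p ∈ S_f. Fix δ ∈ (2/3, 1). Then for almost every g ∈ SL_d(ℚ_S) (with respect to Haar measure) there exist C > 0 and T'_0 such that for all T' ⪰ T'_0, |#(g(ℤ_S^d + v_d/N) ∩ E_{ψ'}(T')) − vol(E_{ψ'}(T'))| ≤ C · vol(E_{ψ'}(T'))^{δ}. -/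

import Mathlib

open MeasureTheory Matrix

noncomputable section

/-- `z` belongs to the ring of `S`-integers `ℤ_S = ℤ[1/P]`,
where `P` is the product of the finite primes in `S`. -/
def IsZS (P : ℕ) (z : ℚ) : Prop := ∃ (a : ℤ) (k : ℕ), z = (a : ℚ) / (P : ℚ) ^ k

/-- A collection of approximating functions `ψ = (ψ_p)_{p ∈ S}`:
each `ψ_p : ℝ_{>0} → ℝ_{>0}` is non-increasing and `≡ 1` on `(0,1]`
(we extend by `1` on `t ≤ 1`); moreover for each finite place `p`,
`ψ_p` is constant on `{p^{kn}, …, p^{kn+n-1}}` for every `k ∈ ℤ` and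
takes values in `p^{mℤ}` on `p^ℤ`. -/
structure ApproxFamily (m n s : ℕ) (p : Fin s → ℕ) : Type where
  psiR : ℝ → ℝ
  psiP : Fin s → ℝ → ℝ
  posR : ∀ t, 0 < psiR t
  antiR : ∀ ⦃t₁ t₂ : ℝ⦄, 0 < t₁ → t₁ ≤ t₂ → psiR t₂ ≤ psiR t₁
  oneR : ∀ ⦃t : ℝ⦄, t ≤ 1 → psiR t = 1
  posP : ∀ i t, 0 < psiP i t
  antiP : ∀ i ⦃t₁ t₂ : ℝ⦄, 0 < t₁ → t₁ ≤ t₂ → psiP i t₂ ≤ psiP i t₁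
  oneP : ∀ i ⦃t : ℝ⦄, t ≤ 1 → psiP i t = 1
  constP : ∀ i (k : ℤ) (j : ℕ), j < n →
    psiP i ((p i : ℝ) ^ (k * n + j : ℤ)) = psiP i ((p i : ℝ) ^ (k * n : ℤ))
  valsP : ∀ i (k : ℤ), ∃ l : ℤ, psiP i ((p i : ℝ) ^ k) = (p i : ℝ) ^ (m * l : ℤ)

/-- The real components of the diagonal embedding of a rational vector. -/
def ratR {k : ℕ} (q : Fin k → ℚ) : Fin k → ℝ := fun j => (q j : ℝ)

/-- The `p i`-adic components of the diagonal embedding of a rational vector. -/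
def ratP {s : ℕ} (p : Fin s → ℕ) [∀ i, Fact (p i).Prime] {k : ℕ} (i : Fin s)
    (q : Fin k → ℚ) : Fin k → ℚ_[p i] := fun j => (q j : ℚ_[p i])

/-- The region `E_f(T) ⊆ ℚ_S^m × ℚ_S^n` cut out by `‖x‖_p^m ≤ f_p(‖y‖_p^n)` and
`‖y‖_p^n ≤ T_p` for all `p ∈ S` (product coordinates). -/
def Eprod (m n : ℕ) {s : ℕ} (p : Fin s → ℕ) [∀ i, Fact (p i).Prime]
    (fR : ℝ → ℝ) (fP : Fin s → ℝ → ℝ) (TR : ℝ) (TP : Fin s → ℝ) :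
    Set (((Fin m → ℝ) × ∀ i, Fin m → ℚ_[p i]) × ((Fin n → ℝ) × ∀ i, Fin n → ℚ_[p i])) :=
  {xy | ‖xy.1.1‖ ^ m ≤ fR (‖xy.2.1‖ ^ n) ∧ ‖xy.2.1‖ ^ n ≤ TR ∧
      ∀ i, ‖xy.1.2 i‖ ^ m ≤ fP i (‖xy.2.2 i‖ ^ n) ∧ ‖xy.2.2 i‖ ^ n ≤ TP i}

/-- The region `E_f(T) ⊆ ℚ_S^{m+n}`, where the first `m` coordinates play the role of
`x` and the last `n` coordinates the role of `y`. -/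
def Efull (m n : ℕ) {s : ℕ} (p : Fin s → ℕ) [∀ i, Fact (p i).Prime]
    (fR : ℝ → ℝ) (fP : Fin s → ℝ → ℝ) (TR : ℝ) (TP : Fin s → ℝ) :
    Set ((Fin (m + n) → ℝ) × ∀ i, Fin (m + n) → ℚ_[p i]) :=
  {v | ‖fun a : Fin m => v.1 (Fin.castAdd n a)‖ ^ m
        ≤ fR (‖fun b : Fin n => v.1 (Fin.natAdd m b)‖ ^ n) ∧
      ‖fun b : Fin n => v.1 (Fin.natAdd m b)‖ ^ n ≤ TR ∧
      ∀ i, ‖fun a : Fin m => v.2 i (Fin.castAdd n a)‖ ^ m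
            ≤ fP i (‖fun b : Fin n => v.2 i (Fin.natAdd m b)‖ ^ n) ∧
          ‖fun b : Fin n => v.2 i (Fin.natAdd m b)‖ ^ n ≤ TP i}

/-- The operator norm of a real matrix acting on sup-normed spaces. -/
def opNorm {k l : ℕ} (M : Matrix (Fin k) (Fin l) ℝ) : ℝ :=
  ‖LinearMap.toContinuousLinearMap M.mulVecLin‖

/-- An element of the group `𝐇 = ∏_{p ∈ S} H_p` of block lower-triangular matrices,
given by its blocks at each place. -/
structure HElem (m n : ℕ) (s : ℕ) (p : Fin s → ℕ) [∀ i, Fact (p i).Prime] : Type where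
  aR : Matrix (Fin m) (Fin m) ℝ
  bR : Matrix (Fin n) (Fin m) ℝ
  cR : Matrix (Fin n) (Fin n) ℝ
  aP : ∀ i, Matrix (Fin m) (Fin m) ℚ_[p i]
  bP : ∀ i, Matrix (Fin n) (Fin m) ℚ_[p i]
  cP : ∀ i, Matrix (Fin n) (Fin n) ℚ_[p i]

/-- The action of an element of `𝐇` on `ℚ_S^m × ℚ_S^n`:
`h·(x, y) = (α x, β x + γ y)` at each place. -/
def HElem.act {m n s : ℕ} {p : Fin s → ℕ} [∀ i, Fact (p i).Prime] (h : HElem m n s p)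
    (xy : ((Fin m → ℝ) × ∀ i, Fin m → ℚ_[p i]) × ((Fin n → ℝ) × ∀ i, Fin n → ℚ_[p i])) :
    ((Fin m → ℝ) × ∀ i, Fin m → ℚ_[p i]) × ((Fin n → ℝ) × ∀ i, Fin n → ℚ_[p i]) :=
  ((h.aR.mulVec xy.1.1, fun i => (h.aP i).mulVec (xy.1.2 i)),
   (h.bR.mulVec xy.1.1 + h.cR.mulVec xy.2.1,
    fun i => (h.bP i).mulVec (xy.1.2 i) + (h.cP i).mulVec (xy.2.2 i)))

/-- Membership in `H̃_{∞,ε}`: operator norm bounds on the blocks. -/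
def inHtilde (m n : ℕ) (ε : ℝ) (α : Matrix (Fin m) (Fin m) ℝ) (β : Matrix (Fin n) (Fin m) ℝ)
    (γ : Matrix (Fin n) (Fin n) ℝ) : Prop :=
  opNorm α ^ m ≤ 1 + ε ∧ opNorm γ ^ n ≤ 1 + ε / 2 ∧ opNorm β ≤ ε / (4 * n)

/-- `h ∈ (H̃_{∞,ε} ∩ H̃_{∞,ε}⁻¹) × ∏_{p ∈ S_f} H_p(ℤ_p)`. -/
def HElem.isAdmissible {m n s : ℕ} {p : Fin s → ℕ} [∀ i, Fact (p i).Prime]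
    (h : HElem m n s p) (ε : ℝ) : Prop :=
  IsUnit h.aR.det ∧ IsUnit h.cR.det ∧
  inHtilde m n ε h.aR h.bR h.cR ∧
  inHtilde m n ε h.aR⁻¹ (-(h.cR⁻¹ * h.bR * h.aR⁻¹)) h.cR⁻¹ ∧
  ∀ i, ((∀ a b, ‖h.aP i a b‖ ≤ 1) ∧ ‖(h.aP i).det‖ = 1) ∧
      ((∀ a b, ‖h.cP i a b‖ ≤ 1) ∧ ‖(h.cP i).det‖ = 1) ∧
      (∀ a b, ‖h.bP i a b‖ ≤ 1)

end

noncomputable section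

/-- The number of points of the image under `g ∈ SL_{m+n}(ℚ_S)` of the set of
rational vectors in `L` (diagonally embedded into `ℚ_S^{m+n}`) lying in `E`. -/
def gridCount (m n : ℕ) {s : ℕ} (p : Fin s → ℕ) [∀ i, Fact (p i).Prime]
    (g : (SpecialLinearGroup (Fin (m + n)) ℝ) ×
      ∀ i, SpecialLinearGroup (Fin (m + n)) ℚ_[p i])
    (L : Set (Fin (m + n) → ℚ))
    (E : Set ((Fin (m + n) → ℝ) × ∀ i, Fin (m + n) → ℚ_[p i])) : ℕ :=
  Set.ncard {w : Fin (m + n) → ℚ | w ∈ L ∧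
    (((g.1 : Matrix (Fin (m + n)) (Fin (m + n)) ℝ).mulVec (ratR w),
      fun i => ((g.2 i : Matrix (Fin (m + n)) (Fin (m + n)) ℚ_[p i]).mulVec (ratP p i w)))
      ∈ E)}

section

open Filter Topology

set_option linter.unusedSectionVars false

/-- Kernel of a surjective homomorphism between finite additive groups. -/
theorem card_filter_ker_mul {G H : Type*} [AddCommGroup G] [AddCommGroup H] [Fintype G] [Fintype H]
    [DecidableEq H] (f : G →+ H) (hf : Function.Surjective f) :
    (Finset.univ.filter fun x => f x = 0).card * Fintype.card H = Fintype.card G := by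
  classical
  have h1 := AddSubgroup.card_eq_card_quotient_mul_card_addSubgroup f.ker
  have h2 : Nat.card (G ⧸ f.ker) = Nat.card H :=
    Nat.card_congr (QuotientAddGroup.quotientKerEquivOfSurjective f hf).toEquiv
  have h3 : Nat.card f.ker = (Finset.univ.filter fun x => f x = 0).card := by
    rw [Nat.card_eq_fintype_card, Fintype.card_subtype]
    simp [AddMonoidHom.mem_ker]
  rw [h2, h3, Nat.card_eq_fintype_card, Nat.card_eq_fintype_card] at h1
  rw [h1, mul_comm]

section ModPrime

variable {d : ℕ} {l : ℕ} [Fact l.Prime]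

theorem card_orthogonal_mul (y : Fin d → ZMod l) (hy : y ≠ 0) :
    (Finset.univ.filter fun ξ : Fin d → ZMod l => ξ ⬝ᵥ y = 0).card * l = l ^ d := by
  classical
  obtain ⟨j, hj⟩ := Function.ne_iff.mp hy
  have h := card_filter_ker_mul
    (AddMonoidHom.mk' (fun ξ : Fin d → ZMod l => ξ ⬝ᵥ y) (fun a b => add_dotProduct a b y))
    (fun c => ⟨Pi.single j (c * (y j)⁻¹), by
      have hj' : y j ≠ 0 := hj
      simp [single_dotProduct, hj']⟩)
  simpa [ZMod.card] using h

theorem card_orthogonal_pair_mul (y z : Fin d → ZMod l) (i j : Fin d)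
    (h : y i * z j - y j * z i ≠ 0) :
    (Finset.univ.filter fun ξ : Fin d → ZMod l => ξ ⬝ᵥ y = 0 ∧ ξ ⬝ᵥ z = 0).card * l ^ 2
      = l ^ d := by
  classical
  have h' := card_filter_ker_mul
    (AddMonoidHom.mk' (fun ξ : Fin d → ZMod l => (ξ ⬝ᵥ y, ξ ⬝ᵥ z))
      (fun a b => by simp [add_dotProduct]))
    (fun c => ⟨Pi.single i ((c.1 * z j - c.2 * y j) / (y i * z j - y j * z i)) +
        Pi.single j ((c.2 * y i - c.1 * z i) / (y i * z j - y j * z i)), by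
      ext
      · simp [add_dotProduct]
        rw [div_mul_eq_mul_div, div_mul_eq_mul_div, ← add_div, div_eq_iff h]
        ring
      · simp [add_dotProduct]
        rw [div_mul_eq_mul_div, div_mul_eq_mul_div, ← add_div, div_eq_iff h]
        ring⟩)
  simpa [ZMod.card, Prod.ext_iff, pow_two] using h'

end ModPrime

/-- The reduction of an integer vector modulo `l`. -/
def redMod (l : ℕ) {d : ℕ} (y : Fin d → ℤ) : Fin d → ZMod l := fun j => (y j : ZMod l)

theorem redMod_ne_zero {l d : ℕ} {y : Fin d → ℤ} (hy : y ≠ 0) (hb : ∀ j, |y j| < l) :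
    redMod l y ≠ 0 := by
  intro h
  apply hy
  funext j
  have h1 : ((y j : ℤ) : ZMod l) = 0 := congrFun h j
  rw [ZMod.intCast_zmod_eq_zero_iff_dvd] at h1
  exact Int.eq_zero_of_abs_lt_dvd h1 (hb j)

/-- `ξ` is good at scale `h` if `ξ₀ ≠ 0` and no short nonzero integer vector is orthogonal
to it modulo `l`. -/
def IsGoodMod {l d : ℕ} [NeZero d] (h : ℕ) (ξ : Fin d → ZMod l) : Prop :=
  ξ 0 ≠ 0 ∧ ∀ y : Fin d → ℤ, y ≠ 0 → (∀ j, |y j| ≤ h) → ξ ⬝ᵥ redMod l y ≠ 0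

open Classical in
theorem card_good_mod {l d : ℕ} [Fact l.Prime] [NeZero d] (h : ℕ) (hl : 4 ≤ l)
    (hh : 4 * (2 * h + 1) ^ d ≤ l) :
    l ^ d ≤ 2 * (Finset.univ.filter fun ξ : Fin d → ZMod l => IsGoodMod h ξ).card := by
  set box : Finset (Fin d → ℤ) :=
    (Fintype.piFinset fun _ => Finset.Icc (-(h : ℤ)) h).filter (· ≠ 0) with hbox
  set bad : Finset (Fin d → ZMod l) := (Finset.univ.filter fun ξ => ξ ⬝ᵥ Pi.single 0 1 = 0) ∪
    box.biUnion fun y => Finset.univ.filter fun ξ => ξ ⬝ᵥ redMod l y = 0 with hbad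
  have hl0 : 0 < l := by lia
  have hboxcard : box.card ≤ (2 * h + 1) ^ d := by
    refine (Finset.card_filter_le _ _).trans ?_
    rw [Fintype.card_piFinset]
    simp only [Int.card_Icc, Finset.prod_const, Finset.card_univ, Fintype.card_fin]
    apply Nat.pow_le_pow_left
    lia
  have hhl : h < l := by
    have : 2 * h + 1 ≤ (2 * h + 1) ^ d := Nat.le_self_pow (NeZero.ne d) _
    lia
  have hbadcard : bad.card * l ≤ l ^ d + (2 * h + 1) ^ d * l ^ d := by
    have h1 : (Finset.univ.filter fun ξ : Fin d → ZMod l =>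
        ξ ⬝ᵥ Pi.single 0 1 = 0).card * l = l ^ d :=
      card_orthogonal_mul _ (by
        intro hz
        have := congrFun hz 0
        simp at this)
    have h2 : (box.biUnion fun y => Finset.univ.filter fun ξ : Fin d → ZMod l =>
        ξ ⬝ᵥ redMod l y = 0).card * l ≤ box.card * l ^ d := by
      refine (Nat.mul_le_mul_right _ Finset.card_biUnion_le).trans ?_
      rw [Finset.sum_mul, ← smul_eq_mul, ← Finset.sum_const]
      refine Finset.sum_le_sum fun y hy => ?_
      simp only [hbox, Finset.mem_filter, Fintype.mem_piFinset, Finset.mem_Icc] at hy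
      refine (card_orthogonal_mul _ (redMod_ne_zero hy.2 fun j => ?_)).le
      have := abs_le.mpr (hy.1 j)
      lia
    calc bad.card * l ≤ (_ + _) * l := Nat.mul_le_mul_right _ (Finset.card_union_le _ _)
      _ ≤ l ^ d + (2 * h + 1) ^ d * l ^ d := by
        rw [add_mul, h1]
        exact Nat.add_le_add_left (h2.trans (Nat.mul_le_mul_right _ hboxcard)) _
  have hcover : (Finset.univ : Finset (Fin d → ZMod l)) ⊆
      (Finset.univ.filter fun ξ : Fin d → ZMod l => IsGoodMod h ξ) ∪ bad := by
    intro ξ _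
    by_cases hg : IsGoodMod h ξ
    · simp [hg]
    · apply Finset.mem_union_right
      simp only [IsGoodMod, not_and_or, not_not, not_forall] at hg
      rcases hg with hg | ⟨y, hy, hb, hg⟩
      · apply Finset.mem_union_left
        simpa using hg
      · apply Finset.mem_union_right
        simp only [Finset.mem_biUnion, Finset.mem_filter, Finset.mem_univ, true_and]
        refine ⟨y, ?_, hg⟩
        simp only [hbox, Finset.mem_filter, Fintype.mem_piFinset, Finset.mem_Icc]
        exact ⟨fun j => abs_le.mp (hb j), hy⟩
  have hc := (Finset.card_le_card hcover).trans (Finset.card_union_le _ _)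
  rw [Finset.card_univ, Fintype.card_fun, ZMod.card, Fintype.card_fin] at hc
  have hb2 : 2 * bad.card ≤ l ^ d := by
    have h4 : bad.card * l * 2 ≤ l ^ d * l := by
      have : (1 + (2 * h + 1) ^ d) * 2 ≤ l := by lia
      calc bad.card * l * 2 ≤ (l ^ d + (2 * h + 1) ^ d * l ^ d) * 2 :=
            Nat.mul_le_mul_right _ hbadcard
        _ = l ^ d * ((1 + (2 * h + 1) ^ d) * 2) := by ring
        _ ≤ l ^ d * l := Nat.mul_le_mul_left _ this
    have : 2 * bad.card * l ≤ l ^ d * l := by lia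
    exact Nat.le_of_mul_le_mul_right this hl0
  lia

/-- Pigeonhole: a box with more than `l` points contains two points with the same pairing
against `ξ` modulo `l`. -/
theorem exists_orthogonal_in_box {l d : ℕ} [Fact l.Prime] (ξ : Fin d → ZMod l) (w : Fin d → ℕ)
    (hw : l < ∏ j, w j) :
    ∃ y : Fin d → ℤ, y ≠ 0 ∧ (∀ j, |y j| < w j) ∧ ξ ⬝ᵥ redMod l y = 0 := by
  classical
  obtain ⟨a, ha, b, hb, hab, h⟩ := Finset.exists_ne_map_eq_of_card_lt_of_maps_to
    (s := Fintype.piFinset fun j => Finset.Ico (0 : ℤ) (w j)) (t := Finset.univ)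
    (f := fun y => ξ ⬝ᵥ redMod l y) (by
      rw [Fintype.card_piFinset, Finset.card_univ, ZMod.card]
      simpa using hw) (fun _ _ => Finset.mem_coe.mpr (Finset.mem_univ _))
  refine ⟨a - b, sub_ne_zero.mpr hab, fun j => ?_, ?_⟩
  · have h1 := Fintype.mem_piFinset.mp ha j
    have h2 := Fintype.mem_piFinset.mp hb j
    rw [Finset.mem_Ico] at h1 h2
    rw [Pi.sub_apply, abs_lt]
    constructor <;> lia
  · have : redMod l (a - b) = redMod l a - redMod l b := by
      funext j; simp [redMod]
    rw [this, dotProduct_sub, sub_eq_zero]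
    exact h

/-- For a good `ξ` there is a nonsingular integer matrix of small size whose columns are
orthogonal to `ξ` modulo `l`. -/
theorem exists_nonsingular_of_good {l d : ℕ} [Fact l.Prime] [NeZero d] {X : ℝ} (hX : 0 < X)
    (hXl : X ^ d = l) {ξ : Fin d → ZMod l} (hξ : IsGoodMod ⌊X / 8⌋₊ ξ) :
    ∃ B : Matrix (Fin d) (Fin d) ℤ, B.det ≠ 0 ∧
      (∀ i j, |(B i j : ℝ)| ≤ (16 * d) ^ (d - 1) * X) ∧
      ∀ j, ξ ⬝ᵥ redMod l (fun i => B i j) = 0 := by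
  have hd0 : 0 < d := Nat.pos_of_ne_zero (NeZero.ne d)
  have hd1 : (1 : ℝ) ≤ d := by exact_mod_cast hd0
  have hc1 : (1 : ℝ) ≤ (16 * d) ^ (d - 1) := one_le_pow₀ (by linarith)
  have key : ∀ i : Fin d, ∃ y : Fin d → ℤ, (∀ j, j ≠ i → |(y j : ℝ)| ≤ X / (16 * d)) ∧
      X / 8 < |(y i : ℝ)| ∧ |(y i : ℝ)| ≤ (16 * d) ^ (d - 1) * X ∧ ξ ⬝ᵥ redMod l y = 0 := by
    intro i
    set a : ℕ := ⌊X / (16 * d)⌋₊ + 1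
    set b : ℕ := ⌊(16 * d) ^ (d - 1) * X⌋₊ + 1
    have hprod : l < ∏ j, (if j = i then b else a) := by
      have h1 : ∏ j, (if j = i then b else a) = b * a ^ (d - 1) := by
        rw [← Finset.mul_prod_erase Finset.univ _ (Finset.mem_univ i)]
        simp only [if_true]
        congr 1
        rw [Finset.prod_congr rfl (g := fun _ => a)
          (fun x hx => if_neg (Finset.ne_of_mem_erase hx))]
        simp
      rw [h1]
      have ha : X / (16 * d) < a := by
        simpa [a] using Nat.lt_floor_add_one (X / (16 * d))
      have hb : (16 * d) ^ (d - 1) * X < b := by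
        simpa [b] using Nat.lt_floor_add_one ((16 * d : ℝ) ^ (d - 1) * X)
      have h2 : (l : ℝ) < b * a ^ (d - 1) := by
        calc (l : ℝ) = ((16 * d) ^ (d - 1) * X) * (X / (16 * d)) ^ (d - 1) := by
              rw [← hXl, div_pow]
              field_simp
              rw [← pow_succ']
              congr 1
              lia
          _ < b * (X / (16 * d)) ^ (d - 1) := by
              apply mul_lt_mul_of_pos_right hb
              positivity
          _ ≤ b * a ^ (d - 1) := by gcongr
      exact_mod_cast h2
    obtain ⟨y, hy0, hyb, hyξ⟩ := exists_orthogonal_in_box ξ _ hprod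
    have hoff : ∀ j, j ≠ i → |(y j : ℝ)| ≤ X / (16 * d) := by
      intro j hj
      have h1 := hyb j
      rw [if_neg hj] at h1
      have h2 : |y j| ≤ (⌊X / (16 * d)⌋₊ : ℤ) := by simp only [a] at h1; push_cast at h1; lia
      calc |(y j : ℝ)| ≤ (⌊X / (16 * d)⌋₊ : ℝ) := by exact_mod_cast h2
        _ ≤ _ := Nat.floor_le (by positivity)
    have hon : |(y i : ℝ)| ≤ (16 * d) ^ (d - 1) * X := by
      have h1 := hyb i
      rw [if_pos rfl] at h1
      have h2 : |y i| ≤ (⌊(16 * d : ℝ) ^ (d - 1) * X⌋₊ : ℤ) := by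
        simp only [b] at h1; push_cast at h1; lia
      calc |(y i : ℝ)| ≤ (⌊(16 * d : ℝ) ^ (d - 1) * X⌋₊ : ℝ) := by exact_mod_cast h2
        _ ≤ _ := Nat.floor_le (by positivity)
    refine ⟨y, hoff, ?_, hon, hyξ⟩
    by_contra hcon
    push Not at hcon
    refine hξ.2 y hy0 (fun j => ?_) hyξ
    have h3 : |(y j : ℝ)| ≤ X / 8 := by
      by_cases hj : j = i
      · rw [hj]; exact hcon
      · refine (hoff j hj).trans ?_
        apply div_le_div_of_nonneg_left hX.le (by norm_num) (by linarith)
    have : ((|y j|).toNat : ℕ) ≤ ⌊X / 8⌋₊ := by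
      apply Nat.le_floor
      rw [← Int.cast_natCast, Int.toNat_of_nonneg (abs_nonneg _)]
      exact_mod_cast h3
    have h0 := abs_nonneg (y j)
    lia
  choose y hoff hbig hon hyξ using key
  refine ⟨Matrix.of fun i j => y j i, ?_, fun i j => ?_, fun j => hyξ j⟩
  · have hdet : (Matrix.of fun i j => (y j i : ℝ)).det ≠ 0 := by
      apply det_ne_zero_of_sum_col_lt_diag
      intro k
      simp only [Matrix.of_apply, Real.norm_eq_abs]
      calc ∑ i ∈ Finset.univ.erase k, |(y k i : ℝ)|
          ≤ ∑ i ∈ Finset.univ.erase k, X / (16 * d) :=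
            Finset.sum_le_sum fun i hi => hoff k i (Finset.ne_of_mem_erase hi)
        _ ≤ d * (X / (16 * d)) := by
            rw [Finset.sum_const, nsmul_eq_mul]
            gcongr
            exact_mod_cast (Finset.card_le_univ _).trans (by simp)
        _ = X / 16 := by field_simp
        _ < X / 8 := by linarith
        _ < _ := hbig k
    intro h
    apply hdet
    have h5 : (Matrix.of fun i j => (y j i : ℝ)) =
        (Int.castRingHom ℝ).mapMatrix (Matrix.of fun i j => y j i) := by
      ext; simp
    rw [h5, ← RingHom.map_det, h, map_zero]
  · simp only [Matrix.of_apply]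
    by_cases h : i = j
    · rw [h]; exact hon j
    · refine (hoff j i h).trans ?_
      calc X / (16 * d) ≤ X / 1 := by
            apply div_le_div_of_nonneg_left hX.le (by norm_num) (by linarith)
        _ = 1 * X := by ring
        _ ≤ _ := by gcongr

/-- Integer matrices with bounded nonzero determinant have, modulo a fixed `W`, representatives
of the same determinant with uniformly bounded adjugate. -/
theorem exists_bounded_representative (d W J : ℕ) [NeZero W] :
    ∃ K : ℕ, ∀ A : Matrix (Fin d) (Fin d) ℤ, |A.det| ≤ J →
      ∃ A' E : Matrix (Fin d) (Fin d) ℤ, A'.det = A.det ∧ A = A' + (W : ℤ) • E ∧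
        ∀ i j, |A'.adjugate i j| ≤ K := by
  classical
  let T := (Matrix (Fin d) (Fin d) (ZMod W)) × Finset.Icc (-(J : ℤ)) J
  have key : ∀ t : T, ∃ K : ℕ, ∀ A : Matrix (Fin d) (Fin d) ℤ,
      A.map (Int.cast : ℤ → ZMod W) = t.1 → A.det = t.2 →
      ∃ A' E : Matrix (Fin d) (Fin d) ℤ, A'.det = A.det ∧ A = A' + (W : ℤ) • E ∧
        ∀ i j, |A'.adjugate i j| ≤ K := by
    intro t
    by_cases h : ∃ A' : Matrix (Fin d) (Fin d) ℤ,
        A'.map (Int.cast : ℤ → ZMod W) = t.1 ∧ A'.det = t.2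
    · obtain ⟨A', h1, h2⟩ := h
      refine ⟨∑ i, ∑ j, (A'.adjugate i j).natAbs, fun A hA1 hA2 => ?_⟩
      have hdiv : ∀ i j, ∃ e, A i j - A' i j = W * e := by
        intro i j
        have : ((A i j - A' i j : ℤ) : ZMod W) = 0 := by
          have := congrFun (congrFun (hA1.trans h1.symm) i) j
          simp only [Matrix.map_apply] at this
          push_cast
          rw [this, sub_self]
        rwa [ZMod.intCast_zmod_eq_zero_iff_dvd] at this
      choose e he using hdiv
      refine ⟨A', Matrix.of e, h2.trans hA2.symm, ?_, fun i j => ?_⟩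
      · ext i j
        simp only [Matrix.add_apply, Matrix.smul_apply, Matrix.of_apply, smul_eq_mul]
        linarith [he i j]
      · rw [Int.abs_eq_natAbs]
        exact_mod_cast (Finset.single_le_sum (f := fun j => (A'.adjugate i j).natAbs)
          (fun _ _ => Nat.zero_le _) (Finset.mem_univ j)).trans
          (Finset.single_le_sum (f := fun i => ∑ j, (A'.adjugate i j).natAbs)
          (fun _ _ => Nat.zero_le _) (Finset.mem_univ i))
    · exact ⟨0, fun A h1 h2 => absurd ⟨A, h1, h2⟩ h⟩
  choose K hK using key
  refine ⟨∑ t : T, K t, fun A hA => ?_⟩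
  let t : T := (A.map (Int.cast : ℤ → ZMod W), ⟨A.det, Finset.mem_Icc.mpr (abs_le.mp hA)⟩)
  obtain ⟨A', E, h1, h2, h3⟩ := hK t A rfl rfl
  refine ⟨A', E, h1, h2, fun i j => (h3 i j).trans ?_⟩
  exact_mod_cast Finset.single_le_sum (f := K) (fun _ _ => Nat.zero_le _) (Finset.mem_univ t)

/-- Given a nonsingular sublattice `B A`, one can change the basis `B` by an element of
`SL_d(ℤ)` congruent to `1` modulo `N` so that its size is controlled by that of `B A`. -/
theorem exists_unimodular_reduction (d N J : ℕ) (hN : 0 < N) :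
    ∃ K : ℕ, ∀ (A B : Matrix (Fin d) (Fin d) ℤ) (Y : ℝ), A.det ≠ 0 → |A.det| ≤ J →
      (∀ i j, |((B * A) i j : ℝ)| ≤ Y) →
      ∃ γ E : Matrix (Fin d) (Fin d) ℤ, γ.det = 1 ∧ γ = 1 + (N : ℤ) • E ∧
        ∀ i j, |((B * γ) i j : ℝ)| ≤ K * Y := by
  have : NeZero (J.factorial * N) := ⟨by positivity⟩
  obtain ⟨K, hK⟩ := exists_bounded_representative d (J.factorial * N) J
  refine ⟨d * K, fun A B Y hA0 hA hY => ?_⟩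
  obtain ⟨A', E, hdet, hAE, hadj⟩ := hK A hA
  obtain ⟨q, hq⟩ : A.det ∣ (J.factorial : ℤ) := by
    have h1 : A.det.natAbs ∣ J.factorial :=
      Nat.dvd_factorial (Int.natAbs_pos.mpr hA0) (by
        rw [Int.abs_eq_natAbs] at hA
        exact_mod_cast hA)
    exact Int.natAbs_dvd.mp (Int.natCast_dvd_natCast.mpr h1)
  set F : Matrix (Fin d) (Fin d) ℤ := q • E with hF
  have hAF : A = A' + A.det • ((N : ℤ) • F) := by
    conv_lhs => rw [hAE]
    rw [hF, smul_smul, smul_smul]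
    congr 2
    push_cast
    rw [hq]
    ring
  have hγA : (1 + (N : ℤ) • (F * A'.adjugate)) * A' = A := by
    conv_rhs => rw [hAF]
    rw [add_mul, one_mul, smul_mul_assoc, mul_assoc, adjugate_mul, hdet, mul_smul_comm, mul_one,
      smul_comm]
  refine ⟨1 + (N : ℤ) • (F * A'.adjugate), F * A'.adjugate, ?_, rfl, fun i j => ?_⟩
  · have h := congrArg Matrix.det hγA
    rw [det_mul, hdet] at h
    exact mul_right_cancel₀ hA0 (h.trans (one_mul _).symm)
  · set γ := 1 + (N : ℤ) • (F * A'.adjugate)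
    have h1 : A.det • (B * γ) = (B * A) * A'.adjugate := by
      conv_rhs => rw [← hγA]
      rw [mul_assoc, mul_assoc, mul_adjugate, hdet, mul_smul_comm, mul_one, mul_smul_comm]
    have h2 : (A.det : ℝ) * ((B * γ) i j : ℝ) = ∑ k, ((B * A) i k : ℝ) * (A'.adjugate k j : ℝ) := by
      have := congrFun (congrFun h1 i) j
      rw [Matrix.smul_apply, smul_eq_mul, Matrix.mul_apply] at this
      exact_mod_cast this
    have h3 : (1 : ℝ) ≤ |(A.det : ℝ)| := by exact_mod_cast Int.one_le_abs hA0
    calc |((B * γ) i j : ℝ)| ≤ |(A.det : ℝ)| * |((B * γ) i j : ℝ)| :=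
          le_mul_of_one_le_left (abs_nonneg _) h3
      _ = |∑ k, ((B * A) i k : ℝ) * (A'.adjugate k j : ℝ)| := by rw [← abs_mul, h2]
      _ ≤ ∑ k, |((B * A) i k : ℝ) * (A'.adjugate k j : ℝ)| := Finset.abs_sum_le_sum_abs _ _
      _ ≤ ∑ _k : Fin d, Y * K := by
          refine Finset.sum_le_sum fun k _ => ?_
          rw [abs_mul]
          exact mul_le_mul (hY i k) (by exact_mod_cast hadj k j) (abs_nonneg _)
            ((abs_nonneg _).trans (hY i k))
      _ = _ := by
          rw [Finset.sum_const, Finset.card_univ, Fintype.card_fin, nsmul_eq_mul]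
          push_cast
          ring

/-- A basis, congruent to the identity modulo `N`, of the lattice of integer vectors orthogonal
to `ξ` modulo `l`. -/
theorem exists_hyperplane_basis {l d N : ℕ} [Fact l.Prime] [NeZero d] (hlN : l ≡ 1 [MOD N])
    {ξ : Fin d → ZMod l} (hξ : ξ 0 ≠ 0) :
    ∃ B E : Matrix (Fin d) (Fin d) ℤ, B.det = l ∧ B = 1 + (N : ℤ) • E ∧
      ∀ y : Fin d → ℤ, (∃ x, y = B *ᵥ x) ↔ ξ ⬝ᵥ redMod l y = 0 := by
  classical
  have hcop : Nat.Coprime l N := by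
    have := hlN.gcd_eq
    rwa [Nat.gcd_one_left] at this
  have hl : l ≠ 0 := (Fact.out : l.Prime).ne_zero
  obtain ⟨e, he⟩ : (N : ℤ) ∣ (l : ℤ) - 1 := by
    exact (Nat.modEq_iff_dvd.mp hlN.symm)
  have ht : ∀ j, ∃ t : ℕ, ((N * t : ℤ) : ZMod l) = - ξ j / ξ 0 := by
    intro j
    have hN0 : (N : ZMod l) ≠ 0 := by
      rw [Ne, ZMod.natCast_eq_zero_iff]
      intro h
      have := Nat.Coprime.eq_one_of_dvd hcop h
      exact (Fact.out : l.Prime).one_lt.ne' this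
    refine ⟨((- ξ j / ξ 0) / (N : ZMod l)).val, ?_⟩
    push_cast
    rw [ZMod.natCast_zmod_val]
    field_simp
  choose t ht using ht
  set E : Matrix (Fin d) (Fin d) ℤ :=
    Matrix.of fun i j => if i = 0 then (if j = 0 then e else t j) else 0 with hE
  have hform : ∀ x : Fin d → ℤ, ∀ i, ((1 + (N : ℤ) • E) *ᵥ x) i =
      if i = 0 then l * x 0 + ∑ j ∈ Finset.univ.erase 0, N * t j * x j else x i := by
    intro x i
    rw [add_mulVec, one_mulVec, smul_mulVec, Pi.add_apply, Pi.smul_apply, smul_eq_mul]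
    by_cases hi : i = 0
    · subst hi
      rw [if_pos rfl, mulVec, dotProduct, ← Finset.add_sum_erase _ _ (Finset.mem_univ 0)]
      have h1 : ∑ j ∈ Finset.univ.erase 0, E 0 j * x j =
          ∑ j ∈ Finset.univ.erase 0, t j * x j := by
        refine Finset.sum_congr rfl fun j hj => ?_
        simp [hE, Finset.ne_of_mem_erase hj]
      rw [h1, mul_add, Finset.mul_sum]
      simp only [hE, of_apply, if_true]
      have : (l : ℤ) = 1 + N * e := by linarith
      rw [this]
      simp only [mul_assoc]
      ring
    · rw [if_neg hi]
      simp [mulVec, dotProduct, hE, hi]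
  have hlξ : ∀ y : Fin d → ℤ, ξ ⬝ᵥ redMod l y =
      ξ 0 * ((y 0 - ∑ j ∈ Finset.univ.erase 0, N * t j * y j : ℤ) : ZMod l) := by
    intro y
    rw [dotProduct, ← Finset.add_sum_erase _ _ (Finset.mem_univ 0)]
    push_cast
    rw [mul_sub, sub_eq_add_neg, Finset.mul_sum, ← Finset.sum_neg_distrib]
    congr 1
    refine Finset.sum_congr rfl fun j _ => ?_
    have := ht j
    push_cast at this
    rw [this, redMod]
    field_simp
  refine ⟨1 + (N : ℤ) • E, E, ?_, rfl, fun y => ?_⟩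
  · have hup : (1 + (N : ℤ) • E).BlockTriangular id := by
      intro i j hij
      have hi : i ≠ 0 := fun h => by
        rw [h] at hij
        exact absurd hij (by simp)
      have hij' : i ≠ j := ne_of_gt hij
      simp [hE, hi, hij']
    rw [det_of_isUpperTriangular hup, ← Finset.mul_prod_erase _ _ (Finset.mem_univ 0),
      Finset.prod_congr rfl (g := fun _ => (1 : ℤ)) (fun j hj => by
        simp [hE, Finset.ne_of_mem_erase hj])]
    simp [hE]
    linarith
  · rw [hlξ, mul_eq_zero, or_iff_right hξ, ZMod.intCast_zmod_eq_zero_iff_dvd]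
    constructor
    · rintro ⟨x, rfl⟩
      refine ⟨x 0, ?_⟩
      have h1 : ∑ j ∈ Finset.univ.erase 0, (N : ℤ) * t j * ((1 + (N : ℤ) • E) *ᵥ x) j =
          ∑ j ∈ Finset.univ.erase 0, (N : ℤ) * t j * x j :=
        Finset.sum_congr rfl fun j hj => by rw [hform, if_neg (Finset.ne_of_mem_erase hj)]
      rw [h1, hform, if_pos rfl]
      ring
    · rintro ⟨q, hq⟩
      refine ⟨fun j => if j = 0 then q else y j, ?_⟩
      funext i
      rw [hform]
      by_cases hi : i = 0
      · subst hi
        rw [if_pos rfl, if_pos rfl, Finset.sum_congr rfl (fun j hj => by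
          rw [if_neg (Finset.ne_of_mem_erase hj)])]
        linarith
      · rw [if_neg hi, if_neg hi]

open Classical in
/-- For at least half of the `ξ` modulo `l`, the index-`l` lattice of integer vectors orthogonal
to `ξ` has a basis which is congruent to `1` modulo `N` and whose entries are of the optimal
order `l ^ (1 / d)`. -/
theorem exists_reduced_hyperplane_bases (d N : ℕ) [NeZero d] (hd : 2 ≤ d) (hN : 0 < N) :
    ∃ K : ℝ, 0 < K ∧ ∀ l : ℕ, ∀ _ : Fact l.Prime, l ≡ 1 [MOD N] → ∀ X : ℝ, 8 ≤ X → X ^ d = l →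
      ∃ Good : Finset (Fin d → ZMod l), l ^ d ≤ 2 * Good.card ∧ ∀ ξ ∈ Good,
        ∃ C E : Matrix (Fin d) (Fin d) ℤ, C.det = l ∧ C = 1 + (N : ℤ) • E ∧
          (∀ i j, |(C i j : ℝ)| ≤ K * X) ∧
          ∀ y : Fin d → ℤ, (∃ x, y = C *ᵥ x) ↔ ξ ⬝ᵥ redMod l y = 0 := by
  have hd0 : 0 < d := Nat.pos_of_ne_zero (NeZero.ne d)
  set c : ℕ := (16 * d) ^ (d - 1) with hc
  obtain ⟨K, hK⟩ := exists_unimodular_reduction d N (d.factorial * c ^ d) hN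
  refine ⟨K * c + 1, by positivity, fun l hl hlN X hX hXl => ?_⟩
  have hX0 : 0 < X := by linarith
  refine ⟨Finset.univ.filter fun ξ => IsGoodMod ⌊X / 8⌋₊ ξ, card_good_mod _ ?_ ?_,
    fun ξ hξ => ?_⟩
  · have : (8 : ℝ) ≤ l := by
      rw [← hXl]
      exact hX.trans (le_self_pow₀ (by linarith) hd0.ne')
    have : 8 ≤ l := by exact_mod_cast this
    lia
  · have h1 : (⌊X / 8⌋₊ : ℝ) ≤ X / 8 := Nat.floor_le (by positivity)
    have h2 : (4 : ℝ) * (2 * ⌊X / 8⌋₊ + 1) ^ d ≤ l := by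
      calc (4 : ℝ) * (2 * ⌊X / 8⌋₊ + 1) ^ d ≤ 4 * ((1 / 2) * X) ^ d := by
            gcongr
            linarith
        _ ≤ 4 * ((1 / 2) ^ 2 * X ^ d) := by
            rw [mul_pow]
            gcongr 4 * (?_ * _)
            exact pow_le_pow_of_le_one (by norm_num) (by norm_num) hd
        _ = X ^ d := by ring
        _ = l := hXl
    exact_mod_cast h2
  · have hξ' := (Finset.mem_filter.mp hξ).2
    obtain ⟨B', hB0, hBX, hBξ⟩ := exists_nonsingular_of_good hX0 hXl hξ'
    obtain ⟨B, E, hBdet, hBE, hBy⟩ := exists_hyperplane_basis (N := N) hlN hξ'.1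
    choose A hA using fun j => (hBy _).mpr (hBξ j)
    have hBA : B * (Matrix.of fun i j => A j i) = B' := by
      ext i j
      have := congrFun (hA j) i
      rw [this]
      rfl
    set A' : Matrix (Fin d) (Fin d) ℤ := Matrix.of fun i j => A j i
    have hdet : (l : ℤ) * A'.det = B'.det := by rw [← hBA, det_mul, hBdet]
    have hA0 : A'.det ≠ 0 := fun h => hB0 (by rw [← hdet, h, mul_zero])
    have hl0 : (0 : ℝ) < l := by exact_mod_cast hl.out.pos
    have hAJ : |A'.det| ≤ ((d.factorial * c ^ d : ℕ) : ℤ) := by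
      have h1 : |(B'.det : ℝ)| ≤ d.factorial * (c * X) ^ d := by
        have := Matrix.det_le (A := B'.map (Int.cast : ℤ → ℝ)) (abv := AbsoluteValue.abs)
          (x := c * X) (fun i j => by
            simpa [hc] using hBX i j)
        have h2 : (B'.map (Int.cast : ℤ → ℝ)).det = (B'.det : ℝ) :=
          ((Int.castRingHom ℝ).map_det B').symm
        rw [h2] at this
        simpa using this
      rw [mul_pow, hXl, ← hdet] at h1
      rw [Int.cast_mul, Int.cast_natCast, abs_mul, Nat.abs_cast] at h1
      have h3 : |(A'.det : ℝ)| ≤ d.factorial * c ^ d := by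
        have : (l : ℝ) * |(A'.det : ℝ)| ≤ l * (d.factorial * c ^ d) := by linarith
        exact le_of_mul_le_mul_left this hl0
      exact_mod_cast h3
    obtain ⟨γ, F, hγ1, hγ, hγb⟩ := hK A' B (c * X) hA0 hAJ (fun i j => by
      rw [hBA]; simpa [hc] using hBX i j)
    refine ⟨B * γ, E + F + (N : ℤ) • (E * F), ?_, ?_, fun i j => ?_, fun y => ?_⟩
    · rw [det_mul, hBdet, hγ1, mul_one]
    · rw [hBE, hγ, add_mul, one_mul, mul_add, mul_one, smul_mul_smul_comm, smul_add, smul_add,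
        smul_smul]
      abel
    · refine (hγb i j).trans ?_
      nlinarith
    · rw [← hBy]
      constructor
      · rintro ⟨x, hx⟩
        exact ⟨γ *ᵥ x, by rw [hx, mulVec_mulVec]⟩
      · rintro ⟨x, hx⟩
        refine ⟨γ.adjugate *ᵥ x, ?_⟩
        rw [hx, mulVec_mulVec, mul_assoc, mul_adjugate, hγ1, one_smul, mul_one]

/-- Two vectors are parallel if all their `2 × 2` minors vanish. -/
def IsParallel {ι R : Type*} [Mul R] (y w : ι → R) : Prop := ∀ i j, y i * w j = y j * w i

open Classical in
/-- Second moment of the number of points of a finite set of short integer vectors on a random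
hyperplane modulo `l`. -/
theorem second_moment_mod {l d : ℕ} [Fact l.Prime] (Z : Finset (Fin d → ℤ)) (H : ℝ)
    (hH : 2 * H ^ 2 < l) (hHl : H < l) (hZ0 : ∀ y ∈ Z, y ≠ 0) (hZ : ∀ y ∈ Z, ∀ j, |(y j : ℝ)| ≤ H)
    (V : ℝ) :
    ∑ ξ : Fin d → ZMod l, (((Z.filter fun y => ξ ⬝ᵥ redMod l y = 0).card : ℝ) - V) ^ 2 ≤
      (l : ℝ) ^ d * ((Z.card / l - V) ^ 2 +
        ((Z ×ˢ Z).filter fun q => IsParallel q.1 q.2).card / l) := by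
  have hl0 : (0 : ℝ) < l := by exact_mod_cast (Fact.out : l.Prime).pos
  have hone : ∀ y ∈ Z, ((Finset.univ.filter fun ξ : Fin d → ZMod l =>
      ξ ⬝ᵥ redMod l y = 0).card : ℝ) = l ^ d / l := by
    intro y hy
    rw [eq_div_iff hl0.ne']
    exact_mod_cast card_orthogonal_mul _ (redMod_ne_zero (hZ0 y hy) fun j => by
      exact_mod_cast (hZ y hy j).trans_lt hHl)
  have htwo : ∀ q ∈ Z ×ˢ Z, ((Finset.univ.filter fun ξ : Fin d → ZMod l =>
      ξ ⬝ᵥ redMod l q.1 = 0 ∧ ξ ⬝ᵥ redMod l q.2 = 0).card : ℝ) ≤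
        l ^ d / l ^ 2 + if IsParallel q.1 q.2 then (l : ℝ) ^ d / l else 0 := by
    rintro ⟨y, w⟩ hq
    rw [Finset.mem_product] at hq
    by_cases hp : IsParallel y w
    · rw [if_pos hp]
      calc _ ≤ ((Finset.univ.filter fun ξ : Fin d → ZMod l => ξ ⬝ᵥ redMod l y = 0).card : ℝ) := by
            exact_mod_cast Finset.card_le_card fun ξ hξ => by
              simp only [Finset.mem_filter] at hξ ⊢
              exact ⟨hξ.1, hξ.2.1⟩
        _ = l ^ d / l := hone y hq.1
        _ ≤ _ := le_add_of_nonneg_left (by positivity)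
    · rw [if_neg hp, add_zero]
      apply le_of_eq
      rw [eq_div_iff (by positivity)]
      simp only [IsParallel, not_forall] at hp
      obtain ⟨i, j, hij⟩ := hp
      have hne : ((y i * w j - y j * w i : ℤ) : ZMod l) ≠ 0 := by
        rw [Ne, ZMod.intCast_zmod_eq_zero_iff_dvd]
        intro hdvd
        apply sub_ne_zero.mpr hij
        apply Int.eq_zero_of_abs_lt_dvd hdvd
        have h1 : |((y i * w j - y j * w i : ℤ) : ℝ)| < l := by
          push_cast
          calc |(y i : ℝ) * w j - y j * w i| ≤ |(y i : ℝ) * w j| + |(y j : ℝ) * w i| := abs_sub _ _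
            _ ≤ H * H + H * H := by
              rw [abs_mul, abs_mul]
              have h0 : 0 ≤ H := (abs_nonneg _).trans (hZ y hq.1 i)
              exact add_le_add
                (mul_le_mul (hZ y hq.1 i) (hZ w hq.2 j) (abs_nonneg _) h0)
                (mul_le_mul (hZ y hq.1 j) (hZ w hq.2 i) (abs_nonneg _) h0)
            _ < l := by linarith
        exact_mod_cast h1
      exact_mod_cast card_orthogonal_pair_mul (redMod l y) (redMod l w) i j (by
        simpa [redMod] using hne)
  have hsum1 : ∑ ξ : Fin d → ZMod l, ((Z.filter fun y => ξ ⬝ᵥ redMod l y = 0).card : ℝ) =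
      Z.card * (l ^ d / l) := by
    calc _ = ∑ ξ : Fin d → ZMod l, ∑ y ∈ Z, (if ξ ⬝ᵥ redMod l y = 0 then (1 : ℝ) else 0) := by
          simp
      _ = ∑ y ∈ Z, ((Finset.univ.filter fun ξ : Fin d → ZMod l =>
            ξ ⬝ᵥ redMod l y = 0).card : ℝ) := by
          rw [Finset.sum_comm]
          simp
      _ = _ := by rw [Finset.sum_congr rfl hone, Finset.sum_const, nsmul_eq_mul]
  have hsum2 : ∑ ξ : Fin d → ZMod l, ((Z.filter fun y => ξ ⬝ᵥ redMod l y = 0).card : ℝ) ^ 2 ≤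
      Z.card ^ 2 * (l ^ d / l ^ 2) +
        ((Z ×ˢ Z).filter fun q => IsParallel q.1 q.2).card * (l ^ d / l) := by
    calc _ = ∑ ξ : Fin d → ZMod l, ∑ q ∈ Z ×ˢ Z,
          (if ξ ⬝ᵥ redMod l q.1 = 0 ∧ ξ ⬝ᵥ redMod l q.2 = 0 then (1 : ℝ) else 0) := by
          refine Finset.sum_congr rfl fun ξ _ => ?_
          rw [Finset.sum_boole, pow_two, ← Nat.cast_mul, ← Finset.card_product,
            ← Finset.filter_product]
      _ = ∑ q ∈ Z ×ˢ Z, ((Finset.univ.filter fun ξ : Fin d → ZMod l =>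
            ξ ⬝ᵥ redMod l q.1 = 0 ∧ ξ ⬝ᵥ redMod l q.2 = 0).card : ℝ) := by
          rw [Finset.sum_comm]
          simp
      _ ≤ ∑ q ∈ Z ×ˢ Z, (l ^ d / l ^ 2 + if IsParallel q.1 q.2 then (l : ℝ) ^ d / l else 0) :=
          Finset.sum_le_sum htwo
      _ = _ := by
          rw [Finset.sum_add_distrib, Finset.sum_const, ← Finset.sum_filter, Finset.sum_const,
            nsmul_eq_mul, nsmul_eq_mul, Finset.card_product]
          push_cast
          ring
  have hcard : (Fintype.card (Fin d → ZMod l) : ℝ) = l ^ d := by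
    rw [Fintype.card_fun, ZMod.card, Fintype.card_fin]
    push_cast
    rfl
  calc ∑ ξ : Fin d → ZMod l, (((Z.filter fun y => ξ ⬝ᵥ redMod l y = 0).card : ℝ) - V) ^ 2
      = ∑ ξ : Fin d → ZMod l, ((Z.filter fun y => ξ ⬝ᵥ redMod l y = 0).card : ℝ) ^ 2
        - 2 * V * ∑ ξ : Fin d → ZMod l, ((Z.filter fun y => ξ ⬝ᵥ redMod l y = 0).card : ℝ)
        + l ^ d * V ^ 2 := by
        rw [Finset.mul_sum, ← Finset.sum_sub_distrib, ← hcard, ← nsmul_eq_mul,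
          ← Finset.card_univ, ← Finset.sum_const, ← Finset.sum_add_distrib]
        refine Finset.sum_congr rfl fun ξ _ => by ring
    _ ≤ _ := by
        rw [hsum1]
        refine (add_le_add_left (sub_le_sub_right hsum2 _) _).trans (le_of_eq ?_)
        field_simp
        ring

theorem finite_lattice_points {d : ℕ} {S : Set (Fin d → ℝ)} (hb : Bornology.IsBounded S)
    (u : Fin d → ℝ) {q X : ℝ} (hq : 0 < q) (hX : 0 < X) :
    {t : Fin d → ℤ | (fun j => (u j + q * t j) / X) ∈ S}.Finite := by
  obtain ⟨r, hr⟩ := hb.exists_norm_le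
  apply (Set.Finite.pi' fun j : Fin d =>
    Set.finite_Icc (⌊(-(r * X) - u j) / q⌋) (⌈(r * X - u j) / q⌉)).subset
  intro t ht j
  have h1 := (norm_le_pi_norm _ j).trans (hr _ ht)
  rw [Real.norm_eq_abs, abs_div, abs_of_pos hX, div_le_iff₀ hX, abs_le] at h1
  constructor
  · rw [← Int.cast_le (R := ℝ)]
    refine (Int.floor_le _).trans ?_
    rw [div_le_iff₀ hq]
    linarith
  · rw [← Int.cast_le (R := ℝ)]
    refine le_trans ?_ (Int.le_ceil _)
    rw [le_div_iff₀ hq]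
    linarith

/-- A point of `S` near a point outside `S` is near the frontier of `S`. -/
theorem mem_cthickening_frontier {d : ℕ} {S : Set (Fin d → ℝ)} {x y : Fin d → ℝ} {ε : ℝ}
    (hx : x ∈ S) (hy : y ∉ S) (h : dist x y ≤ ε) :
    x ∈ Metric.cthickening ε (frontier S) ∧ y ∈ Metric.cthickening ε (frontier S) := by
  obtain ⟨w, hw1, hw2⟩ : ∃ w ∈ segment ℝ x y, w ∈ frontier S := by
    by_contra! hcon
    have hx' : x ∈ interior S := by
      by_contra h'
      exact hcon x (left_mem_segment ℝ x y) ⟨subset_closure hx, h'⟩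
    have hy' : y ∈ (closure S)ᶜ := fun h' =>
      hcon y (right_mem_segment ℝ x y) ⟨h', fun h'' => hy (interior_subset h'')⟩
    obtain ⟨w, -, hw1, hw2⟩ := (convex_segment (𝕜 := ℝ) x y).isPreconnected (interior S)
      (closure S)ᶜ isOpen_interior isClosed_closure.isOpen_compl
      (fun w hw => by
        by_cases h1 : w ∈ closure S
        · left
          by_contra h2
          exact hcon w hw ⟨h1, h2⟩
        · exact Or.inr h1)
      ⟨x, left_mem_segment ℝ x y, hx'⟩ ⟨y, right_mem_segment ℝ x y, hy'⟩
    exact hw2 (subset_closure (interior_subset hw1))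
  have hd := dist_add_dist_of_mem_segment hw1
  have hxw : dist x w ≤ ε := by linarith [dist_nonneg (x := w) (y := y)]
  have hyw : dist y w ≤ ε := by
    rw [dist_comm]
    linarith [dist_nonneg (x := x) (y := w)]
  exact ⟨Metric.mem_cthickening_of_dist_le _ _ _ _ hw2 hxw,
    Metric.mem_cthickening_of_dist_le _ _ _ _ hw2 hyw⟩

/-- Counting points of a translated and dilated integer lattice in a dilated bounded set. -/
theorem tendsto_lattice_count {d : ℕ} {S : Set (Fin d → ℝ)} (hb : Bornology.IsBounded S)
    (hfr : volume (frontier S) = 0) (u : Fin d → ℝ) {q : ℝ} (hq : 0 < q) :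
    Tendsto (fun X : ℝ => ({t : Fin d → ℤ | (fun j => (u j + q * t j) / X) ∈ S}.ncard : ℝ)
      * q ^ d / X ^ d) atTop (𝓝 (volume S).toReal) := by
  classical
  have hbf : Bornology.IsBounded (frontier S) := hb.closure.subset frontier_subset_closure
  have hbc : ∀ ε, volume (Metric.cthickening ε (frontier S)) ≠ ⊤ := fun ε =>
    (hbf.cthickening (δ := ε)).measure_lt_top.ne
  have hthick : Tendsto (fun X : ℝ => (volume (Metric.cthickening (q / X) (frontier S))).toReal)
      atTop (𝓝 0) := by
    have h1 := tendsto_measure_cthickening_of_isClosed (μ := (volume : Measure (Fin d → ℝ)))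
      (s := frontier S) ⟨1, one_pos, hbc 1⟩ isClosed_frontier
    have h2 : Tendsto (fun X : ℝ => q / X) atTop (𝓝 0) := tendsto_const_nhds.div_atTop tendsto_id
    have h3 := (ENNReal.tendsto_toReal (by simp [hfr])).comp (h1.comp h2)
    rw [hfr] at h3
    exact h3
  have key : ∀ X : ℝ, 0 < X →
      |({t : Fin d → ℤ | (fun j => (u j + q * t j) / X) ∈ S}.ncard : ℝ) * q ^ d / X ^ d
        - (volume S).toReal| ≤ (volume (Metric.cthickening (q / X) (frontier S))).toReal := by
    intro X hX
    set T := {t : Fin d → ℤ | (fun j => (u j + q * t j) / X) ∈ S} with hT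
    have hTf : T.Finite := finite_lattice_points hb u hq hX
    let cube : (Fin d → ℤ) → Set (Fin d → ℝ) := fun t =>
      Set.pi Set.univ fun j => Set.Ico ((u j + q * t j) / X) ((u j + q * (t j + 1)) / X)
    have hmem : ∀ t y, y ∈ cube t ↔ ∀ j, ⌊(X * y j - u j) / q⌋ = t j := by
      intro t y
      simp only [cube, Set.mem_univ_pi, Set.mem_Ico, Int.floor_eq_iff]
      refine forall_congr' fun j => ?_
      rw [div_le_iff₀ hX, lt_div_iff₀ hX, le_div_iff₀ hq, div_lt_iff₀ hq]
      constructor <;> rintro ⟨h1, h2⟩ <;> constructor <;> nlinarith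
    have hvol : ∀ t, volume (cube t) = ENNReal.ofReal ((q / X) ^ d) := by
      intro t
      simp only [cube]
      rw [Real.volume_pi_Ico]
      have : ∀ j, (u j + q * ((t j : ℝ) + 1)) / X - (u j + q * t j) / X = q / X := by
        intro j; field_simp; ring
      simp only [this, Finset.prod_const, Finset.card_univ, Fintype.card_fin]
      rw [ENNReal.ofReal_pow (by positivity)]
    have hdisj : Set.PairwiseDisjoint T cube := by
      intro a _ b _ hab
      rw [Function.onFun, Set.disjoint_left]
      intro y hya hyb
      exact hab (funext fun j => ((hmem a y).mp hya j).symm.trans ((hmem b y).mp hyb j))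
    set G := ⋃ t ∈ T, cube t with hG
    have hGvol : (volume G).toReal = T.ncard * q ^ d / X ^ d := by
      rw [hG, measure_biUnion hTf.countable hdisj
        (fun t _ => MeasurableSet.univ_pi fun j => measurableSet_Ico)]
      simp only [hvol]
      rw [ENNReal.tsum_const, ENNReal.toReal_mul, ENNReal.toReal_ofReal (by positivity), div_pow,
        mul_div_assoc, ENat.card_coe_set_eq, ← hTf.cast_ncard_eq]
      simp
    have hGmem : ∀ y, y ∈ G ↔ (fun j => (u j + q * ⌊(X * y j - u j) / q⌋) / X) ∈ S := by
      intro y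
      simp only [hG, Set.mem_iUnion, hmem]
      constructor
      · rintro ⟨t, ht, hy⟩
        have : (fun j => (u j + q * ⌊(X * y j - u j) / q⌋) / X) =
            fun j => (u j + q * t j) / X := by
          funext j; rw [hy j]
        rw [this]
        exact ht
      · intro h
        exact ⟨fun j => ⌊(X * y j - u j) / q⌋, h, fun j => rfl⟩
    have hdist : ∀ y : Fin d → ℝ,
        dist (fun j => (u j + q * ⌊(X * y j - u j) / q⌋) / X) y ≤ q / X := by
      intro y
      rw [dist_pi_le_iff (by positivity)]
      intro j
      have h1 := Int.floor_le ((X * y j - u j) / q)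
      have h2 := (Int.lt_floor_add_one ((X * y j - u j) / q)).le
      rw [le_div_iff₀ hq] at h1
      rw [div_le_iff₀ hq] at h2
      rw [Real.dist_eq, abs_le]
      constructor
      · rw [← sub_nonneg]
        have : (u j + q * ⌊(X * y j - u j) / q⌋) / X - y j - -(q / X) =
          (u j + q * ⌊(X * y j - u j) / q⌋ - X * y j + q) / X := by field_simp; ring
        rw [this]
        apply div_nonneg _ hX.le
        linarith
      · rw [← sub_nonneg]
        have : q / X - ((u j + q * ⌊(X * y j - u j) / q⌋) / X - y j) =
          (q - (u j + q * ⌊(X * y j - u j) / q⌋ - X * y j)) / X := by field_simp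
        rw [this]
        apply div_nonneg _ hX.le
        linarith
    have hsub1 : G ⊆ S ∪ Metric.cthickening (q / X) (frontier S) := by
      intro y hy
      by_cases hyS : y ∈ S
      · exact Or.inl hyS
      · exact Or.inr (mem_cthickening_frontier ((hGmem y).mp hy) hyS (hdist y)).2
    have hsub2 : S ⊆ G ∪ Metric.cthickening (q / X) (frontier S) := by
      intro y hy
      by_cases hyG : y ∈ G
      · exact Or.inl hyG
      · refine Or.inr (mem_cthickening_frontier hy (fun h => hyG ((hGmem y).mpr h)) ?_).1
        rw [dist_comm]
        exact hdist y
    have hSfin : volume S ≠ ⊤ := hb.measure_lt_top.ne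
    have hGfin : volume G ≠ ⊤ := ((measure_mono hsub1).trans_lt
      ((measure_union_le _ _).trans_lt (ENNReal.add_lt_top.mpr
        ⟨hSfin.lt_top, (hbc _).lt_top⟩))).ne
    rw [← hGvol, abs_le]
    have e1 := ENNReal.toReal_mono (ENNReal.add_ne_top.mpr ⟨hSfin, hbc (q / X)⟩)
      ((measure_mono hsub1).trans (measure_union_le _ _))
    have e2 := ENNReal.toReal_mono (ENNReal.add_ne_top.mpr ⟨hGfin, hbc (q / X)⟩)
      ((measure_mono hsub2).trans (measure_union_le _ _))
    rw [ENNReal.toReal_add hSfin (hbc _)] at e1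
    rw [ENNReal.toReal_add hGfin (hbc _)] at e2
    constructor <;> linarith
  rw [tendsto_iff_dist_tendsto_zero]
  refine squeeze_zero' (Eventually.of_forall fun _ => dist_nonneg) ?_ hthick
  filter_upwards [eventually_gt_atTop 0] with X hX
  rw [Real.dist_eq]
  exact key X hX

section PadicHaar

variable {p : ℕ} [Fact p.Prime]

theorem padic_exists_digit (x : ℚ_[p]) (a : ℤ) (hx : ‖x‖ ≤ (p : ℝ) ^ (a + 1)) :
    ∃ i < p, ‖x - i * (p : ℚ_[p]) ^ (-(a + 1))‖ ≤ (p : ℝ) ^ a := by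
  have hp0 : (p : ℝ) ≠ 0 := by exact_mod_cast (Fact.out : p.Prime).ne_zero
  have hp0' : (p : ℚ_[p]) ≠ 0 := by exact_mod_cast (Fact.out : p.Prime).ne_zero
  have hpos : (0 : ℝ) < p := by exact_mod_cast (Fact.out : p.Prime).pos
  have hy : ‖x * (p : ℚ_[p]) ^ (a + 1)‖ ≤ 1 := by
    rw [norm_mul, Padic.norm_p_zpow]
    calc ‖x‖ * (p : ℝ) ^ (-(a + 1)) ≤ (p : ℝ) ^ (a + 1) * (p : ℝ) ^ (-(a + 1)) := by gcongr
      _ = 1 := by rw [← zpow_add₀ hp0]; simp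
  obtain ⟨y, hyx⟩ : ∃ y : ℤ_[p], (y : ℚ_[p]) = x * (p : ℚ_[p]) ^ (a + 1) := ⟨⟨_, hy⟩, rfl⟩
  obtain ⟨i, hi, hmem⟩ := PadicInt.exists_mem_range y
  refine ⟨i, hi, ?_⟩
  have h1 : ‖y - i‖ < 1 := by
    rwa [← PadicInt.mem_nonunits, ← IsLocalRing.mem_maximalIdeal]
  rw [PadicInt.norm_def] at h1
  push_cast at h1
  rw [hyx] at h1
  have h2 := (Padic.norm_lt_pow_iff_norm_le_pow_sub_one
    (x * (p : ℚ_[p]) ^ (a + 1) - (i : ℚ_[p])) 0).mp (by simpa using h1)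
  have h3 : x - i * (p : ℚ_[p]) ^ (-(a + 1)) =
      (x * (p : ℚ_[p]) ^ (a + 1) - i) * (p : ℚ_[p]) ^ (-(a + 1)) := by
    rw [sub_mul, mul_assoc, ← zpow_add₀ hp0']
    simp
  rw [h3, norm_mul, Padic.norm_p_zpow, neg_neg]
  calc ‖x * (p : ℚ_[p]) ^ (a + 1) - i‖ * (p : ℝ) ^ (a + 1)
      ≤ (p : ℝ) ^ (0 - 1 : ℤ) * (p : ℝ) ^ (a + 1) := by gcongr
    _ = (p : ℝ) ^ a := by rw [← zpow_add₀ hp0]; congr 1; ring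

theorem padic_digit_unique (a : ℤ) {i j : ℕ} (hi : i < p) (hj : j < p)
    (h : ‖((i : ℚ_[p]) - j) * (p : ℚ_[p]) ^ (-(a + 1))‖ ≤ (p : ℝ) ^ a) : i = j := by
  have hp0 : (p : ℝ) ≠ 0 := by exact_mod_cast (Fact.out : p.Prime).ne_zero
  have hp1 : (1 : ℝ) < p := by exact_mod_cast (Fact.out : p.Prime).one_lt
  rw [norm_mul, Padic.norm_p_zpow, neg_neg] at h
  have h1 : ‖((i : ℚ_[p]) - j)‖ < 1 := by
    by_contra hcon
    push Not at hcon
    have h2 : (p : ℝ) ^ (a + 1) ≤ (p : ℝ) ^ a := by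
      refine le_trans ?_ h
      exact le_mul_of_one_le_left (by positivity) hcon
    have h3 : (p : ℝ) ^ a < (p : ℝ) ^ (a + 1) := zpow_lt_zpow_right₀ hp1 (by lia)
    linarith
  have h2 : ‖(((i : ℤ) - (j : ℤ) : ℤ) : ℚ_[p])‖ < 1 := by push_cast; exact h1
  rw [Padic.norm_intCast_lt_one_iff] at h2
  have := Int.eq_zero_of_abs_lt_dvd h2 (by rw [abs_lt]; constructor <;> lia)
  lia

theorem padic_exists_norm_eq_zpow {c : ℚ_[p]} (hc : c ≠ 0) : ∃ a : ℤ, ‖c‖ = (p : ℝ) ^ a :=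
  ⟨_, Padic.norm_eq_zpow_neg_valuation hc⟩

variable [MeasurableSpace ℚ_[p]] [BorelSpace ℚ_[p]]

theorem padic_haar_closedBall_succ (μ : Measure ℚ_[p]) [μ.IsAddHaarMeasure] (a : ℤ) :
    μ (Metric.closedBall 0 ((p : ℝ) ^ (a + 1))) = p * μ (Metric.closedBall 0 ((p : ℝ) ^ a)) := by
  have hU : Metric.closedBall (0 : ℚ_[p]) ((p : ℝ) ^ (a + 1)) =
      ⋃ i ∈ Finset.range p, Metric.closedBall (i * (p : ℚ_[p]) ^ (-(a + 1))) ((p : ℝ) ^ a) := by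
    have hpos : (1 : ℝ) < p := by exact_mod_cast (Fact.out : p.Prime).one_lt
    ext x
    simp only [Set.mem_iUnion, Finset.mem_range, mem_closedBall_iff_norm, sub_zero, exists_prop]
    constructor
    · intro hx
      exact padic_exists_digit x a hx
    · rintro ⟨i, -, hx⟩
      have h1 : ‖(i : ℚ_[p]) * (p : ℚ_[p]) ^ (-(a + 1))‖ ≤ (p : ℝ) ^ (a + 1) := by
        rw [norm_mul, Padic.norm_p_zpow, neg_neg]
        refine mul_le_of_le_one_left (by positivity) ?_
        exact_mod_cast Padic.norm_int_le_one (p := p) (i : ℤ)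
      have h2 : (p : ℝ) ^ a ≤ (p : ℝ) ^ (a + 1) := zpow_le_zpow_right₀ hpos.le (by lia)
      calc ‖x‖ = ‖(x - i * (p : ℚ_[p]) ^ (-(a + 1))) + i * (p : ℚ_[p]) ^ (-(a + 1))‖ := by
            rw [sub_add_cancel]
        _ ≤ max _ _ := IsUltrametricDist.norm_add_le_max _ _
        _ ≤ _ := max_le (hx.trans h2) h1
  rw [hU, measure_biUnion_finset _ (fun i _ => measurableSet_closedBall)]
  · simp [Measure.addHaar_closedBall_center]
  · intro i hi j hj hij
    rw [Function.onFun, Set.disjoint_left]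
    intro x hxi hxj
    apply hij
    rw [mem_closedBall_iff_norm] at hxi hxj
    apply padic_digit_unique a (Finset.mem_range.mp hi) (Finset.mem_range.mp hj)
    have : ((i : ℚ_[p]) - j) * (p : ℚ_[p]) ^ (-(a + 1)) =
        (x - j * (p : ℚ_[p]) ^ (-(a + 1))) - (x - i * (p : ℚ_[p]) ^ (-(a + 1))) := by ring
    rw [this, sub_eq_add_neg]
    exact (IsUltrametricDist.norm_add_le_max _ _).trans (max_le hxj (by rwa [norm_neg]))

theorem padic_haar_closedBall (μ : Measure ℚ_[p]) [μ.IsAddHaarMeasure]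
    (h1 : μ (Metric.closedBall 0 1) = 1) (a : ℤ) :
    μ (Metric.closedBall 0 ((p : ℝ) ^ a)) = (p : ENNReal) ^ a := by
  have hp0 : (p : ENNReal) ≠ 0 := by exact_mod_cast (Fact.out : p.Prime).ne_zero
  have hpt : (p : ENNReal) ≠ ⊤ := ENNReal.natCast_ne_top p
  induction a using Int.induction_on with
  | zero => simpa using h1
  | succ i ih =>
    rw [padic_haar_closedBall_succ, ih, ENNReal.zpow_add hp0 hpt, zpow_one, mul_comm]
  | pred i ih =>
    have h := padic_haar_closedBall_succ μ (-(i : ℤ) - 1)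
    rw [sub_add_cancel, ih] at h
    have h2 : (p : ENNReal) * (p : ENNReal) ^ (-(i : ℤ) - 1) = (p : ENNReal) ^ (-(i : ℤ)) := by
      have h3 := ENNReal.zpow_add hp0 hpt (-(i : ℤ) - 1) 1
      rw [sub_add_cancel, zpow_one] at h3
      rw [h3, mul_comm]
    rw [← h2] at h
    exact ((ENNReal.mul_right_inj hp0 hpt).mp h).symm

variable {d : ℕ}

theorem padic_haar_box (μ : Measure (Fin d → ℚ_[p])) [μ.IsAddHaarMeasure]
    (h1 : μ {y | ∀ j, ‖y j‖ ≤ 1} = 1) (a : Fin d → ℤ) :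
    μ {y | ∀ j, ‖y j‖ ≤ (p : ℝ) ^ a j} = ∏ j, (p : ENNReal) ^ a j := by
  let K : TopologicalSpace.PositiveCompacts ℚ_[p] :=
    ⟨⟨Metric.closedBall 0 1, isCompact_closedBall 0 1⟩, by
      refine ⟨0, mem_interior.mpr ⟨Metric.ball 0 1, Metric.ball_subset_closedBall,
        Metric.isOpen_ball, by simp⟩⟩⟩
  have hK : Measure.addHaarMeasure K (Metric.closedBall 0 1) = 1 := Measure.addHaarMeasure_self
  have hbox : ∀ r : Fin d → ℝ, {y : Fin d → ℚ_[p] | ∀ j, ‖y j‖ ≤ r j} =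
      Set.univ.pi fun j => Metric.closedBall 0 (r j) := by
    intro r; ext y; simp
  have hμ := Measure.isAddLeftInvariant_eq_smul μ
    (Measure.pi fun _ : Fin d => Measure.addHaarMeasure K)
  set c := μ.addHaarScalarFactor (Measure.pi fun _ : Fin d => Measure.addHaarMeasure K)
  have hc : c = 1 := by
    have := h1
    rw [hμ, hbox (fun _ => 1), Measure.smul_apply, Measure.pi_pi] at this
    simp only [hK, Finset.prod_const_one] at this
    rw [ENNReal.smul_def, smul_eq_mul, mul_one] at this
    exact_mod_cast this
  rw [hμ, hc, one_smul, hbox, Measure.pi_pi]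
  exact Finset.prod_congr rfl fun j _ => padic_haar_closedBall _ hK (a j)

theorem padic_map_eq_of_preimage (μ : Measure (Fin d → ℚ_[p])) [μ.IsAddHaarMeasure]
    {M : Matrix (Fin d) (Fin d) ℚ_[p]} (hM : M.det ≠ 0) {W : Set (Fin d → ℚ_[p])}
    (hW : MeasurableSet W) (hW0 : μ W ≠ 0) (hWt : μ W ≠ ⊤) {κ : ENNReal}
    (h : μ ((M *ᵥ ·) ⁻¹' W) = κ * μ W) : Measure.map (M *ᵥ ·) μ = κ • μ := by
  have hcont : Continuous (fun x => M *ᵥ x) :=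
    Continuous.matrix_mulVec continuous_const continuous_id
  have hcont' : Continuous (fun x => M⁻¹ *ᵥ x) :=
    Continuous.matrix_mulVec continuous_const continuous_id
  have hu : IsUnit M.det := isUnit_iff_ne_zero.mpr hM
  let e : (Fin d → ℚ_[p]) ≃ₜ (Fin d → ℚ_[p]) :=
    { toFun := fun x => M *ᵥ x
      invFun := fun x => M⁻¹ *ᵥ x
      left_inv := fun x => by simp [mulVec_mulVec, nonsing_inv_mul M hu]
      right_inv := fun x => by simp [mulVec_mulVec, mul_nonsing_inv M hu]
      continuous_toFun := hcont
      continuous_invFun := hcont' }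
  have : (Measure.map (M *ᵥ ·) μ).IsAddHaarMeasure :=
    Measure.isAddHaarMeasure_map μ (AddMonoidHom.mk' (fun x => M *ᵥ x) (mulVec_add M)) hcont
      e.surjective e.isClosedEmbedding.tendsto_cocompact
  have hμ := Measure.isAddLeftInvariant_eq_smul (Measure.map (M *ᵥ ·) μ) μ
  have h2 : Measure.map (M *ᵥ ·) μ W = κ * μ W := by
    rw [Measure.map_apply hcont.measurable hW]
    exact h
  rw [hμ, Measure.smul_apply, ENNReal.smul_def, smul_eq_mul,
    ENNReal.mul_left_inj hW0 hWt] at h2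
  rw [hμ, ← h2]
  rfl

theorem padic_measurableSet_box (r : Fin d → ℝ) :
    MeasurableSet {y : Fin d → ℚ_[p] | ∀ j, ‖y j‖ ≤ r j} := by
  rw [Set.ofPred_forall]
  exact MeasurableSet.iInter fun j => measurableSet_le (measurable_pi_apply j).norm measurable_const

/-- A linear map scales the Haar measure of `ℚ_p^d` by the absolute value of its determinant. -/
theorem padic_map_mulVec (μ : Measure (Fin d → ℚ_[p])) [μ.IsAddHaarMeasure]
    (h1 : μ {y | ∀ j, ‖y j‖ ≤ 1} = 1) (M : Matrix (Fin d) (Fin d) ℚ_[p]) (hM : M.det ≠ 0) :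
    Measure.map (M *ᵥ ·) μ = (ENNReal.ofReal ‖M.det‖)⁻¹ • μ := by
  have hp0 : (p : ENNReal) ≠ 0 := by exact_mod_cast (Fact.out : p.Prime).ne_zero
  have hpt : (p : ENNReal) ≠ ⊤ := ENNReal.natCast_ne_top p
  have hpos : (0 : ℝ) < p := by exact_mod_cast (Fact.out : p.Prime).pos
  refine Matrix.diagonal_transvection_induction_of_det_ne_zero
    (fun M => Measure.map (M *ᵥ ·) μ = (ENNReal.ofReal ‖M.det‖)⁻¹ • μ) M hM ?_ ?_ ?_
  · intro D hD
    have hDj : ∀ j, D j ≠ 0 := by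
      rw [det_diagonal, Finset.prod_ne_zero_iff] at hD
      exact fun j => hD j (Finset.mem_univ j)
    choose a ha using fun j => padic_exists_norm_eq_zpow (hDj j)
    refine padic_map_eq_of_preimage μ hD (padic_measurableSet_box fun _ => 1)
      (by rw [h1]; simp) (by rw [h1]; simp) ?_
    rw [h1, mul_one]
    have hpre : ((diagonal D *ᵥ ·) ⁻¹' {y | ∀ j, ‖y j‖ ≤ 1}) =
        {y : Fin d → ℚ_[p] | ∀ j, ‖y j‖ ≤ (p : ℝ) ^ (-a j)} := by
      ext y
      simp only [Set.mem_preimage, Set.mem_ofPred_eq, mulVec_diagonal, norm_mul, ha]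
      refine forall_congr' fun j => ?_
      rw [_root_.zpow_neg, ← one_div, le_div_iff₀ (by positivity), mul_comm]
    rw [hpre, padic_haar_box μ h1, det_diagonal, norm_prod]
    simp only [ha]
    rw [ENNReal.ofReal_prod_of_nonneg (fun j _ => by positivity), ENNReal.prod_inv_distrib
      (fun i _ j _ _ => Or.inr (by simp))]
    refine Finset.prod_congr rfl fun j _ => ?_
    rw [ENNReal.zpow_neg, ← Real.rpow_intCast, ENNReal.ofReal_rpow_of_pos hpos |>.symm,
      ENNReal.ofReal_natCast, ENNReal.rpow_intCast]
  · intro t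
    obtain ⟨b, hb⟩ : ∃ b : ℕ, ‖t.c‖ ≤ (p : ℝ) ^ b :=
      pow_unbounded_of_one_lt _ (by exact_mod_cast (Fact.out : p.Prime).one_lt) |>.imp
        fun _ h => h.le
    have hdet : t.toMatrix.det = 1 := t.det
    rw [hdet]
    let a : Fin d → ℤ := fun j => if j = t.i then b else 0
    have hW : μ {y | ∀ j, ‖y j‖ ≤ (p : ℝ) ^ a j} = ∏ j, (p : ENNReal) ^ a j :=
      padic_haar_box μ h1 a
    have hstep : ∀ (c : ℚ_[p]) (y : Fin d → ℚ_[p]), ‖c‖ ≤ (p : ℝ) ^ b →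
        (∀ j, ‖y j‖ ≤ (p : ℝ) ^ a j) → ∀ j, ‖(transvection t.i t.j c *ᵥ y) j‖ ≤ (p : ℝ) ^ a j := by
      intro c y hc hy j
      have hval : (transvection t.i t.j c *ᵥ y) j = y j + (if j = t.i then c * y t.j else 0) := by
        rw [transvection, add_mulVec, one_mulVec, Pi.add_apply]
        congr 1
        by_cases hj : j = t.i
        · subst hj; simp [mulVec, dotProduct, single_apply]
        · simp [mulVec, dotProduct, Ne.symm hj, hj]
      rw [hval]
      by_cases hj : j = t.i
      · rw [if_pos hj]
        refine (IsUltrametricDist.norm_add_le_max _ _).trans (max_le (hy j) ?_)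
        rw [norm_mul]
        have h2 := hy t.j
        simp only [a, if_neg t.hij.symm, zpow_zero] at h2
        simp only [a, if_pos hj, zpow_natCast]
        calc ‖c‖ * ‖y t.j‖ ≤ p ^ b * 1 := by gcongr
          _ = _ := mul_one _
      · rw [if_neg hj, add_zero]
        exact hy j
    refine padic_map_eq_of_preimage μ (by rw [hdet]; exact one_ne_zero)
      (padic_measurableSet_box fun j => (p : ℝ) ^ a j)
      (by
        rw [hW]
        exact Finset.prod_ne_zero_iff.mpr fun j _ => (ENNReal.zpow_pos hp0 hpt _).ne')
      (by
        rw [hW]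
        exact ENNReal.prod_ne_top fun j _ => (ENNReal.zpow_lt_top hp0 hpt _).ne) ?_
    rw [norm_one, ENNReal.ofReal_one, inv_one, one_mul]
    congr 1
    ext y
    simp only [Set.mem_preimage, Set.mem_ofPred_eq, TransvectionStruct.toMatrix]
    refine ⟨fun h => ?_, fun h => hstep _ y hb h⟩
    have h2 := hstep (-t.c) _ (by rwa [norm_neg]) h
    rwa [mulVec_mulVec, transvection_mul_transvection_same t.i t.j t.hij, neg_add_cancel,
      transvection_zero, one_mulVec] at h2
  · intro A B hA hB hPA hPB
    have hcont : ∀ M : Matrix (Fin d) (Fin d) ℚ_[p], Measurable (fun x => M *ᵥ x) :=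
      fun M => (Continuous.matrix_mulVec continuous_const continuous_id).measurable
    have hcomp : (fun x => (A * B) *ᵥ x) = (fun x => A *ᵥ x) ∘ fun x => B *ᵥ x := by
      funext x; simp [mulVec_mulVec]
    rw [hcomp, ← Measure.map_map (hcont A) (hcont B), hPB, Measure.map_smul, hPA, smul_smul,
      det_mul, norm_mul, ENNReal.ofReal_mul (norm_nonneg _), ENNReal.mul_inv (by simp) (by simp),
      mul_comm]

end PadicHaar

section StrongApproximation

variable {s : ℕ} {p : Fin s → ℕ} [hp : ∀ i, Fact (p i).Prime]

theorem padic_prod_pos (p : Fin s → ℕ) [hp : ∀ i, Fact (p i).Prime] : 0 < ∏ i, p i :=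
  Finset.prod_pos fun i _ => (hp i).out.pos

theorem IsZS.add {P : ℕ} (hP : 0 < P) {x y : ℚ} (hx : IsZS P x) (hy : IsZS P y) :
    IsZS P (x + y) := by
  obtain ⟨a, k, rfl⟩ := hx
  obtain ⟨b, l, rfl⟩ := hy
  refine ⟨a * P ^ l + b * P ^ k, k + l, ?_⟩
  have : (P : ℚ) ≠ 0 := by exact_mod_cast hP.ne'
  push_cast
  field_simp
  ring

theorem IsZS.neg {P : ℕ} {x : ℚ} (hx : IsZS P x) : IsZS P (-x) := by
  obtain ⟨a, k, rfl⟩ := hx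
  exact ⟨-a, k, by push_cast; ring⟩

theorem IsZS.sub {P : ℕ} (hP : 0 < P) {x y : ℚ} (hx : IsZS P x) (hy : IsZS P y) :
    IsZS P (x - y) := by
  rw [sub_eq_add_neg]
  exact hx.add hP hy.neg

theorem IsZS.mul {P : ℕ} {x y : ℚ} (hx : IsZS P x) (hy : IsZS P y) : IsZS P (x * y) := by
  obtain ⟨a, k, rfl⟩ := hx
  obtain ⟨b, l, rfl⟩ := hy
  exact ⟨a * b, k + l, by push_cast; rw [pow_add, div_mul_div_comm]⟩

theorem isZS_intCast (P : ℕ) (a : ℤ) : IsZS P a := ⟨a, 0, by simp⟩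

theorem isZS_natCast (P : ℕ) (a : ℕ) : IsZS P a := ⟨a, 0, by simp⟩

theorem IsZS.div_pow {P : ℕ} {x : ℚ} (hx : IsZS P x) (k : ℕ) : IsZS P (x / (P : ℚ) ^ k) := by
  obtain ⟨a, l, rfl⟩ := hx
  exact ⟨a, l + k, by rw [div_div, pow_add]⟩

theorem IsZS.sum {P : ℕ} (hP : 0 < P) {ι : Type*} (t : Finset ι) {f : ι → ℚ}
    (hf : ∀ i ∈ t, IsZS P (f i)) : IsZS P (∑ i ∈ t, f i) := by
  classical
  induction t using Finset.induction_on with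
  | empty => simpa using isZS_intCast P 0
  | insert a t ha ih =>
    rw [Finset.sum_insert ha]
    exact (hf a (by simp)).add hP (ih fun i hi => hf i (by simp [hi]))

theorem padic_not_dvd_den_of_norm_le_one {q : ℕ} [Fact q.Prime] {x : ℚ}
    (h : ‖(x : ℚ_[q])‖ ≤ 1) : ¬ q ∣ x.den := by
  intro hq
  have h1 : ‖(x.den : ℚ_[q])‖ < 1 := Padic.norm_natCast_lt_one_iff.mpr hq
  have h2 : ‖(x.num : ℚ_[q])‖ < 1 := by
    have h3 : (x.num : ℚ_[q]) = x * x.den := by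
      have := Rat.mul_den_eq_num x
      exact_mod_cast this.symm
    rw [h3, norm_mul]
    exact mul_lt_one_of_nonneg_of_lt_one_right h (norm_nonneg _) h1
  rw [Padic.norm_intCast_lt_one_iff] at h2
  have h3 : q ∣ x.num.natAbs := Int.natCast_dvd.mp h2
  exact (Fact.out : q.Prime).one_lt.ne' (Nat.eq_one_of_dvd_coprimes x.reduced h3 hq)

theorem isZS_eq_intCast_of_norm_le_one {x : ℚ} (hx : IsZS (∏ i, p i) x)
    (h : ∀ i, ‖(x : ℚ_[p i])‖ ≤ 1) : ∃ a : ℤ, x = a := by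
  obtain ⟨a, k, hak⟩ := hx
  have hdvd : x.den ∣ (∏ i, p i) ^ k := by
    have : x = Rat.divInt a (((∏ i, p i) ^ k : ℕ) : ℤ) := by
      rw [hak, Rat.divInt_eq_div]; push_cast; rfl
    have h2 := Rat.den_dvd a (((∏ i, p i) ^ k : ℕ) : ℤ)
    rw [← this] at h2
    exact_mod_cast h2
  have hden : x.den = 1 := by
    by_contra hne
    obtain ⟨q, hq, hqd⟩ := Nat.exists_prime_and_dvd hne
    have h3 := hq.dvd_of_dvd_pow (hqd.trans hdvd)
    obtain ⟨i, -, hi⟩ := (Nat.Prime.prime hq).exists_mem_finset_dvd h3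
    have h4 : q = p i := (Nat.prime_dvd_prime_iff_eq hq (hp i).out).mp hi
    subst h4
    exact padic_not_dvd_den_of_norm_le_one (h i) hqd
  exact ⟨x.num, ((Rat.den_eq_one_iff x).mp hden).symm⟩

theorem padic_norm_natCast_eq_one {q : ℕ} [hq : Fact q.Prime] {a : ℕ} (h : ¬ q ∣ a) :
    ‖(a : ℚ_[q])‖ = 1 := by
  have h1 : ‖(a : ℚ_[q])‖ ≤ 1 := by exact_mod_cast Padic.norm_int_le_one (p := q) (a : ℤ)
  rcases h1.lt_or_eq with h2 | h2
  · exact absurd (Padic.norm_natCast_lt_one_iff.mp h2) h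
  · exact h2

theorem padic_norm_prod_primes (hpinj : Function.Injective p) (i : Fin s) :
    ‖((∏ j, p j : ℕ) : ℚ_[p i])‖ = (p i : ℝ)⁻¹ := by
  classical
  rw [← Finset.mul_prod_erase Finset.univ p (Finset.mem_univ i)]
  push_cast
  rw [norm_mul, Padic.norm_p, norm_prod, Finset.prod_eq_one, mul_one]
  intro j hj
  refine padic_norm_natCast_eq_one fun hdvd => ?_
  rw [Nat.prime_dvd_prime_iff_eq (hp i).out (hp j).out] at hdvd
  exact (Finset.mem_erase.mp hj).1 (hpinj hdvd.symm)

theorem isZS_eq_mul_of_norm_le (hpinj : Function.Injective p) {x : ℚ} (hx : IsZS (∏ i, p i) x)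
    {k : ℕ} (h : ∀ i, ‖(x : ℚ_[p i])‖ ≤ (p i : ℝ) ^ (-(k : ℤ))) :
    ∃ a : ℤ, x = ((∏ i, p i : ℕ) : ℚ) ^ k * a := by
  have hP : ((∏ i, p i : ℕ) : ℚ) ≠ 0 := by exact_mod_cast (padic_prod_pos p).ne'
  obtain ⟨a, ha⟩ := isZS_eq_intCast_of_norm_le_one (hx.div_pow k) (fun i => by
    have hpos : (0 : ℝ) < p i := by exact_mod_cast (hp i).out.pos
    rw [Rat.cast_div, Rat.cast_pow, norm_div, norm_pow, Rat.cast_natCast,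
      padic_norm_prod_primes hpinj]
    refine (div_le_iff₀ (by positivity)).mpr ((h i).trans ?_)
    rw [one_mul, _root_.zpow_neg, zpow_natCast, inv_pow])
  exact ⟨a, by rw [← ha]; field_simp⟩

theorem exists_nat_padic_approx {q : ℕ} [hq : Fact q.Prime] (x : ℚ_[q]) (hx : ‖x‖ ≤ 1) (k : ℕ) :
    ∃ a : ℕ, ‖(a : ℚ_[q]) - x‖ ≤ (q : ℝ) ^ (-(k : ℤ)) := by
  have hpos : (0 : ℝ) < q := by exact_mod_cast hq.out.pos
  obtain ⟨y, hy⟩ : ∃ y : ℤ_[q], (y : ℚ_[q]) = x := ⟨⟨x, hx⟩, rfl⟩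
  obtain ⟨a, ha⟩ := PadicInt.denseRange_natCast.exists_dist_lt y
    (show (0 : ℝ) < (q : ℝ) ^ (-(k : ℤ)) by positivity)
  refine ⟨a, ?_⟩
  rw [dist_comm, dist_eq_norm, PadicInt.norm_def] at ha
  push_cast at ha
  rw [hy] at ha
  exact ha.le

/-- Simultaneous approximation of local numbers by an `S`-integer. -/
theorem exists_isZS_approx (hpinj : Function.Injective p) (x : ∀ i, ℚ_[p i]) (k : ℕ) :
    ∃ r : ℚ, IsZS (∏ i, p i) r ∧ ∀ i, ‖(r : ℚ_[p i]) - x i‖ ≤ (p i : ℝ) ^ (-(k : ℤ)) := by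
  have hP : ∀ i, ((∏ j, p j : ℕ) : ℚ_[p i]) ≠ 0 := fun i => by
    exact_mod_cast (padic_prod_pos p).ne'
  have hM : ∃ M : ℕ, ∀ i, ‖x i‖ ≤ (p i : ℝ) ^ M := by
    have h1 : ∀ i, ∃ M : ℕ, ‖x i‖ ≤ (p i : ℝ) ^ M := fun i =>
      (pow_unbounded_of_one_lt ‖x i‖ (show (1 : ℝ) < p i by
        exact_mod_cast (hp i).out.one_lt)).imp fun _ h => h.le
    choose M hM using h1
    refine ⟨∑ i, M i, fun i => (hM i).trans ?_⟩
    exact pow_le_pow_right₀ (by exact_mod_cast (hp i).out.one_le)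
      (Finset.single_le_sum (fun _ _ => Nat.zero_le _) (Finset.mem_univ i))
  obtain ⟨M, hM⟩ := hM
  have h2 : ∀ i, ∃ a : ℕ, ‖(a : ℚ_[p i]) - ((∏ j, p j : ℕ) : ℚ_[p i]) ^ M * x i‖
      ≤ (p i : ℝ) ^ (-((k + M : ℕ) : ℤ)) := fun i => by
    have hpos : (0 : ℝ) < p i := by exact_mod_cast (hp i).out.pos
    refine exists_nat_padic_approx _ ?_ (k + M)
    rw [norm_mul, norm_pow, padic_norm_prod_primes hpinj, inv_pow]
    exact (inv_mul_le_iff₀ (by positivity)).mpr (by simpa using hM i)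
  choose a ha using h2
  have hco : ((Finset.univ : Finset (Fin s)) : Set (Fin s)).Pairwise
      (Function.onFun Nat.Coprime fun i => p i ^ (k + M)) := by
    intro i _ j _ hij
    exact Nat.Coprime.pow _ _ ((Nat.coprime_primes (hp i).out (hp j).out).mpr
      fun h => hij (hpinj h))
  obtain ⟨b, hb⟩ := Nat.chineseRemainderOfFinset a (fun i => p i ^ (k + M)) Finset.univ
    (fun i _ => pow_ne_zero _ (hp i).out.ne_zero) hco
  refine ⟨b / ((∏ j, p j : ℕ) : ℚ) ^ M, (isZS_natCast _ b).div_pow M, fun i => ?_⟩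
  have hpos : (0 : ℝ) < p i := by exact_mod_cast (hp i).out.pos
  have h3 : ‖(b : ℚ_[p i]) - a i‖ ≤ (p i : ℝ) ^ (-((k + M : ℕ) : ℤ)) := by
    have h4 := (Padic.norm_int_le_pow_iff_dvd (p := p i) ((b : ℤ) - a i) (k + M)).mpr (by
      have := (Nat.modEq_iff_dvd.mp (hb i (Finset.mem_univ i)).symm)
      exact_mod_cast this)
    exact_mod_cast h4
  have h4 : ‖(b : ℚ_[p i]) - ((∏ j, p j : ℕ) : ℚ_[p i]) ^ M * x i‖
      ≤ (p i : ℝ) ^ (-((k + M : ℕ) : ℤ)) := by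
    rw [← sub_add_sub_cancel (b : ℚ_[p i]) (a i)]
    exact (IsUltrametricDist.norm_add_le_max _ _).trans (max_le h3 (ha i))
  have h5 : (((b / ((∏ j, p j : ℕ) : ℚ) ^ M : ℚ)) : ℚ_[p i]) - x i =
      ((b : ℚ_[p i]) - ((∏ j, p j : ℕ) : ℚ_[p i]) ^ M * x i) /
        ((∏ j, p j : ℕ) : ℚ_[p i]) ^ M := by
    rw [sub_div, mul_div_cancel_left₀ _ (pow_ne_zero _ (hP i))]
    push_cast
    rfl
  rw [h5, norm_div, norm_pow, padic_norm_prod_primes hpinj]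
  refine (div_le_iff₀ (by positivity)).mpr (h4.trans (le_of_eq ?_))
  rw [← _root_.inv_zpow', ← _root_.inv_zpow', zpow_natCast, zpow_natCast, pow_add]

end StrongApproximation

section PadicCosets

variable {q d : ℕ} [hq : Fact q.Prime]

/-- The subgroup of `ℚ_q^d` of vectors whose entries have norm at most `q ^ (-k)`. -/
def padicBall (q d : ℕ) [Fact q.Prime] (k : ℕ) : AddSubgroup (Fin d → ℚ_[q]) where
  carrier := {x | ∀ j, ‖x j‖ ≤ (q : ℝ) ^ (-(k : ℤ))}
  add_mem' hx hy j := (IsUltrametricDist.norm_add_le_max _ _).trans (max_le (hx j) (hy j))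
  zero_mem' j := by simp only [Pi.zero_apply, norm_zero]; positivity
  neg_mem' hx j := by simpa using hx j

theorem mem_padicBall {k : ℕ} {x : Fin d → ℚ_[q]} :
    x ∈ padicBall q d k ↔ ∀ j, ‖x j‖ ≤ (q : ℝ) ^ (-(k : ℤ)) := Iff.rfl

theorem isOpen_padicBall (k : ℕ) : IsOpen (padicBall q d k : Set (Fin d → ℚ_[q])) := by
  have hpos : (0 : ℝ) < q := by exact_mod_cast hq.out.pos
  have : (padicBall q d k : Set (Fin d → ℚ_[q])) =
      ⋂ j, {x | x j ∈ Metric.closedBall (0 : ℚ_[q]) ((q : ℝ) ^ (-(k : ℤ)))} := by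
    ext x
    simp [mem_padicBall]
  rw [this]
  exact isOpen_iInter_of_finite fun j =>
    (IsUltrametricDist.isOpen_closedBall _ (by positivity)).preimage (continuous_apply j)

theorem padicBall_mono {k l : ℕ} (h : k ≤ l) : padicBall q d l ≤ padicBall q d k := fun _ hx j =>
  (hx j).trans (zpow_le_zpow_right₀ (by exact_mod_cast hq.out.one_le) (by lia))

theorem finite_padic_cosets {S : Set (Fin d → ℚ_[q])} {M : ℝ} (hM : ∀ x ∈ S, ∀ j, ‖x j‖ ≤ M)
    (k : ℕ) : ((QuotientAddGroup.mk : _ → (Fin d → ℚ_[q]) ⧸ padicBall q d k) '' S).Finite := by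
  have := QuotientAddGroup.discreteTopology (isOpen_padicBall (q := q) (d := d) k)
  have hc : IsCompact (Metric.closedBall (0 : Fin d → ℚ_[q]) (max M 0)) := isCompact_closedBall _ _
  have hfin := isCompact_iff_finite.mp (hc.image
    (QuotientAddGroup.continuous_mk (N := padicBall q d k)))
  refine hfin.subset (Set.image_mono fun x hx => ?_)
  rw [mem_closedBall_zero_iff, pi_norm_le_iff_of_nonneg (le_max_right _ _)]
  exact fun j => (hM x hx j).trans (le_max_left _ _)

variable [MeasurableSpace ℚ_[q]] [BorelSpace ℚ_[q]]

theorem padic_measure_eq_card_cosets (μ : Measure (Fin d → ℚ_[q])) [μ.IsAddHaarMeasure]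
    (h1 : μ {y | ∀ j, ‖y j‖ ≤ 1} = 1) {S : Set (Fin d → ℚ_[q])} {M : ℝ}
    (hM : ∀ x ∈ S, ∀ j, ‖x j‖ ≤ M) {k : ℕ}
    (hk : ∀ x ∈ S, ∀ y ∈ padicBall q d k, x + y ∈ S) :
    (μ S).toReal = (finite_padic_cosets hM k).toFinset.card * ((q : ℝ) ^ (k * d))⁻¹ := by
  have hS : S = ⋃ c ∈ (finite_padic_cosets hM k).toFinset,
      (QuotientAddGroup.mk : _ → (Fin d → ℚ_[q]) ⧸ padicBall q d k) ⁻¹' {c} := by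
    ext x
    simp only [Set.Finite.mem_toFinset, Set.mem_iUnion, Set.mem_preimage, Set.mem_singleton_iff,
      exists_prop, exists_eq_right', Set.mem_image]
    refine ⟨fun hx => ⟨x, hx, rfl⟩, fun ⟨y, hy, hyx⟩ => ?_⟩
    rw [QuotientAddGroup.eq] at hyx
    simpa using hk y hy _ hyx
  have hmeas : ∀ c : (Fin d → ℚ_[q]) ⧸ padicBall q d k,
      (QuotientAddGroup.mk : _ → (Fin d → ℚ_[q]) ⧸ padicBall q d k) ⁻¹' {c} =
        (fun x => -c.out + x) ⁻¹' (padicBall q d k) := by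
    intro c
    ext x
    rw [Set.mem_preimage, Set.mem_preimage, Set.mem_singleton_iff, SetLike.mem_coe,
      ← QuotientAddGroup.eq, QuotientAddGroup.out_eq']
    exact eq_comm
  have hball : μ (padicBall q d k) = ((q : ENNReal) ^ (-(k : ℤ))) ^ d := by
    refine (padic_haar_box μ h1 (fun _ => -(k : ℤ))).trans ?_
    rw [Finset.prod_const, Finset.card_univ, Fintype.card_fin]
  have hcoset : ∀ c : (Fin d → ℚ_[q]) ⧸ padicBall q d k,
      μ ((QuotientAddGroup.mk : _ → (Fin d → ℚ_[q]) ⧸ padicBall q d k) ⁻¹' {c}) =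
        ((q : ENNReal) ^ (-(k : ℤ))) ^ d := fun c => by
    rw [hmeas, measure_preimage_add, hball]
  conv_lhs => rw [hS]
  rw [measure_biUnion_finset]
  · simp only [hcoset, Finset.sum_const, nsmul_eq_mul, ENNReal.toReal_mul, ENNReal.toReal_natCast,
      ENNReal.toReal_pow]
    congr 1
    rw [ENNReal.zpow_neg, ENNReal.toReal_inv, zpow_natCast, ENNReal.toReal_pow,
      ENNReal.toReal_natCast, inv_pow, ← pow_mul]
  · intro a _ b _ hab
    exact Set.disjoint_left.mpr fun x hxa hxb => hab (hxa.symm.trans hxb)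
  · intro c _
    rw [hmeas]
    exact (isOpen_padicBall k).measurableSet.preimage (measurable_const_add _)

end PadicCosets

section SArithmeticCount

variable {d s : ℕ} {p : Fin s → ℕ} [hp : ∀ i, Fact (p i).Prime]

/-- The points of the grid `v + ℤ_S^d` whose real component lies in `X • SR` and whose
`p i`-adic component lies in `SP i` for all `i`. -/
def gridPoints (p : Fin s → ℕ) [∀ i, Fact (p i).Prime] (v : Fin d → ℚ) (SR : Set (Fin d → ℝ))
    (SP : ∀ i, Set (Fin d → ℚ_[p i])) (X : ℝ) : Set (Fin d → ℚ) :=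
  {z | (∀ j, IsZS (∏ i, p i) (z j - v j)) ∧ (fun j => (z j : ℝ) / X) ∈ SR ∧
    ∀ i, ratP p i z ∈ SP i}

/-- `S`-integral vectors with prescribed residues form a coset of a multiple of `ℤ^d`. -/
theorem exists_grid_coset (hpinj : Function.Injective p) (v : Fin d → ℚ) (k : ℕ)
    (x : ∀ i, Fin d → ℚ_[p i]) :
    ∃ u : Fin d → ℚ, ∀ z : Fin d → ℚ,
      ((∀ j, IsZS (∏ i, p i) (z j - v j)) ∧
        ∀ i, ratP p i z - x i ∈ padicBall (p i) d k) ↔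
      ∃ t : Fin d → ℤ, ∀ j, z j = u j + ((∏ i, p i : ℕ) : ℚ) ^ k * t j := by
  have hP := padic_prod_pos p
  choose r hr hrx using fun j => exists_isZS_approx hpinj (fun i => x i j - v j) k
  refine ⟨fun j => v j + r j, fun z => ⟨fun ⟨h1, h2⟩ => ?_, fun ⟨t, ht⟩ => ⟨fun j => ?_, ?_⟩⟩⟩
  · have h3 : ∀ j, ∃ a : ℤ, z j - (v j + r j) = ((∏ i, p i : ℕ) : ℚ) ^ k * a := by
      intro j
      refine isZS_eq_mul_of_norm_le hpinj ?_ fun i => ?_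
      · rw [← sub_sub]
        exact (h1 j).sub hP (hr j)
      · have h4 : ((z j - (v j + r j) : ℚ) : ℚ_[p i]) =
            ((z j : ℚ_[p i]) - x i j) + -((r j : ℚ_[p i]) - (x i j - v j)) := by
          push_cast; ring
        rw [h4]
        refine (IsUltrametricDist.norm_add_le_max _ _).trans (max_le (h2 i j) ?_)
        rw [norm_neg]
        exact hrx j i
    choose t ht using h3
    exact ⟨t, fun j => by rw [← ht]; ring⟩
  · have h3 : z j - v j = r j + ((((∏ i, p i) ^ k : ℕ) : ℤ) * t j : ℤ) := by
      rw [ht j]; push_cast; ring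
    rw [h3]
    exact (hr j).add hP (isZS_intCast _ _)
  · intro i j
    have h4 : ratP p i z j - x i j =
        ((r j : ℚ_[p i]) - (x i j - v j)) + ((∏ i, p i : ℕ) : ℚ_[p i]) ^ k * (t j : ℚ_[p i]) := by
      rw [ratP, ht j]
      push_cast
      ring
    rw [Pi.sub_apply, h4]
    refine (IsUltrametricDist.norm_add_le_max _ _).trans (max_le (hrx j i) ?_)
    have hpos : (0 : ℝ) < p i := by exact_mod_cast (hp i).out.pos
    rw [norm_mul, norm_pow, padic_norm_prod_primes hpinj, _root_.zpow_neg, zpow_natCast, inv_pow]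
    exact mul_le_of_le_one_right (by positivity) (Padic.norm_int_le_one _)

theorem tendsto_grid_count_coset {SR : Set (Fin d → ℝ)} (hb : Bornology.IsBounded SR)
    (hfr : volume (frontier SR) = 0) (u : Fin d → ℚ) {q : ℚ} (hq : 0 < q) :
    Tendsto (fun X : ℝ => ({z : Fin d → ℚ | (∃ t : Fin d → ℤ, ∀ j, z j = u j + q * t j) ∧
      (fun j => (z j : ℝ) / X) ∈ SR}.ncard : ℝ) / X ^ d) atTop
      (𝓝 ((volume SR).toReal * ((q : ℝ) ^ d)⁻¹)) := by
  have hqR : (0 : ℝ) < (q : ℝ) := by exact_mod_cast hq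
  have h := (tendsto_lattice_count hb hfr (fun j => (u j : ℝ)) hqR).mul_const (((q : ℝ) ^ d)⁻¹)
  refine h.congr fun X => ?_
  have hset : {z : Fin d → ℚ | (∃ t : Fin d → ℤ, ∀ j, z j = u j + q * t j) ∧
      (fun j => (z j : ℝ) / X) ∈ SR} = (fun (t : Fin d → ℤ) j => u j + q * t j) ''
        {t : Fin d → ℤ | (fun j => ((u j : ℝ) + q * t j) / X) ∈ SR} := by
    ext z
    constructor
    · rintro ⟨⟨t, ht⟩, hz⟩
      obtain rfl : z = fun j => u j + q * t j := funext ht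
      refine ⟨t, ?_, rfl⟩
      simpa using hz
    · rintro ⟨t, ht, rfl⟩
      refine ⟨⟨t, fun j => rfl⟩, ?_⟩
      simpa using ht
  rw [hset, Set.ncard_image_of_injective]
  · field_simp
  · intro t t' htt
    funext j
    have := congrFun htt j
    simp only [add_right_inj, mul_eq_mul_left_iff, hq.ne', or_false] at this
    exact_mod_cast this

theorem finite_grid_coset {SR : Set (Fin d → ℝ)} (hb : Bornology.IsBounded SR)
    (u : Fin d → ℚ) {q : ℚ} (hq : 0 < q) {X : ℝ} (hX : 0 < X) :
    {z : Fin d → ℚ | (∃ t : Fin d → ℤ, ∀ j, z j = u j + q * t j) ∧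
      (fun j => (z j : ℝ) / X) ∈ SR}.Finite := by
  have hqR : (0 : ℝ) < (q : ℝ) := by exact_mod_cast hq
  refine ((finite_lattice_points hb (fun j => (u j : ℝ)) hqR hX).image
    (fun (t : Fin d → ℤ) j => u j + q * t j)).subset ?_
  rintro z ⟨⟨t, ht⟩, hz⟩
  obtain rfl : z = fun j => u j + q * t j := funext ht
  exact ⟨t, by simpa using hz, rfl⟩

theorem exists_uniform_level {q : Fin s → ℕ} [∀ i, Fact (q i).Prime]
    {SP : ∀ i, Set (Fin d → ℚ_[q i])}
    (hinv : ∀ i, ∃ k : ℕ, ∀ x ∈ SP i, ∀ y ∈ padicBall (q i) d k, x + y ∈ SP i) :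
    ∃ k : ℕ, ∀ i, ∀ x ∈ SP i, ∀ y ∈ padicBall (q i) d k, x + y ∈ SP i := by
  choose k hk using hinv
  exact ⟨∑ i, k i, fun i x hx y hy => hk i x hx y
    (padicBall_mono (Finset.single_le_sum (fun _ _ => Nat.zero_le _) (Finset.mem_univ i)) hy)⟩

/-- Decomposition of the grid points into cosets of a multiple of `ℤ^d`. -/
theorem gridPoints_eq_biUnion (hpinj : Function.Injective p) (v : Fin d → ℚ)
    (SR : Set (Fin d → ℝ)) {SP : ∀ i, Set (Fin d → ℚ_[p i])} {M : Fin s → ℝ}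
    (hM : ∀ i, ∀ x ∈ SP i, ∀ j, ‖x j‖ ≤ M i) {k : ℕ}
    (hk : ∀ i, ∀ x ∈ SP i, ∀ y ∈ padicBall (p i) d k, x + y ∈ SP i) :
    ∃ u : (∀ i, (Fin d → ℚ_[p i]) ⧸ padicBall (p i) d k) → Fin d → ℚ,
      (∀ X, gridPoints p v SR SP X =
        ⋃ c ∈ Fintype.piFinset fun i => (finite_padic_cosets (hM i) k).toFinset,
          {z : Fin d → ℚ | (∃ t : Fin d → ℤ, ∀ j,
            z j = u c j + ((∏ i, p i : ℕ) : ℚ) ^ k * t j) ∧ (fun j => (z j : ℝ) / X) ∈ SR}) ∧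
      ∀ c c' (z : Fin d → ℚ), (∃ t : Fin d → ℤ, ∀ j,
        z j = u c j + ((∏ i, p i : ℕ) : ℚ) ^ k * t j) → (∃ t : Fin d → ℤ, ∀ j,
        z j = u c' j + ((∏ i, p i : ℕ) : ℚ) ^ k * t j) → c = c' := by
  choose u hu using fun c : ∀ i, (Fin d → ℚ_[p i]) ⧸ padicBall (p i) d k =>
    exists_grid_coset hpinj v k fun i => (c i).out
  have hmk : ∀ (c : ∀ i, (Fin d → ℚ_[p i]) ⧸ padicBall (p i) d k) (z : Fin d → ℚ) i,
      ratP p i z - (c i).out ∈ padicBall (p i) d k ↔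
        c i = (QuotientAddGroup.mk (ratP p i z) : (Fin d → ℚ_[p i]) ⧸ padicBall (p i) d k) := by
    intro c z i
    conv_rhs => rw [← QuotientAddGroup.out_eq' (c i), QuotientAddGroup.eq]
    rw [sub_eq_add_neg, add_comm]
  refine ⟨u, fun X => ?_, fun c c' z h h' => ?_⟩
  · ext z
    simp only [Set.mem_iUnion, Fintype.mem_piFinset, Set.Finite.mem_toFinset, exists_prop,
      Set.mem_ofPred_eq, gridPoints, ← hu, hmk]
    constructor
    · rintro ⟨h1, h2, h3⟩
      exact ⟨fun i => QuotientAddGroup.mk (ratP p i z), fun i => ⟨_, h3 i, rfl⟩,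
        ⟨h1, fun i => rfl⟩, h2⟩
    · rintro ⟨c, hc, ⟨h1, h2⟩, h3⟩
      refine ⟨h1, h3, fun i => ?_⟩
      obtain ⟨y, hy, hyc⟩ := hc i
      rw [h2 i, QuotientAddGroup.eq] at hyc
      simpa using hk i y hy _ hyc
  · rw [← hu] at h h'
    funext i
    rw [(hmk c z i).mp (h.2 i), (hmk c' z i).mp (h'.2 i)]

theorem finite_gridPoints (hpinj : Function.Injective p) (v : Fin d → ℚ)
    {SR : Set (Fin d → ℝ)} (hb : Bornology.IsBounded SR) {SP : ∀ i, Set (Fin d → ℚ_[p i])}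
    (hM : ∀ i, ∃ M : ℝ, ∀ x ∈ SP i, ∀ j, ‖x j‖ ≤ M)
    (hk : ∀ i, ∃ k : ℕ, ∀ x ∈ SP i, ∀ y ∈ padicBall (p i) d k, x + y ∈ SP i)
    {X : ℝ} (hX : 0 < X) : (gridPoints p v SR SP X).Finite := by
  choose M hM using hM
  obtain ⟨k, hk⟩ := exists_uniform_level hk
  have hP : (0 : ℚ) < ((∏ i, p i : ℕ) : ℚ) ^ k := pow_pos (by exact_mod_cast padic_prod_pos p) _
  obtain ⟨u, hu, -⟩ := gridPoints_eq_biUnion hpinj v SR hM hk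
  rw [hu]
  exact (Finset.finite_toSet _).biUnion fun c _ => finite_grid_coset hb _ hP hX

variable [∀ i, MeasurableSpace ℚ_[p i]] [∀ i, BorelSpace ℚ_[p i]]

/-- Asymptotic count of the points of the grid `v + ℤ_S^d`. -/
theorem tendsto_grid_count (hpinj : Function.Injective p) (v : Fin d → ℚ)
    {SR : Set (Fin d → ℝ)} (hb : Bornology.IsBounded SR) (hfr : volume (frontier SR) = 0)
    (μd : ∀ i, Measure (Fin d → ℚ_[p i])) [∀ i, (μd i).IsAddHaarMeasure]
    (hμd : ∀ i, μd i {y | ∀ j, ‖y j‖ ≤ 1} = 1) {SP : ∀ i, Set (Fin d → ℚ_[p i])}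
    (hM : ∀ i, ∃ M : ℝ, ∀ x ∈ SP i, ∀ j, ‖x j‖ ≤ M)
    (hk : ∀ i, ∃ k : ℕ, ∀ x ∈ SP i, ∀ y ∈ padicBall (p i) d k, x + y ∈ SP i) :
    Tendsto (fun X : ℝ => ((gridPoints p v SR SP X).ncard : ℝ) / X ^ d) atTop
      (𝓝 ((volume SR).toReal * ∏ i, (μd i (SP i)).toReal)) := by
  choose M hM using hM
  obtain ⟨k, hk⟩ := exists_uniform_level hk
  have hP : (0 : ℚ) < ((∏ i, p i : ℕ) : ℚ) ^ k := pow_pos (by exact_mod_cast padic_prod_pos p) _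
  obtain ⟨u, hu, hdisj⟩ := gridPoints_eq_biUnion hpinj v SR hM hk
  have hlim := tendsto_finsetSum
    (Fintype.piFinset fun i => (finite_padic_cosets (hM i) k).toFinset)
    fun c _ => tendsto_grid_count_coset hb hfr (u c) hP
  have hval : ∑ c ∈ Fintype.piFinset fun i => (finite_padic_cosets (hM i) k).toFinset,
      (volume SR).toReal * ((((((∏ i, p i : ℕ) : ℚ) ^ k : ℚ) : ℝ)) ^ d)⁻¹ =
        (volume SR).toReal * ∏ i, (μd i (SP i)).toReal := by
    rw [Finset.sum_const, Fintype.card_piFinset, nsmul_eq_mul, mul_left_comm]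
    congr 1
    simp_rw [fun i => padic_measure_eq_card_cosets (μd i) (hμd i) (hM i) (hk i)]
    rw [Finset.prod_mul_distrib]
    push_cast
    congr 1
    rw [Finset.prod_inv_distrib, ← pow_mul, Finset.prod_pow]
  rw [hval] at hlim
  refine hlim.congr' ?_
  filter_upwards [eventually_gt_atTop 0] with X hX
  rw [← Finset.sum_div]
  congr 1
  rw [hu, ← Nat.cast_sum]
  congr 1
  classical
  have hfin := fun c => finite_grid_coset hb (u c) hP hX
  have h1 : (⋃ c ∈ Fintype.piFinset fun i => (finite_padic_cosets (hM i) k).toFinset,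
      {z : Fin d → ℚ | (∃ t : Fin d → ℤ, ∀ j,
        z j = u c j + ((∏ i, p i : ℕ) : ℚ) ^ k * t j) ∧ (fun j => (z j : ℝ) / X) ∈ SR}) =
      (((Fintype.piFinset fun i => (finite_padic_cosets (hM i) k).toFinset).biUnion
        fun c => (hfin c).toFinset : Finset (Fin d → ℚ)) : Set (Fin d → ℚ)) := by
    rw [Finset.coe_biUnion]
    refine Set.iUnion_congr fun c => ?_
    rw [Set.Finite.coe_toFinset]
    rfl
  rw [h1, Set.ncard_coe_finset, Finset.card_biUnion]
  · exact Finset.sum_congr rfl fun c _ => Set.ncard_eq_toFinset_card _ (hfin c)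
  · intro c _ c' _ hcc
    rw [Function.onFun, Finset.disjoint_left]
    intro z hz hz'
    rw [Set.Finite.mem_toFinset] at hz hz'
    exact hcc (hdisj c c' z hz.1 hz'.1)

end SArithmeticCount

section SPart

variable {s : ℕ} {p : Fin s → ℕ} [hp : ∀ i, Fact (p i).Prime]

/-- The part of a natural number composed of the primes `p i`. -/
def sPart (p : Fin s → ℕ) (b : ℕ) : ℕ := ∏ i, p i ^ padicValNat (p i) b

theorem sPart_pos (b : ℕ) : 0 < sPart p b :=
  Finset.prod_pos fun i _ => pow_pos (hp i).out.pos _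

theorem sPart_dvd (hpinj : Function.Injective p) (b : ℕ) : sPart p b ∣ b := by
  refine Finset.prod_dvd_of_isRelPrime (fun i _ j _ hij => ?_) fun i _ => pow_padicValNat_dvd
  rw [Function.onFun, ← Nat.coprime_iff_isRelPrime]
  exact Nat.Coprime.pow _ _ ((Nat.coprime_primes (hp i).out (hp j).out).mpr
    fun h => hij (hpinj h))

theorem prod_padic_norm_natCast {b : ℕ} (hb : b ≠ 0) :
    ∏ i, ‖(b : ℚ_[p i])‖ = ((sPart p b : ℕ) : ℝ)⁻¹ := by
  rw [sPart, Nat.cast_prod, ← Finset.prod_inv_distrib]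
  refine Finset.prod_congr rfl fun i _ => ?_
  rw [Padic.norm_eq_zpow_neg_valuation (by exact_mod_cast hb), Padic.valuation_natCast,
    _root_.zpow_neg, zpow_natCast, Nat.cast_pow]

/-- The relative density of pairs of parallel vectors with ratio of denominator `b`. -/
noncomputable def parWeight (p : Fin s → ℕ) (d b : ℕ) : ℝ :=
  ((sPart p b : ℕ) : ℝ)⁻¹ * (((b / sPart p b : ℕ) : ℝ) ^ d)⁻¹

theorem parWeight_nonneg (p : Fin s → ℕ) (d b : ℕ) : 0 ≤ parWeight p d b := by
  unfold parWeight; positivity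

theorem summable_sqrt_parWeight (hpinj : Function.Injective p) {d : ℕ} (hd : 3 ≤ d) :
    Summable fun b => √(parWeight p d b) := by
  let f : ℕ →* ℝ :=
    { toFun := fun k => √((k : ℝ)⁻¹)
      map_one' := by simp
      map_mul' := fun a b => by
        push_cast
        rw [mul_inv, Real.sqrt_mul (by positivity)] }
  have hf : ∀ {q : ℕ}, q.Prime → ‖f q‖ < 1 := by
    intro q hq
    change ‖√((q : ℝ)⁻¹)‖ < 1
    rw [Real.norm_of_nonneg (Real.sqrt_nonneg _), Real.sqrt_lt' one_pos, one_pow]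
    exact inv_lt_one_of_one_lt₀ (by exact_mod_cast hq.one_lt)
  have h1 := (EulerProduct.summable_and_hasSum_factoredNumbers_prod_filter_prime_geometric hf
    (Finset.univ.image p)).1
  have h2 : Summable fun k : ℕ => √(((k : ℝ) ^ 3)⁻¹) := by
    refine (Real.summable_nat_rpow_inv.mpr (show (1 : ℝ) < 3 / 2 by norm_num)).congr fun k => ?_
    rw [Real.sqrt_inv, Real.sqrt_eq_rpow, ← Real.rpow_natCast, ← Real.rpow_mul (by positivity)]
    norm_num
  have h3 := h1.mul_of_nonneg h2 (fun _ => norm_nonneg _) fun _ => Real.sqrt_nonneg _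
  have hmem : ∀ b, sPart p b ∈ Nat.factoredNumbers (Finset.univ.image p) := by
    intro b
    rw [Nat.mem_factoredNumbers']
    intro q hq hqd
    obtain ⟨i, -, hi⟩ := (Nat.Prime.prime hq).exists_mem_finset_dvd hqd
    rw [(Nat.prime_dvd_prime_iff_eq hq (hp i).out).mp (hq.dvd_of_dvd_pow hi)]
    exact Finset.mem_image_of_mem _ (Finset.mem_univ i)
  have hinj : Function.Injective fun b : ℕ =>
      ((⟨sPart p b, hmem b⟩, b / sPart p b) : Nat.factoredNumbers (Finset.univ.image p) × ℕ) := by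
    intro a b hab
    simp only [Prod.mk.injEq, Subtype.mk.injEq] at hab
    rw [← Nat.mul_div_cancel' (sPart_dvd hpinj a), ← Nat.mul_div_cancel' (sPart_dvd hpinj b),
      hab.2, hab.1]
  refine Summable.of_nonneg_of_le (fun _ => Real.sqrt_nonneg _) (fun b => ?_)
    (h3.comp_injective hinj)
  rw [parWeight, Real.sqrt_mul (by positivity)]
  change _ ≤ ‖√(((sPart p b : ℕ) : ℝ)⁻¹)‖ * √((((b / sPart p b : ℕ) : ℝ) ^ 3)⁻¹)
  rw [Real.norm_of_nonneg (Real.sqrt_nonneg _)]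
  refine mul_le_mul_of_nonneg_left (Real.sqrt_le_sqrt ?_) (Real.sqrt_nonneg _)
  rcases Nat.eq_zero_or_pos (b / sPart p b) with h | h
  · rw [h]
    simp [show d ≠ 0 by lia]
  · have h1 : (1 : ℝ) ≤ ((b / sPart p b : ℕ) : ℝ) := by exact_mod_cast h
    exact inv_anti₀ (by positivity) (pow_le_pow_right₀ h1 hd)

theorem summable_den_mul_den_inv {f : ℕ → ℝ} (hf0 : ∀ k, 0 ≤ f k) (hf : Summable f) :
    Summable fun c : ℚ => f c.den * f c⁻¹.den := by
  have h1 := hf.mul_of_nonneg hf hf0 hf0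
  have h2 : Summable fun _ : SignType => (1 : ℝ) := (hasSum_fintype _).summable
  have h3 := h1.mul_of_nonneg h2 (fun x => mul_nonneg (hf0 _) (hf0 _)) fun _ => zero_le_one
  have hinj : Function.Injective fun c : ℚ => ((c.den, c⁻¹.den), SignType.sign c) := by
    have habs : ∀ c : ℚ, c ≠ 0 → |c| = c⁻¹.den / c.den := by
      intro c hc
      rw [Rat.den_inv_of_ne_zero hc, Nat.cast_natAbs, Int.cast_abs]
      nth_rewrite 1 [← Rat.num_div_den c]
      rw [abs_div, Nat.abs_cast]
    intro c e hce
    simp only [Prod.mk.injEq] at hce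
    obtain ⟨⟨h1, h2⟩, h3⟩ := hce
    by_cases hc : c = 0
    · subst hc
      rw [sign_zero] at h3
      exact (sign_eq_zero_iff.mp h3.symm).symm
    · have he : e ≠ 0 := by
        rintro rfl
        rw [sign_zero, sign_eq_zero_iff] at h3
        exact hc h3
      rw [← sign_mul_abs c, ← sign_mul_abs e, habs c hc, habs e he, h1, h2, h3]
  exact (h3.comp_injective hinj).congr fun c => by simp

end SPart

section PadicNice

variable {q d : ℕ} [hq : Fact q.Prime]

theorem padic_exists_pow_le (r : ℝ) (hr : 0 < r) : ∃ k : ℕ, (q : ℝ) ^ (-(k : ℤ)) ≤ r := by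
  have h1 : (1 : ℝ) < q := by exact_mod_cast hq.out.one_lt
  obtain ⟨k, hk⟩ := pow_unbounded_of_one_lt r⁻¹ h1
  refine ⟨k, ?_⟩
  rw [_root_.zpow_neg, zpow_natCast]
  exact inv_le_of_inv_le₀ hr hk.le

theorem padic_isOpen_of_translation {S : Set (Fin d → ℚ_[q])}
    (h : ∃ k : ℕ, ∀ x ∈ S, ∀ y ∈ padicBall q d k, x + y ∈ S) : IsOpen S := by
  obtain ⟨k, hk⟩ := h
  rw [isOpen_iff_mem_nhds]
  intro x hx
  have h1 : (fun y => y - x) ⁻¹' (padicBall q d k : Set (Fin d → ℚ_[q])) ∈ 𝓝 x := by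
    refine ((isOpen_padicBall k).preimage (continuous_id.sub continuous_const)).mem_nhds ?_
    simp
  refine Filter.mem_of_superset h1 fun y hy => ?_
  simpa using hk x hx _ hy

/-- Linear preimages of translation invariant sets are translation invariant. -/
theorem padic_translation_preimage {S : Set (Fin d → ℚ_[q])}
    (h : ∃ k : ℕ, ∀ x ∈ S, ∀ y ∈ padicBall q d k, x + y ∈ S)
    (M : Matrix (Fin d) (Fin d) ℚ_[q]) :
    ∃ k : ℕ, ∀ x ∈ {x | M *ᵥ x ∈ S}, ∀ y ∈ padicBall q d k, x + y ∈ {x | M *ᵥ x ∈ S} := by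
  obtain ⟨k, hk⟩ := h
  have hqpos : (0 : ℝ) < q := by exact_mod_cast hq.out.pos
  obtain ⟨B, hB0, hB⟩ : ∃ B : ℝ, 0 < B ∧ ∀ i j, ‖M i j‖ ≤ B := by
    refine ⟨1 + ∑ i, ∑ j, ‖M i j‖, by positivity, fun i j => ?_⟩
    have h1 : ‖M i j‖ ≤ ∑ j, ‖M i j‖ :=
      Finset.single_le_sum (f := fun j => ‖M i j‖) (fun _ _ => norm_nonneg _) (Finset.mem_univ j)
    have h2 : ∑ j, ‖M i j‖ ≤ ∑ i, ∑ j, ‖M i j‖ :=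
      Finset.single_le_sum (f := fun i => ∑ j, ‖M i j‖)
        (fun _ _ => Finset.sum_nonneg fun _ _ => norm_nonneg _) (Finset.mem_univ i)
    linarith
  obtain ⟨l, hl⟩ := padic_exists_pow_le (q := q) ((q : ℝ) ^ (-(k : ℤ)) / B) (by positivity)
  refine ⟨l, fun x hx y hy => ?_⟩
  change M *ᵥ (x + y) ∈ S
  rw [mulVec_add]
  refine hk _ hx _ fun i => ?_
  change ‖∑ j, M i j * y j‖ ≤ _
  refine IsUltrametricDist.norm_sum_le_of_forall_le_of_nonneg (by positivity) fun j _ => ?_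
  rw [norm_mul]
  calc ‖M i j‖ * ‖y j‖ ≤ B * ((q : ℝ) ^ (-(k : ℤ)) / B) := by
        gcongr
        · exact hB i j
        · exact (hy j).trans hl
    _ = _ := by field_simp

theorem padic_translation_smul {S : Set (Fin d → ℚ_[q])}
    (h : ∃ k : ℕ, ∀ x ∈ S, ∀ y ∈ padicBall q d k, x + y ∈ S) (t : ℚ_[q]) :
    ∃ k : ℕ, ∀ x ∈ {x | t • x ∈ S}, ∀ y ∈ padicBall q d k, x + y ∈ {x | t • x ∈ S} := by
  simpa [smul_mulVec] using padic_translation_preimage h (t • 1)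

theorem padic_translation_inter {S S' : Set (Fin d → ℚ_[q])}
    (h : ∃ k : ℕ, ∀ x ∈ S, ∀ y ∈ padicBall q d k, x + y ∈ S)
    (h' : ∃ k : ℕ, ∀ x ∈ S', ∀ y ∈ padicBall q d k, x + y ∈ S') :
    ∃ k : ℕ, ∀ x ∈ S ∩ S', ∀ y ∈ padicBall q d k, x + y ∈ S ∩ S' := by
  obtain ⟨k, hk⟩ := h
  obtain ⟨l, hl⟩ := h'
  exact ⟨max k l, fun x hx y hy => ⟨hk x hx.1 y (padicBall_mono (le_max_left _ _) hy),
    hl x hx.2 y (padicBall_mono (le_max_right _ _) hy)⟩⟩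

variable [MeasurableSpace ℚ_[q]]

theorem padic_measure_lt_top (μ : Measure (Fin d → ℚ_[q])) [μ.IsAddHaarMeasure]
    {S : Set (Fin d → ℚ_[q])} {M : ℝ} (hM : ∀ x ∈ S, ∀ j, ‖x j‖ ≤ M) : μ S < ⊤ := by
  have hc : IsCompact (Metric.closedBall (0 : Fin d → ℚ_[q]) (max M 0)) := isCompact_closedBall _ _
  refine (measure_mono fun x hx => ?_).trans_lt hc.measure_lt_top
  rw [mem_closedBall_zero_iff, pi_norm_le_iff_of_nonneg (le_max_right _ _)]
  exact fun j => (hM x hx j).trans (le_max_left _ _)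

variable [BorelSpace ℚ_[q]]

/-- Regularity conditions on a subset of `ℚ_q^d`: it is bounded, a union of balls of a fixed
radius, invariant under multiplication by units, and multiplication by large scalars moves
most of it away from itself. -/
structure PadicNice (μ : Measure (Fin d → ℚ_[q])) (S : Set (Fin d → ℚ_[q])) : Prop where
  bounded : ∃ M : ℝ, ∀ x ∈ S, ∀ j, ‖x j‖ ≤ M
  translation : ∃ k : ℕ, ∀ x ∈ S, ∀ y ∈ padicBall q d k, x + y ∈ S
  unit : ∀ u : ℚ_[q], ‖u‖ = 1 → ∀ x ∈ S, u • x ∈ S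
  shrink : ∀ c : ℚ_[q], 1 < ‖c‖ → (μ (S ∩ {x | c • x ∈ S})).toReal ≤ ‖c‖⁻¹ * (μ S).toReal

theorem padic_measure_mulVec_preimage (μ : Measure (Fin d → ℚ_[q])) [μ.IsAddHaarMeasure]
    (h1 : μ {y | ∀ j, ‖y j‖ ≤ 1} = 1) {S : Set (Fin d → ℚ_[q])} (hS : MeasurableSet S)
    (M : Matrix (Fin d) (Fin d) ℚ_[q]) (hM : M.det ≠ 0) :
    (μ {x | M *ᵥ x ∈ S}).toReal = ‖M.det‖⁻¹ * (μ S).toReal := by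
  have hcont : Continuous (fun x => M *ᵥ x) :=
    Continuous.matrix_mulVec continuous_const continuous_id
  have h2 : μ {x | M *ᵥ x ∈ S} = Measure.map (M *ᵥ ·) μ S :=
    (Measure.map_apply hcont.measurable hS).symm
  rw [h2, padic_map_mulVec μ h1 M hM, Measure.smul_apply, smul_eq_mul, ENNReal.toReal_mul,
    ENNReal.toReal_inv, ENNReal.toReal_ofReal (norm_nonneg _)]

theorem padic_measure_smul_preimage (μ : Measure (Fin d → ℚ_[q])) [μ.IsAddHaarMeasure]
    (h1 : μ {y | ∀ j, ‖y j‖ ≤ 1} = 1) {S : Set (Fin d → ℚ_[q])} (hS : MeasurableSet S)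
    {t : ℚ_[q]} (ht : t ≠ 0) :
    (μ {x | t • x ∈ S}).toReal = (‖t‖ ^ d)⁻¹ * (μ S).toReal := by
  have hdet : (t • (1 : Matrix (Fin d) (Fin d) ℚ_[q])).det = t ^ d := by simp
  have h := padic_measure_mulVec_preimage μ h1 hS (t • 1) (by rw [hdet]; exact pow_ne_zero _ ht)
  rw [hdet, norm_pow] at h
  simpa [smul_mulVec] using h

theorem PadicNice.measurableSet {μ : Measure (Fin d → ℚ_[q])} {S : Set (Fin d → ℚ_[q])}
    (h : PadicNice μ S) : MeasurableSet S :=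
  (padic_isOpen_of_translation h.translation).measurableSet

/-- Regularity is preserved by unimodular linear maps. -/
theorem PadicNice.preimage {μ : Measure (Fin d → ℚ_[q])} [μ.IsAddHaarMeasure]
    (h1 : μ {y | ∀ j, ‖y j‖ ≤ 1} = 1) {S : Set (Fin d → ℚ_[q])} (h : PadicNice μ S)
    (g : Matrix.SpecialLinearGroup (Fin d) ℚ_[q]) :
    PadicNice μ {x | (g : Matrix (Fin d) (Fin d) ℚ_[q]) *ᵥ x ∈ S} where
  bounded := by
    obtain ⟨M, hM⟩ := h.bounded
    let B : ℝ := ∑ i, ∑ j, ‖(g⁻¹ : Matrix.SpecialLinearGroup (Fin d) ℚ_[q]) i j‖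
    refine ⟨B * max M 0, fun x hx i => ?_⟩
    have h2 : x i = ∑ j, (g⁻¹ : Matrix.SpecialLinearGroup (Fin d) ℚ_[q]) i j *
        ((g : Matrix (Fin d) (Fin d) ℚ_[q]) *ᵥ x) j := by
      have h3 : x = (↑(g⁻¹) : Matrix (Fin d) (Fin d) ℚ_[q]) *ᵥ
          ((g : Matrix (Fin d) (Fin d) ℚ_[q]) *ᵥ x) := by
        rw [mulVec_mulVec, ← Matrix.SpecialLinearGroup.coe_mul, inv_mul_cancel,
          Matrix.SpecialLinearGroup.coe_one, one_mulVec]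
      exact congrFun h3 i
    rw [h2]
    calc ‖∑ j, (g⁻¹ : Matrix.SpecialLinearGroup (Fin d) ℚ_[q]) i j *
          ((g : Matrix (Fin d) (Fin d) ℚ_[q]) *ᵥ x) j‖
        ≤ ∑ j, ‖(g⁻¹ : Matrix.SpecialLinearGroup (Fin d) ℚ_[q]) i j‖ * max M 0 := by
          refine norm_sum_le_of_le _ fun j _ => ?_
          rw [norm_mul]
          gcongr
          exact (hM _ hx j).trans (le_max_left _ _)
      _ = (∑ j, ‖(g⁻¹ : Matrix.SpecialLinearGroup (Fin d) ℚ_[q]) i j‖) * max M 0 := by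
          rw [Finset.sum_mul]
      _ ≤ B * max M 0 := by
          refine mul_le_mul_of_nonneg_right ?_ (le_max_right _ _)
          exact Finset.single_le_sum
            (f := fun i => ∑ j, ‖(g⁻¹ : Matrix.SpecialLinearGroup (Fin d) ℚ_[q]) i j‖)
            (fun _ _ => Finset.sum_nonneg fun _ _ => norm_nonneg _) (Finset.mem_univ i)
  translation := padic_translation_preimage h.translation _
  unit u hu x hx := by
    change _ *ᵥ (u • x) ∈ S
    rw [mulVec_smul]
    exact h.unit u hu _ hx
  shrink c hc := by
    have hdet : ((g : Matrix (Fin d) (Fin d) ℚ_[q])).det ≠ 0 := by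
      rw [Matrix.SpecialLinearGroup.det_coe]; exact one_ne_zero
    have hS := h.measurableSet
    have hS' : MeasurableSet (S ∩ {x | c • x ∈ S}) :=
      (padic_isOpen_of_translation (padic_translation_inter h.translation
        (padic_translation_smul h.translation c))).measurableSet
    have h2 : {x | (g : Matrix (Fin d) (Fin d) ℚ_[q]) *ᵥ x ∈ S} ∩
        {x | c • x ∈ {x | (g : Matrix (Fin d) (Fin d) ℚ_[q]) *ᵥ x ∈ S}} =
        {x | (g : Matrix (Fin d) (Fin d) ℚ_[q]) *ᵥ x ∈ S ∩ {x | c • x ∈ S}} := by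
      ext x
      simp [mulVec_smul]
    rw [h2, padic_measure_mulVec_preimage μ h1 hS' _ hdet,
      padic_measure_mulVec_preimage μ h1 hS _ hdet, Matrix.SpecialLinearGroup.det_coe]
    simpa using h.shrink c hc

end PadicNice

section ParallelPairs

variable {d : ℕ}

/-- The number of vectors of `Z` whose multiple by `c` lies in `Z`. -/
def ratioCount (Z : Finset (Fin d → ℚ)) (c : ℚ) : ℕ := (Z.filter fun z => c • z ∈ Z).card

open Classical in
/-- The number of pairs of parallel vectors in `Z`. -/
noncomputable def parCount (Z : Finset (Fin d → ℚ)) : ℕ :=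
  ((Z ×ˢ Z).filter fun q => IsParallel q.1 q.2).card

theorem IsParallel.exists_smul {y w : Fin d → ℚ} (h : IsParallel y w) (hy : y ≠ 0) :
    ∃ c : ℚ, w = c • y := by
  obtain ⟨i, hi⟩ := Function.ne_iff.mp hy
  refine ⟨w i / y i, funext fun j => ?_⟩
  have hi' : y i ≠ 0 := hi
  rw [Pi.smul_apply, smul_eq_mul]
  field_simp
  linarith [h i j]

theorem parCount_le_sum {Z : Finset (Fin d → ℚ)} (h0 : ∀ z ∈ Z, z ≠ 0) :
    ∃ F : Finset ℚ, parCount Z ≤ ∑ c ∈ F, ratioCount Z c := by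
  classical
  have h : ∀ q ∈ (Z ×ˢ Z).filter fun q => IsParallel q.1 q.2, ∃ c : ℚ, q.2 = c • q.1 := by
    intro q hq
    rw [Finset.mem_filter, Finset.mem_product] at hq
    exact hq.2.exists_smul (h0 _ hq.1.1)
  choose! c hc using h
  refine ⟨((Z ×ˢ Z).filter fun q => IsParallel q.1 q.2).image c, ?_⟩
  rw [parCount]
  calc _ ≤ ((((Z ×ˢ Z).filter fun q => IsParallel q.1 q.2).image c).biUnion fun e =>
        (Z.filter fun z => e • z ∈ Z).image fun z => (z, e • z)).card := by
        refine Finset.card_le_card fun q hq => ?_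
        rw [Finset.mem_biUnion]
        refine ⟨c q, Finset.mem_image_of_mem _ hq, ?_⟩
        rw [Finset.mem_image]
        have hq' := Finset.mem_product.mp (Finset.mem_filter.mp hq).1
        refine ⟨q.1, Finset.mem_filter.mpr ⟨hq'.1, ?_⟩, ?_⟩
        · rw [← hc q hq]; exact hq'.2
        · rw [← hc q hq]
    _ ≤ _ := Finset.card_biUnion_le.trans (Finset.sum_le_sum fun e _ => Finset.card_image_le)

theorem card_le_parCount (Z : Finset (Fin d → ℚ)) : Z.card ≤ parCount Z := by
  classical
  rw [parCount]
  refine Finset.card_le_card_of_injOn (fun z => (z, z)) (fun z hz => ?_) fun a _ b _ h => ?_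
  · simp only [Finset.coe_filter, Finset.mem_product, Set.mem_ofPred_eq]
    exact ⟨⟨hz, hz⟩, fun i j => mul_comm _ _⟩
  · exact (Prod.mk.inj h).1

theorem ratioCount_inv (Z : Finset (Fin d → ℚ)) {c : ℚ} (hc : c ≠ 0) :
    ratioCount Z c⁻¹ = ratioCount Z c := by
  have h : ∀ e : ℚ, e ≠ 0 → ratioCount Z e ≤ ratioCount Z e⁻¹ := by
    intro e he
    refine Finset.card_le_card_of_injOn (fun z => e • z) (fun z hz => ?_) fun a _ b _ hab => ?_
    · rw [Finset.coe_filter] at hz ⊢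
      exact ⟨hz.2, by rw [inv_smul_smul₀ he]; exact hz.1⟩
    · exact smul_right_injective _ he hab
  refine le_antisymm ?_ (h c hc)
  simpa using h c⁻¹ (inv_ne_zero hc)

theorem ratioCount_zero {Z : Finset (Fin d → ℚ)} (h0 : ∀ z ∈ Z, z ≠ 0) : ratioCount Z 0 = 0 := by
  rw [ratioCount, Finset.card_eq_zero, Finset.filter_eq_empty_iff]
  intro z _ h
  exact h0 _ h (zero_smul _ _)

theorem Rat.dvd_den_of_mul_eq_int {c : ℚ} {y w : ℤ} (h : (w : ℚ) = c * y) :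
    ∃ t : ℤ, y = c.den * t ∧ w = c.num * t := by
  have hb : (c.den : ℚ) ≠ 0 := by exact_mod_cast c.den_nz
  have h1 : w * c.den = c.num * y := by
    have : (w : ℚ) * c.den = c.num * y := by
      rw [h]
      nth_rewrite 1 [← Rat.num_div_den c]
      field_simp
    exact_mod_cast this
  have hcop : IsCoprime (c.den : ℤ) c.num := by
    rw [Int.isCoprime_iff_gcd_eq_one, Int.gcd_comm]
    exact c.reduced
  obtain ⟨t, ht⟩ := hcop.dvd_of_dvd_mul_left (Dvd.intro_left _ h1)
  refine ⟨t, ht, ?_⟩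
  have hb' : (c.den : ℤ) ≠ 0 := by exact_mod_cast c.den_nz
  apply mul_right_cancel₀ hb'
  rw [h1, ht]
  ring

theorem card_box_le {h : ℝ} {F : Finset (Fin d → ℤ)} (h0 : ∀ t ∈ F, t ≠ 0)
    (hF : ∀ t ∈ F, ∀ j, |(t j : ℝ)| ≤ h) : (F.card : ℝ) ≤ (3 * |h|) ^ d := by
  by_cases hh : h < 1
  · have hFe : F = ∅ := by
      refine Finset.eq_empty_of_forall_notMem fun t ht => h0 t ht (funext fun j => ?_)
      have h1 := (hF t ht j).trans_lt hh
      rw [← Int.cast_abs] at h1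
      exact Int.abs_lt_one_iff.mp (by exact_mod_cast h1)
    rw [hFe, Finset.card_empty, Nat.cast_zero]
    positivity
  · push Not at hh
    have hsub : F ⊆ Fintype.piFinset fun _ => Finset.Icc (-⌊h⌋) ⌊h⌋ := by
      intro t ht
      rw [Fintype.mem_piFinset]
      intro j
      rw [Finset.mem_Icc, ← abs_le, Int.le_floor]
      push_cast
      exact hF t ht j
    have hfl : 0 ≤ ⌊h⌋ := Int.floor_nonneg.mpr (by linarith)
    have hc : ((Finset.Icc (-⌊h⌋) ⌊h⌋).card : ℝ) = 2 * (⌊h⌋ : ℝ) + 1 := by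
      have : ((Finset.Icc (-⌊h⌋) ⌊h⌋).card : ℤ) = 2 * ⌊h⌋ + 1 := by
        rw [Int.card_Icc, Int.toNat_of_nonneg (by lia)]
        ring
      exact_mod_cast this
    calc (F.card : ℝ) ≤ ((Fintype.piFinset fun _ : Fin d => Finset.Icc (-⌊h⌋) ⌊h⌋).card : ℝ) := by
          exact_mod_cast Finset.card_le_card hsub
      _ = (2 * (⌊h⌋ : ℝ) + 1) ^ d := by
          rw [Fintype.card_piFinset_const, Nat.cast_pow, hc]
      _ ≤ (3 * |h|) ^ d := by
          have := Int.floor_le h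
          have hfl' : (0 : ℝ) ≤ ⌊h⌋ := by exact_mod_cast hfl
          refine pow_le_pow_left₀ (by positivity) ?_ _
          rw [abs_of_nonneg (by linarith)]
          linarith

/-- The summable weight dominating the number of parallel pairs with a given ratio. -/
noncomputable def ratioWeight (c : ℚ) : ℝ :=
  √(((c.den : ℝ) ^ 3)⁻¹) * √(((c⁻¹.den : ℝ) ^ 3)⁻¹)

theorem ratioWeight_nonneg (c : ℚ) : 0 ≤ ratioWeight c := by
  unfold ratioWeight; positivity

theorem summable_ratioWeight : Summable ratioWeight := by
  refine summable_den_mul_den_inv (f := fun k : ℕ => √(((k : ℝ) ^ 3)⁻¹))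
    (fun _ => Real.sqrt_nonneg _) ?_
  refine (Real.summable_nat_rpow_inv.mpr (show (1 : ℝ) < 3 / 2 by norm_num)).congr fun k => ?_
  rw [Real.sqrt_inv, Real.sqrt_eq_rpow, ← Real.rpow_natCast, ← Real.rpow_mul (by positivity)]
  norm_num

theorem ratioCount_le (hd : 3 ≤ d) {Z : Finset (Fin d → ℚ)} (h0 : ∀ z ∈ Z, z ≠ 0) {Q : ℚ}
    (hQ0 : Q ≠ 0) (hQ : ∀ z ∈ Z, ∀ j, ∃ a : ℤ, Q * z j = a) {H : ℝ}
    (hH : ∀ z ∈ Z, ∀ j, |((Q * z j : ℚ) : ℝ)| ≤ H) (hH0 : 0 ≤ H) (c : ℚ) :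
    (ratioCount Z c : ℝ) ≤ (3 * H) ^ d * ratioWeight c := by
  by_cases hc : c = 0
  · rw [hc, ratioCount_zero h0, Nat.cast_zero]
    have := ratioWeight_nonneg 0
    positivity
  have key : ∀ z ∈ Z.filter fun z => c • z ∈ Z, ∃ t : Fin d → ℤ, ∀ j,
      Q * z j = c.den * t j ∧ Q * (c * z j) = c.num * t j := by
    intro z hz
    rw [Finset.mem_filter] at hz
    have : ∀ j, ∃ t : ℤ, Q * z j = c.den * t ∧ Q * (c * z j) = c.num * t := by
      intro j
      obtain ⟨y, hy⟩ := hQ z hz.1 j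
      obtain ⟨w, hw⟩ := hQ _ hz.2 j
      rw [Pi.smul_apply, smul_eq_mul] at hw
      obtain ⟨t, ht1, ht2⟩ := Rat.dvd_den_of_mul_eq_int (c := c) (y := y) (w := w) (by
        rw [← hw, ← hy]; ring)
      refine ⟨t, ?_, ?_⟩
      · rw [hy, ht1]; push_cast; rfl
      · rw [hw, ht2]; push_cast; rfl
    choose t ht using this
    exact ⟨t, ht⟩
  choose! t ht using key
  have hb : (c.den : ℚ) ≠ 0 := by exact_mod_cast c.den_nz
  have hA : c⁻¹.den = c.num.natAbs := Rat.den_inv_of_ne_zero hc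
  have hApos : 0 < c⁻¹.den := c⁻¹.den_pos
  have hinj : Set.InjOn t ((Z.filter fun z => c • z ∈ Z : Finset _) : Set (Fin d → ℚ)) := by
    intro z hz w hw hzw
    refine funext fun j => mul_left_cancel₀ hQ0 ?_
    rw [(ht z hz j).1, (ht w hw j).1, hzw]
  have hmaxpos : (0 : ℝ) < max (c.den : ℝ) (c⁻¹.den : ℝ) :=
    lt_max_of_lt_left (by exact_mod_cast c.den_pos)
  have hcard : (ratioCount Z c : ℝ) ≤ (3 * |H / max (c.den : ℝ) (c⁻¹.den : ℝ)|) ^ d := by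
    rw [ratioCount, ← Finset.card_image_of_injOn hinj]
    refine card_box_le ?_ ?_
    · simp only [Finset.mem_image]
      rintro _ ⟨z, hz, rfl⟩ h
      refine h0 z (Finset.mem_filter.mp hz).1 (funext fun j => mul_left_cancel₀ hQ0 ?_)
      rw [(ht z hz j).1, h]
      simp
    · simp only [Finset.mem_image]
      rintro _ ⟨z, hz, rfl⟩ j
      have hz' := Finset.mem_filter.mp hz
      rw [le_div_iff₀ hmaxpos, mul_max_of_nonneg _ _ (abs_nonneg _), max_le_iff]
      constructor
      · have := hH z hz'.1 j
        rw [(ht z hz j).1] at this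
        push_cast at this
        rw [abs_mul, Nat.abs_cast] at this
        linarith
      · have := hH _ hz'.2 j
        rw [Pi.smul_apply, smul_eq_mul, (ht z hz j).2] at this
        push_cast at this
        rw [abs_mul] at this
        rw [hA, Nat.cast_natAbs, Int.cast_abs]
        linarith
  refine hcard.trans ?_
  rw [abs_of_nonneg (by positivity), ← mul_div_assoc, div_pow, div_eq_mul_inv]
  refine mul_le_mul_of_nonneg_left ?_ (by positivity)
  rw [ratioWeight, ← Real.sqrt_mul (by positivity), ← mul_inv, Real.sqrt_inv]
  have hpos1 : (0 : ℝ) < c.den := by exact_mod_cast c.den_pos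
  have hpos2 : (0 : ℝ) < c⁻¹.den := by exact_mod_cast hApos
  refine inv_anti₀ (by positivity) ?_
  have h1 : (1 : ℝ) ≤ max (c.den : ℝ) (c⁻¹.den : ℝ) :=
    le_max_of_le_left (by exact_mod_cast c.den_pos)
  refine le_trans ?_ (pow_le_pow_right₀ h1 hd)
  refine Real.sqrt_le_iff.mpr ⟨by positivity, ?_⟩
  rw [← pow_mul, show 3 * 2 = 3 + 3 from rfl, pow_add]
  gcongr
  · exact le_max_left _ _
  · exact le_max_right _ _

theorem parCount_le (hd : 3 ≤ d) {Z : Finset (Fin d → ℚ)} (h0 : ∀ z ∈ Z, z ≠ 0) {Q : ℚ}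
    (hQ0 : Q ≠ 0) (hQ : ∀ z ∈ Z, ∀ j, ∃ a : ℤ, Q * z j = a) {H : ℝ}
    (hH : ∀ z ∈ Z, ∀ j, |((Q * z j : ℚ) : ℝ)| ≤ H) (hH0 : 0 ≤ H) :
    (parCount Z : ℝ) ≤ (3 * H) ^ d * ∑' c, ratioWeight c := by
  obtain ⟨F, hF⟩ := parCount_le_sum h0
  calc (parCount Z : ℝ) ≤ ∑ c ∈ F, (ratioCount Z c : ℝ) := by exact_mod_cast hF
    _ ≤ ∑ c ∈ F, (3 * H) ^ d * ratioWeight c :=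
        Finset.sum_le_sum fun c _ => ratioCount_le hd h0 hQ0 hQ hH hH0 c
    _ = (3 * H) ^ d * ∑ c ∈ F, ratioWeight c := by rw [Finset.mul_sum]
    _ ≤ _ := by
        gcongr
        exact summable_ratioWeight.sum_le_tsum _ fun c _ => ratioWeight_nonneg c

end ParallelPairs

section GridParallel

theorem IsZS.div_den {P : ℕ} (hP : 0 < P) {c x : ℚ} (hx : IsZS P x) (hcx : IsZS P (c * x)) :
    IsZS P (x / c.den) := by
  have hb : (c.den : ℚ) ≠ 0 := by exact_mod_cast c.den_nz
  have hcop : IsCoprime c.num (c.den : ℤ) := by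
    rw [Int.isCoprime_iff_gcd_eq_one]
    exact c.reduced
  obtain ⟨u, w, huw⟩ := hcop
  have huw' : (u : ℚ) * c.num + w * c.den = 1 := by exact_mod_cast huw
  have h1 : x / c.den = u * (c * x) + w * x := by
    rw [eq_comm, ← mul_one (x / c.den), ← huw']
    nth_rewrite 1 [← Rat.num_div_den c]
    field_simp
  rw [h1]
  exact ((isZS_intCast P u).mul hcx).add hP ((isZS_intCast P w).mul hx)

variable {s d : ℕ} {p : Fin s → ℕ} [hp : ∀ i, Fact (p i).Prime]

theorem isZS_mul_of_grid {N : ℕ} {v z : Fin d → ℚ} (hv : ∀ j, IsZS (∏ i, p i) (N * v j))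
    (hz : ∀ j, IsZS (∏ i, p i) (z j - v j)) (j : Fin d) : IsZS (∏ i, p i) (N * z j) := by
  have h := ((isZS_natCast (∏ i, p i) N).mul (hz j)).add (padic_prod_pos p) (hv j)
  rwa [← mul_add, sub_add_cancel] at h

/-- Vectors of a grid with bounded `p`-adic components have a common denominator. -/
theorem grid_exists_int (hpinj : Function.Injective p) {N : ℕ} {v z : Fin d → ℚ}
    (hv : ∀ j, IsZS (∏ i, p i) (N * v j)) (hz : ∀ j, IsZS (∏ i, p i) (z j - v j)) {M : ℕ}
    (hM : ∀ i j, ‖ratP p i z j‖ ≤ (p i : ℝ) ^ M) (j : Fin d) :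
    ∃ a : ℤ, ((N : ℚ) * ((∏ i, p i : ℕ) : ℚ) ^ M) * z j = a := by
  refine isZS_eq_intCast_of_norm_le_one (p := p) ?_ fun i => ?_
  · have h := (isZS_mul_of_grid hv hz j).mul (isZS_natCast (∏ i, p i) ((∏ i, p i) ^ M))
    rw [Nat.cast_pow] at h
    convert h using 1
    ring
  · have h1 : ‖((N : ℕ) : ℚ_[p i])‖ ≤ 1 := by
      exact_mod_cast Padic.norm_int_le_one (p := p i) (N : ℤ)
    have hpi : (0 : ℝ) < p i := by exact_mod_cast (hp i).out.pos
    have hc : (((N : ℚ) * ((∏ i, p i : ℕ) : ℚ) ^ M * z j : ℚ) : ℚ_[p i]) =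
        (N : ℚ_[p i]) * ((∏ i, p i : ℕ) : ℚ_[p i]) ^ M * ratP p i z j := by
      simp [ratP]
    rw [hc, norm_mul, norm_mul, norm_pow, padic_norm_prod_primes hpinj i]
    calc ‖(N : ℚ_[p i])‖ * ((p i : ℝ)⁻¹) ^ M * ‖ratP p i z j‖
        ≤ 1 * ((p i : ℝ)⁻¹) ^ M * (p i : ℝ) ^ M := by
          gcongr
          exact hM i j
      _ = 1 := by
          rw [one_mul, ← mul_pow, inv_mul_cancel₀ hpi.ne', one_pow]

theorem padic_exists_pow_bound {SP : ∀ i, Set (Fin d → ℚ_[p i])}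
    (hM : ∀ i, ∃ M : ℝ, ∀ x ∈ SP i, ∀ j, ‖x j‖ ≤ M) :
    ∃ M : ℕ, ∀ i, ∀ x ∈ SP i, ∀ j, ‖x j‖ ≤ (p i : ℝ) ^ M := by
  choose M hM using hM
  have h : ∀ i, ∃ k : ℕ, M i ≤ (p i : ℝ) ^ k := fun i => by
    obtain ⟨k, hk⟩ := pow_unbounded_of_one_lt (M i)
      (show (1 : ℝ) < p i by exact_mod_cast (hp i).out.one_lt)
    exact ⟨k, hk.le⟩
  choose k hk using h
  refine ⟨∑ i, k i, fun i x hx j => (hM i x hx j).trans ((hk i).trans ?_)⟩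
  exact pow_le_pow_right₀ (by exact_mod_cast (hp i).out.one_le)
    (Finset.single_le_sum (f := k) (fun _ _ => Nat.zero_le _) (Finset.mem_univ i))

/-- The local conditions on a primitive representative of a pair of parallel vectors. -/
def ratioRegion (SP : ∀ i, Set (Fin d → ℚ_[p i])) (N : ℕ) (c : ℚ) (i : Fin s) :
    Set (Fin d → ℚ_[p i]) :=
  {x | ((c.den : ℚ_[p i]) / N) • x ∈ SP i ∩ {x | (c : ℚ_[p i]) • x ∈ SP i}}

theorem ratioCount_grid_le {N : ℕ} (hN : 0 < N)
    {v : Fin d → ℚ} (hv : ∀ j, IsZS (∏ i, p i) (N * v j))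
    {SR : Set (Fin d → ℝ)} {SP : ∀ i, Set (Fin d → ℚ_[p i])} {X : ℝ} {Z : Finset (Fin d → ℚ)}
    (hZ : ∀ z ∈ Z, z ∈ gridPoints p v SR SP X) (c : ℚ)
    (hfin : (gridPoints p 0 SR (ratioRegion SP N c) (X * (N / c.den))).Finite) :
    ratioCount Z c ≤ (gridPoints p 0 SR (ratioRegion SP N c) (X * (N / c.den))).ncard := by
  have hP := padic_prod_pos p
  have hNQ : (N : ℚ) ≠ 0 := by exact_mod_cast hN.ne'
  have hb : (c.den : ℚ) ≠ 0 := by exact_mod_cast c.den_nz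
  have hNR : (N : ℝ) ≠ 0 := by exact_mod_cast hN.ne'
  have hbR : (c.den : ℝ) ≠ 0 := by exact_mod_cast c.den_nz
  rw [ratioCount, ← Set.ncard_coe_finset]
  refine Set.ncard_le_ncard_of_injOn (fun z => ((N : ℚ) / c.den) • z) (fun z hz => ?_)
    (fun a _ b _ hab => smul_right_injective _ (div_ne_zero hNQ hb) hab) hfin
  rw [Finset.mem_coe, Finset.mem_filter] at hz
  obtain ⟨h1, h2, h3⟩ := hZ z hz.1
  obtain ⟨k1, -, k3⟩ := hZ _ hz.2
  refine ⟨fun j => ?_, ?_, fun i => ?_⟩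
  · have e1 := isZS_mul_of_grid hv h1 j
    have e2 := isZS_mul_of_grid hv k1 j
    rw [Pi.smul_apply, smul_eq_mul, mul_left_comm] at e2
    have e3 := e1.div_den hP e2
    simpa [mul_div_right_comm] using e3
  · convert h2 using 2 with j
    rw [Pi.smul_apply, smul_eq_mul]
    push_cast
    field_simp
  · have hNp : (N : ℚ_[p i]) ≠ 0 := by exact_mod_cast hN.ne'
    have hbp : (c.den : ℚ_[p i]) ≠ 0 := by exact_mod_cast c.den_nz
    have e1 : ((c.den : ℚ_[p i]) / N) • ratP p i (((N : ℚ) / c.den) • z) = ratP p i z := by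
      funext j
      simp only [ratP, Pi.smul_apply, smul_eq_mul]
      push_cast
      field_simp
    rw [ratioRegion, Set.mem_ofPred_eq, e1]
    refine ⟨h3 i, ?_⟩
    have e2 : (c : ℚ_[p i]) • ratP p i z = ratP p i (c • z) := funext fun j => by simp [ratP]
    rw [Set.mem_ofPred_eq, e2]
    exact k3 i

theorem ratioRegion_bounded {SP : ∀ i, Set (Fin d → ℚ_[p i])} {N : ℕ} (hN : 0 < N) (c : ℚ)
    (hM : ∀ i, ∃ M : ℝ, ∀ x ∈ SP i, ∀ j, ‖x j‖ ≤ M) (i : Fin s) :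
    ∃ M : ℝ, ∀ x ∈ ratioRegion SP N c i, ∀ j, ‖x j‖ ≤ M := by
  obtain ⟨M, hM⟩ := hM i
  have hNp : (N : ℚ_[p i]) ≠ 0 := by exact_mod_cast hN.ne'
  have hbp : (c.den : ℚ_[p i]) ≠ 0 := by exact_mod_cast c.den_nz
  have ht : 0 < ‖(c.den : ℚ_[p i]) / N‖ := norm_pos_iff.mpr (div_ne_zero hbp hNp)
  refine ⟨M / ‖(c.den : ℚ_[p i]) / N‖, fun x hx j => ?_⟩
  have h := hM _ hx.1 j
  rw [Pi.smul_apply, smul_eq_mul, norm_mul] at h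
  rw [le_div_iff₀ ht]
  linarith

theorem ratioRegion_translation {SP : ∀ i, Set (Fin d → ℚ_[p i])} (N : ℕ) (c : ℚ)
    (hk : ∀ i, ∃ k : ℕ, ∀ x ∈ SP i, ∀ y ∈ padicBall (p i) d k, x + y ∈ SP i) (i : Fin s) :
    ∃ k : ℕ, ∀ x ∈ ratioRegion SP N c i, ∀ y ∈ padicBall (p i) d k,
      x + y ∈ ratioRegion SP N c i :=
  padic_translation_smul (padic_translation_inter (hk i) (padic_translation_smul (hk i) _)) _

variable [∀ i, MeasurableSpace ℚ_[p i]] [∀ i, BorelSpace ℚ_[p i]]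

theorem ratioRegion_measure_le (μd : ∀ i, Measure (Fin d → ℚ_[p i]))
    [∀ i, (μd i).IsAddHaarMeasure] (hμd : ∀ i, μd i {y | ∀ j, ‖y j‖ ≤ 1} = 1)
    {SP : ∀ i, Set (Fin d → ℚ_[p i])} (hnice : ∀ i, PadicNice (μd i) (SP i))
    {N : ℕ} (hN : 0 < N) (hNS : Nat.Coprime N (∏ i, p i)) (c : ℚ) (i : Fin s) :
    (μd i (ratioRegion SP N c i)).toReal ≤
      (‖(c.den : ℚ_[p i])‖ ^ d)⁻¹ * (‖(c.den : ℚ_[p i])‖ * (μd i (SP i)).toReal) := by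
  have hNp : (N : ℚ_[p i]) ≠ 0 := by exact_mod_cast hN.ne'
  have hbp : (c.den : ℚ_[p i]) ≠ 0 := by exact_mod_cast c.den_nz
  have hN1 : ‖(N : ℚ_[p i])‖ = 1 := by
    refine padic_norm_natCast_eq_one fun h => ?_
    have h1 : p i ∣ ∏ i, p i := Finset.dvd_prod_of_mem p (Finset.mem_univ i)
    exact (hp i).out.one_lt.ne' (Nat.eq_one_of_dvd_coprimes hNS h h1)
  have hmeas : MeasurableSet (SP i ∩ {x | (c : ℚ_[p i]) • x ∈ SP i}) :=
    (padic_isOpen_of_translation (padic_translation_inter (hnice i).translation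
      (padic_translation_smul (hnice i).translation _))).measurableSet
  obtain ⟨M, hM⟩ := (hnice i).bounded
  rw [ratioRegion, padic_measure_smul_preimage (μd i) (hμd i) hmeas (div_ne_zero hbp hNp),
    norm_div, hN1, div_one]
  refine mul_le_mul_of_nonneg_left ?_ (by positivity)
  by_cases hdvd : p i ∣ c.den
  · have hnum : ‖(c.num : ℚ_[p i])‖ = 1 := by
      refine le_antisymm (Padic.norm_int_le_one _) (not_lt.mp fun h => ?_)
      rw [Padic.norm_intCast_lt_one_iff] at h
      have h1 : p i ∣ c.num.natAbs := Int.natCast_dvd.mp h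
      exact (hp i).out.one_lt.ne' (Nat.eq_one_of_dvd_coprimes c.reduced h1 hdvd)
    have hc : ‖(c : ℚ_[p i])‖ = ‖(c.den : ℚ_[p i])‖⁻¹ := by
      rw [Rat.cast_def, norm_div, hnum, one_div]
    have hlt : ‖(c.den : ℚ_[p i])‖ < 1 := by
      have := (Padic.norm_intCast_lt_one_iff (p := p i) (k := (c.den : ℤ))).mpr
        (by exact_mod_cast hdvd)
      exact_mod_cast this
    have h2 := (hnice i).shrink (c : ℚ_[p i]) (by
      rw [hc]
      exact (one_lt_inv₀ (norm_pos_iff.mpr hbp)).mpr hlt)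
    rwa [hc, inv_inv] at h2
  · rw [padic_norm_natCast_eq_one hdvd, one_mul]
    exact ENNReal.toReal_mono (padic_measure_lt_top (μd i) hM).ne
      (measure_mono Set.inter_subset_left)

/-- The constant in the asymptotic bound for the number of parallel pairs. -/
noncomputable def parConst (p : Fin s → ℕ) (d N : ℕ) : ℝ :=
  (N : ℝ) ^ d * ∑' c : ℚ, √(parWeight p d c.den) * √(parWeight p d c⁻¹.den)

theorem parConst_nonneg (p : Fin s → ℕ) (d N : ℕ) : 0 ≤ parConst p d N :=
  mul_nonneg (by positivity) (tsum_nonneg fun _ => by positivity)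

/-- Grids contain few pairs of parallel vectors. -/
theorem eventually_parCount_le (hpinj : Function.Injective p) (hd : 3 ≤ d)
    {N : ℕ} (hN : 0 < N) (hNS : Nat.Coprime N (∏ i, p i))
    {v : Fin d → ℚ} (hv : ∀ j, IsZS (∏ i, p i) (N * v j))
    (μd : ∀ i, Measure (Fin d → ℚ_[p i])) [∀ i, (μd i).IsAddHaarMeasure]
    (hμd : ∀ i, μd i {y | ∀ j, ‖y j‖ ≤ 1} = 1)
    {SR : Set (Fin d → ℝ)} (hb : Bornology.IsBounded SR) (hfr : volume (frontier SR) = 0)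
    {SP : ∀ i, Set (Fin d → ℚ_[p i])} (hnice : ∀ i, PadicNice (μd i) (SP i))
    {Z : ℝ → Finset (Fin d → ℚ)}
    (hZ : ∀ X, 0 < X → ∀ z ∈ Z X, z ∈ gridPoints p v SR SP X ∧ z ≠ 0) {ε : ℝ} (hε : 0 < ε) :
    ∀ᶠ X : ℝ in atTop, (parCount (Z X) : ℝ) / X ^ d ≤
      parConst p d N * ((volume SR).toReal * ∏ i, (μd i (SP i)).toReal) + ε := by
  set V := (volume SR).toReal * ∏ i, (μd i (SP i)).toReal with hV
  have hV0 : 0 ≤ V := mul_nonneg ENNReal.toReal_nonneg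
    (Finset.prod_nonneg fun _ _ => ENNReal.toReal_nonneg)
  have hNR : (0 : ℝ) < N := by exact_mod_cast hN
  have hden : ∀ c : ℚ, (0 : ℝ) < c.den := fun c => by exact_mod_cast c.den_pos
  obtain ⟨M, hM⟩ := padic_exists_pow_bound fun i => (hnice i).bounded
  obtain ⟨R, hR⟩ := hb.exists_norm_le
  set Q : ℚ := (N : ℚ) * ((∏ i, p i : ℕ) : ℚ) ^ M with hQdef
  have hQ0 : 0 < Q := by
    have := padic_prod_pos p
    positivity
  have hQR : (0 : ℝ) < Q := by exact_mod_cast hQ0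
  let h : ℚ → ℝ → ℝ := fun c X =>
    ((gridPoints p 0 SR (ratioRegion SP N c) (X * (N / c.den))).ncard : ℝ) / X ^ d
  let L : ℚ → ℝ := fun c => ((N : ℝ) / c.den) ^ d *
    ((volume SR).toReal * ∏ i, (μd i (ratioRegion SP N c i)).toReal)
  let D : ℚ → ℝ := fun c => (3 * ((Q : ℝ) * |R|)) ^ d * ratioWeight c
  have hh0 : ∀ c X, 0 < X → 0 ≤ h c X := fun c X hX => by positivity
  have hL0 : ∀ c, 0 ≤ L c := fun c => mul_nonneg (by positivity)
    (mul_nonneg ENNReal.toReal_nonneg (Finset.prod_nonneg fun _ _ => ENNReal.toReal_nonneg))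
  have hD0 : ∀ c, 0 ≤ D c := fun c => mul_nonneg (by positivity) (ratioWeight_nonneg c)
  have hDs : Summable D := summable_ratioWeight.mul_left _
  have hlim : ∀ c, Tendsto (h c) atTop (𝓝 (L c)) := by
    intro c
    have e1 := tendsto_grid_count hpinj 0 hb hfr μd hμd
      (ratioRegion_bounded hN c fun i => (hnice i).bounded)
      (ratioRegion_translation N c fun i => (hnice i).translation)
    have hpos : (0 : ℝ) < N / c.den := div_pos hNR (hden c)
    have e2 := (e1.comp (tendsto_id.atTop_mul_const hpos)).const_mul (((N : ℝ) / c.den) ^ d)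
    refine e2.congr' ?_
    filter_upwards [eventually_gt_atTop 0] with X hX
    simp only [Function.comp, id, h]
    rw [mul_pow]
    field_simp
  have hLle : ∀ c, L c ≤ (N : ℝ) ^ d * V * parWeight p d c.den := by
    intro c
    have hprod : ∏ i, (μd i (ratioRegion SP N c i)).toReal ≤
        ∏ i, ((‖(c.den : ℚ_[p i])‖ ^ d)⁻¹ * (‖(c.den : ℚ_[p i])‖ * (μd i (SP i)).toReal)) :=
      Finset.prod_le_prod (fun _ _ => ENNReal.toReal_nonneg) fun i _ =>
        ratioRegion_measure_le μd hμd hnice hN hNS c i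
    rw [Finset.prod_mul_distrib, Finset.prod_mul_distrib, Finset.prod_inv_distrib,
      Finset.prod_pow, prod_padic_norm_natCast c.den_nz] at hprod
    have hsp : (0 : ℝ) < sPart p c.den := by exact_mod_cast sPart_pos c.den
    have hdiv : ((c.den / sPart p c.den : ℕ) : ℝ) = (c.den : ℝ) / sPart p c.den :=
      Nat.cast_div (sPart_dvd hpinj _) hsp.ne'
    calc L c ≤ ((N : ℝ) / c.den) ^ d * ((volume SR).toReal *
          (((((sPart p c.den : ℕ) : ℝ)⁻¹ ^ d)⁻¹ * (((sPart p c.den : ℕ) : ℝ)⁻¹ *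
            ∏ i, (μd i (SP i)).toReal)))) := by
          exact mul_le_mul_of_nonneg_left
            (mul_le_mul_of_nonneg_left hprod ENNReal.toReal_nonneg) (by positivity)
      _ = _ := by
          have := hden c
          rw [parWeight, hdiv, hV, inv_pow, inv_inv, div_pow, div_pow, inv_div]
          field_simp
  let F : ℝ → ℚ → ℝ := fun X c => min (√(h c X * h c⁻¹ X)) (D c)
  have hF0 : ∀ X, 0 < X → ∀ c, 0 ≤ F X c := fun X _ c => le_min (Real.sqrt_nonneg _) (hD0 c)
  have hFlim : Tendsto (fun X => ∑' c, F X c) atTop (𝓝 (∑' c, min (√(L c * L c⁻¹)) (D c))) := by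
    refine tendsto_tsum_of_dominated_convergence hDs (fun c => ?_) ?_
    · exact (((hlim c).mul (hlim c⁻¹)).sqrt).min tendsto_const_nhds
    · filter_upwards [eventually_gt_atTop 0] with X hX c
      rw [Real.norm_of_nonneg (hF0 X hX c)]
      exact min_le_right _ _
  have hsw : Summable fun c : ℚ => √(parWeight p d c.den) * √(parWeight p d c⁻¹.den) :=
    summable_den_mul_den_inv (f := fun b => √(parWeight p d b)) (fun _ => Real.sqrt_nonneg _)
      (summable_sqrt_parWeight hpinj hd)
  have hlimle : ∑' c, min (√(L c * L c⁻¹)) (D c) ≤ parConst p d N * V := by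
    have e1 : ∀ c, min (√(L c * L c⁻¹)) (D c) ≤ (N : ℝ) ^ d * V *
        (√(parWeight p d c.den) * √(parWeight p d c⁻¹.den)) := by
      intro c
      refine (min_le_left _ _).trans ?_
      have w1 := parWeight_nonneg p d c.den
      have w2 := parWeight_nonneg p d c⁻¹.den
      calc √(L c * L c⁻¹) ≤ √(((N : ℝ) ^ d * V * parWeight p d c.den) *
            ((N : ℝ) ^ d * V * parWeight p d c⁻¹.den)) := by
            refine Real.sqrt_le_sqrt (mul_le_mul (hLle c) (hLle c⁻¹) (hL0 _) ?_)
            positivity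
        _ = √(((N : ℝ) ^ d * V) ^ 2 * (parWeight p d c.den * parWeight p d c⁻¹.den)) := by
            congr 1; ring
        _ = _ := by
            rw [Real.sqrt_mul (by positivity), Real.sqrt_sq (by positivity), Real.sqrt_mul w1]
    have e2 : Summable fun c => min (√(L c * L c⁻¹)) (D c) :=
      Summable.of_nonneg_of_le (fun c => le_min (Real.sqrt_nonneg _) (hD0 c))
        (fun c => min_le_right _ _) hDs
    refine (e2.tsum_le_tsum e1 (hsw.mul_left _)).trans (le_of_eq ?_)
    rw [tsum_mul_left, parConst]
    ring
  have hev := hFlim.eventually (eventually_le_nhds (show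
    ∑' c, min (√(L c * L c⁻¹)) (D c) < parConst p d N * V + ε by linarith))
  filter_upwards [hev, eventually_gt_atTop 0] with X hX hX0
  refine le_trans ?_ hX
  have hXd : 0 < X ^ d := pow_pos hX0 d
  have hratio : ∀ c, (ratioCount (Z X) c : ℝ) ≤ X ^ d * F X c := by
    intro c
    have hQint : ∀ z ∈ Z X, ∀ j, ∃ a : ℤ, Q * z j = a := fun z hz j => by
      obtain ⟨h1, -, h3⟩ := (hZ X hX0 z hz).1
      exact grid_exists_int hpinj hv h1 (fun i j => hM i _ (h3 i) j) j
    have hQle : ∀ z ∈ Z X, ∀ j, |((Q * z j : ℚ) : ℝ)| ≤ Q * |R| * X := fun z hz j => by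
      obtain ⟨-, h2, -⟩ := (hZ X hX0 z hz).1
      have e1 := (norm_le_pi_norm _ j).trans ((hR _ h2).trans (le_abs_self R))
      rw [Real.norm_eq_abs, abs_div, abs_of_pos hX0, div_le_iff₀ hX0] at e1
      push_cast
      rw [abs_mul, abs_of_pos hQR, mul_assoc]
      exact mul_le_mul_of_nonneg_left e1 hQR.le
    rw [mul_min_of_nonneg _ _ hXd.le]
    refine le_min ?_ ?_
    · by_cases hc : c = 0
      · rw [hc, ratioCount_zero fun z hz => (hZ X hX0 z hz).2, Nat.cast_zero]
        positivity
      have key : ∀ e : ℚ, (ratioCount (Z X) e : ℝ) ≤ X ^ d * h e X := by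
        intro e
        have hpos : 0 < X * ((N : ℝ) / e.den) := mul_pos hX0 (div_pos hNR (hden e))
        have := ratioCount_grid_le hN hv (fun z hz => (hZ X hX0 z hz).1) e
          (finite_gridPoints hpinj 0 hb (ratioRegion_bounded hN e fun i => (hnice i).bounded)
            (ratioRegion_translation N e fun i => (hnice i).translation) hpos)
        simp only [h]
        rw [mul_div_cancel₀ _ hXd.ne']
        exact_mod_cast this
      have k1 := key c
      have k2 := key c⁻¹
      rw [ratioCount_inv _ hc] at k2
      have : (ratioCount (Z X) c : ℝ) ^ 2 ≤ (X ^ d * √(h c X * h c⁻¹ X)) ^ 2 := by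
        rw [mul_pow, Real.sq_sqrt (mul_nonneg (hh0 c X hX0) (hh0 c⁻¹ X hX0)), sq, sq]
        calc (ratioCount (Z X) c : ℝ) * ratioCount (Z X) c
            ≤ (X ^ d * h c X) * (X ^ d * h c⁻¹ X) :=
              mul_le_mul k1 k2 (Nat.cast_nonneg _) (mul_nonneg hXd.le (hh0 c X hX0))
          _ = _ := by ring
      exact (abs_le_of_sq_le_sq' this (by positivity)).2
    · refine (ratioCount_le hd (fun z hz => (hZ X hX0 z hz).2) hQ0.ne' hQint hQle
        (by positivity) c).trans (le_of_eq ?_)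
      simp only [D]
      rw [← mul_assoc 3, mul_pow _ X]
      ring
  obtain ⟨G, hG⟩ := parCount_le_sum fun z hz => (hZ X hX0 z hz).2
  have hFs : Summable (F X) :=
    Summable.of_nonneg_of_le (hF0 X hX0) (fun c => min_le_right _ _) hDs
  rw [div_le_iff₀' hXd]
  calc (parCount (Z X) : ℝ) ≤ ∑ c ∈ G, (ratioCount (Z X) c : ℝ) := by exact_mod_cast hG
    _ ≤ ∑ c ∈ G, X ^ d * F X c := Finset.sum_le_sum fun c _ => hratio c
    _ = X ^ d * ∑ c ∈ G, F X c := by rw [Finset.mul_sum]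
    _ ≤ _ := by
        gcongr
        exact hFs.sum_le_tsum _ fun c _ => hF0 X hX0 c

end GridParallel

section HeckeGrid

variable {s d : ℕ} {p : Fin s → ℕ} [hp : ∀ i, Fact (p i).Prime]

theorem ratR_mulVec (C : Matrix (Fin d) (Fin d) ℤ) (w : Fin d → ℚ) :
    ratR (C.map (Int.cast : ℤ → ℚ) *ᵥ w) = C.map (Int.cast : ℤ → ℝ) *ᵥ ratR w := by
  funext j
  simp [mulVec, dotProduct, ratR]

theorem ratP_mulVec (C : Matrix (Fin d) (Fin d) ℤ) (w : Fin d → ℚ) (i : Fin s) :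
    ratP p i (C.map (Int.cast : ℤ → ℚ) *ᵥ w) = C.map (Int.cast : ℤ → ℚ_[p i]) *ᵥ ratP p i w := by
  funext j
  simp [mulVec, dotProduct, ratP]

theorem IsZS.mulVec {P : ℕ} (hP : 0 < P) (E : Matrix (Fin d) (Fin d) ℤ) {w : Fin d → ℚ}
    (hw : ∀ j, IsZS P (w j)) (j : Fin d) : IsZS P ((E.map (Int.cast : ℤ → ℚ) *ᵥ w) j) := by
  change IsZS P (∑ k, (E j k : ℚ) * w k)
  exact IsZS.sum hP _ fun k _ => (isZS_intCast P _).mul (hw k)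

theorem mulVec_one_add_smul {N : ℕ} {C E : Matrix (Fin d) (Fin d) ℤ}
    (hC : C = 1 + (N : ℤ) • E) (w : Fin d → ℚ) :
    C.map (Int.cast : ℤ → ℚ) *ᵥ w = w + E.map (Int.cast : ℤ → ℚ) *ᵥ (fun j => N * w j) := by
  have h1 : C.map (Int.cast : ℤ → ℚ) = 1 + (N : ℚ) • E.map (Int.cast : ℤ → ℚ) := by
    subst hC
    ext i j
    simp only [map_apply, Matrix.add_apply, Matrix.smul_apply, smul_eq_mul, one_apply]
    push_cast
    rfl
  have h2 : (fun j => (N : ℚ) * w j) = (N : ℚ) • w := rfl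
  rw [h1, add_mulVec, one_mulVec, smul_mulVec, h2, mulVec_smul]

theorem isZS_exists_common_den {P : ℕ} (hP : 0 < P) {w : Fin d → ℚ} (hw : ∀ j, IsZS P (w j)) :
    ∃ (k : ℕ) (x : Fin d → ℤ), ∀ j, (P : ℚ) ^ k * w j = x j := by
  choose a k hk using hw
  have hP' : (P : ℚ) ≠ 0 := by exact_mod_cast hP.ne'
  refine ⟨∑ j, k j, fun j => a j * P ^ (∑ j, k j - k j), fun j => ?_⟩
  have hle : k j ≤ ∑ j, k j :=
    Finset.single_le_sum (f := k) (fun _ _ => Nat.zero_le _) (Finset.mem_univ j)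
  obtain ⟨e, he⟩ := Nat.exists_eq_add_of_le hle
  simp only [he, Nat.add_sub_cancel_left]
  rw [hk j, pow_add]
  push_cast
  field_simp

theorem grid_mulVec_mem {N : ℕ} {C E : Matrix (Fin d) (Fin d) ℤ} (hC : C = 1 + (N : ℤ) • E)
    {v w : Fin d → ℚ} (hv : ∀ j, IsZS (∏ i, p i) (N * v j))
    (hw : ∀ j, IsZS (∏ i, p i) (w j - v j)) (j : Fin d) :
    IsZS (∏ i, p i) ((C.map (Int.cast : ℤ → ℚ) *ᵥ w) j - v j) := by
  rw [mulVec_one_add_smul hC, Pi.add_apply, add_sub_right_comm]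
  exact (hw j).add (padic_prod_pos p) (IsZS.mulVec (padic_prod_pos p) E (isZS_mul_of_grid hv hw) j)

/-- The image of a grid under an integral matrix congruent to the identity is cut out by a
congruence. -/
theorem exists_grid_preimage_iff {N M l : ℕ} [Fact l.Prime] (hN : 0 < N)
    (hlP : Nat.Coprime (∏ i, p i) l) {C E : Matrix (Fin d) (Fin d) ℤ}
    (hC : C = 1 + (N : ℤ) • E) {ξ : Fin d → ZMod l}
    (hξ : ∀ y : Fin d → ℤ, (∃ x, y = C *ᵥ x) ↔ ξ ⬝ᵥ redMod l y = 0)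
    {v z : Fin d → ℚ} (hv : ∀ j, IsZS (∏ i, p i) (N * v j))
    (hz : ∀ j, IsZS (∏ i, p i) (z j - v j)) {y : Fin d → ℤ}
    (hy : ∀ j, ((N : ℚ) * ((∏ i, p i : ℕ) : ℚ) ^ M) * z j = y j) :
    (∃ w : Fin d → ℚ, (∀ j, IsZS (∏ i, p i) (w j - v j)) ∧ C.map (Int.cast : ℤ → ℚ) *ᵥ w = z) ↔
      ξ ⬝ᵥ redMod l y = 0 := by
  have hP := padic_prod_pos p
  set P := ∏ i, p i with hPdef
  have hNQ : (N : ℚ) ≠ 0 := by exact_mod_cast hN.ne'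
  have hPQ : (P : ℚ) ≠ 0 := by exact_mod_cast hP.ne'
  have hcast : ∀ x : Fin d → ℤ, (fun j => ((C *ᵥ x) j : ℚ)) =
      C.map (Int.cast : ℤ → ℚ) *ᵥ fun j => (x j : ℚ) := by
    intro x
    funext j
    simp [mulVec, dotProduct]
  constructor
  · rintro ⟨w, hw, hwz⟩
    obtain ⟨k, x, hx⟩ := isZS_exists_common_den hP (isZS_mul_of_grid hv hw)
    have h1 : (fun j => (P : ℤ) ^ k * y j) = C *ᵥ fun j => (P : ℤ) ^ M * x j := by
      funext j
      have h2 := congrFun (hcast fun j => (P : ℤ) ^ M * x j) j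
      have h3 : (fun j => (((P : ℤ) ^ M * x j : ℤ) : ℚ)) =
          ((P : ℚ) ^ k * N * (P : ℚ) ^ M) • w := by
        funext j
        rw [Pi.smul_apply, smul_eq_mul]
        push_cast
        rw [← hx j]
        ring
      simp only [h3, mulVec_smul, hwz, Pi.smul_apply, smul_eq_mul] at h2
      have h4 : (((P : ℤ) ^ k * y j : ℤ) : ℚ) = ((C *ᵥ fun j => (P : ℤ) ^ M * x j) j : ℤ) := by
        rw [h2]
        push_cast
        rw [← hy j]
        ring
      exact_mod_cast h4
    have h2 := (hξ _).mp ⟨_, h1⟩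
    have h3 : redMod l (fun j => (P : ℤ) ^ k * y j) = ((P : ZMod l) ^ k) • redMod l y := by
      funext j
      simp [redMod]
    rw [h3, dotProduct_smul, smul_eq_mul] at h2
    refine (mul_eq_zero.mp h2).resolve_left (pow_ne_zero _ fun h => ?_)
    rw [ZMod.natCast_eq_zero_iff] at h
    exact (Fact.out : l.Prime).one_lt.ne' (Nat.eq_one_of_dvd_coprimes hlP h dvd_rfl)
  · intro h
    obtain ⟨x, hx⟩ := (hξ y).mpr h
    set Q : ℚ := (N : ℚ) * (P : ℚ) ^ M with hQ
    have hQ0 : Q ≠ 0 := mul_ne_zero hNQ (pow_ne_zero _ hPQ)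
    have hwz : C.map (Int.cast : ℤ → ℚ) *ᵥ (Q⁻¹ • fun j => (x j : ℚ)) = z := by
      rw [mulVec_smul, ← hcast, ← hx]
      funext j
      rw [Pi.smul_apply, smul_eq_mul, ← hy j, inv_mul_cancel_left₀ hQ0]
    refine ⟨_, fun j => ?_, hwz⟩
    have h1 := congrFun hwz j
    rw [mulVec_one_add_smul hC, Pi.add_apply] at h1
    have h2 : (Q⁻¹ • fun j => (x j : ℚ)) j - v j = (z j - v j) -
        (E.map (Int.cast : ℤ → ℚ) *ᵥ fun j => N * (Q⁻¹ • fun j => (x j : ℚ)) j) j := by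
      linarith
    rw [h2]
    refine (hz j).sub hP (IsZS.mulVec hP E (fun j => ?_) j)
    have h3 : (N : ℚ) * (Q⁻¹ • fun j => (x j : ℚ)) j = x j / (P : ℚ) ^ M := by
      rw [Pi.smul_apply, smul_eq_mul, hQ]
      field_simp
    rw [h3]
    exact (isZS_intCast P _).div_pow M

/-- The number of nonzero points of the grid `v + ℤ_S^d` mapped by `g` into a product set. -/
noncomputable def latticeCount (p : Fin s → ℕ) [∀ i, Fact (p i).Prime] (v : Fin d → ℚ)
    (BR : Set (Fin d → ℝ)) (BP : ∀ i, Set (Fin d → ℚ_[p i]))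
    (g : Matrix.SpecialLinearGroup (Fin d) ℝ × ∀ i, Matrix.SpecialLinearGroup (Fin d) ℚ_[p i]) :
    ℕ :=
  Set.ncard {w : Fin d → ℚ | (∀ j, IsZS (∏ i, p i) (w j - v j)) ∧ w ≠ 0 ∧
    (g.1 : Matrix (Fin d) (Fin d) ℝ) *ᵥ ratR w ∈ BR ∧
    ∀ i, (g.2 i : Matrix (Fin d) (Fin d) ℚ_[p i]) *ᵥ ratP p i w ∈ BP i}

/-- Counting in a Hecke translate amounts to counting points on a hyperplane modulo `l`. -/
theorem latticeCount_mul {N M l : ℕ} [Fact l.Prime] (hN : 0 < N)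
    (hlP : Nat.Coprime (∏ i, p i) l) {C E : Matrix (Fin d) (Fin d) ℤ}
    (hC : C = 1 + (N : ℤ) • E) (hCdet : C.det = l) {ξ : Fin d → ZMod l}
    (hξ : ∀ y : Fin d → ℤ, (∃ x, y = C *ᵥ x) ↔ ξ ⬝ᵥ redMod l y = 0)
    {v : Fin d → ℚ} (hv : ∀ j, IsZS (∏ i, p i) (N * v j))
    {BR : Set (Fin d → ℝ)} {BP : ∀ i, Set (Fin d → ℚ_[p i])}
    (hunit : ∀ i, ∀ u : ℚ_[p i], ‖u‖ = 1 → ∀ x ∈ BP i, u • x ∈ BP i)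
    (g σ : Matrix.SpecialLinearGroup (Fin d) ℝ × ∀ i, Matrix.SpecialLinearGroup (Fin d) ℚ_[p i])
    {X : ℝ} (hσR : (σ.1 : Matrix (Fin d) (Fin d) ℝ) = X⁻¹ • C.map (Int.cast : ℤ → ℝ))
    {u : ∀ i, ℚ_[p i]} (hu : ∀ i, ‖u i‖ = 1)
    (hσP : ∀ i, (σ.2 i : Matrix (Fin d) (Fin d) ℚ_[p i]) =
      (u i)⁻¹ • C.map (Int.cast : ℤ → ℚ_[p i]))
    {Z : Finset (Fin d → ℚ)}
    (hZ : ∀ z, z ∈ Z ↔ z ∈ gridPoints p v {x | (g.1 : Matrix (Fin d) (Fin d) ℝ) *ᵥ x ∈ BR}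
      (fun i => {x | (g.2 i : Matrix (Fin d) (Fin d) ℚ_[p i]) *ᵥ x ∈ BP i}) X ∧ z ≠ 0)
    {y : (Fin d → ℚ) → Fin d → ℤ}
    (hy : ∀ z ∈ Z, ∀ j, ((N : ℚ) * ((∏ i, p i : ℕ) : ℚ) ^ M) * z j = y z j) :
    latticeCount p v BR BP (g * σ) = (Z.filter fun z => ξ ⬝ᵥ redMod l (y z) = 0).card := by
  have hl0 : (l : ℚ) ≠ 0 := by exact_mod_cast (Fact.out : l.Prime).ne_zero
  have hdet : (C.map (Int.cast : ℤ → ℚ)).det ≠ 0 := by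
    have := (Int.castRingHom ℚ).map_det C
    rw [hCdet] at this
    rw [show C.map (Int.cast : ℤ → ℚ) = (Int.castRingHom ℚ).mapMatrix C from rfl, ← this]
    simpa using hl0
  have hinj : Function.Injective fun w : Fin d → ℚ => C.map (Int.cast : ℤ → ℚ) *ᵥ w :=
    mulVec_injective_of_isUnit ((isUnit_iff_isUnit_det _).mpr hdet.isUnit)
  have hR : ∀ w : Fin d → ℚ, ((g * σ).1 : Matrix (Fin d) (Fin d) ℝ) *ᵥ ratR w =
      (g.1 : Matrix (Fin d) (Fin d) ℝ) *ᵥ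
        fun j => ((C.map (Int.cast : ℤ → ℚ) *ᵥ w) j : ℝ) / X := by
    intro w
    have h1 : (fun j => ((C.map (Int.cast : ℤ → ℚ) *ᵥ w) j : ℝ) / X) =
        X⁻¹ • (C.map (Int.cast : ℤ → ℝ) *ᵥ ratR w) := by
      rw [← ratR_mulVec]
      funext j
      rw [Pi.smul_apply, smul_eq_mul, div_eq_inv_mul]
      rfl
    rw [h1, Prod.fst_mul, Matrix.SpecialLinearGroup.coe_mul, hσR, ← mulVec_mulVec, smul_mulVec]
  have hPp : ∀ (w : Fin d → ℚ) (i : Fin s),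
      ((g * σ).2 i : Matrix (Fin d) (Fin d) ℚ_[p i]) *ᵥ ratP p i w =
      (u i)⁻¹ • ((g.2 i : Matrix (Fin d) (Fin d) ℚ_[p i]) *ᵥ
        ratP p i (C.map (Int.cast : ℤ → ℚ) *ᵥ w)) := by
    intro w i
    rw [ratP_mulVec, Prod.snd_mul, Pi.mul_apply, Matrix.SpecialLinearGroup.coe_mul, hσP,
      ← mulVec_mulVec, smul_mulVec, mulVec_smul]
  have hPmem : ∀ (i : Fin s) (x : Fin d → ℚ_[p i]), (u i)⁻¹ • x ∈ BP i ↔ x ∈ BP i := by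
    intro i x
    have hu0 : u i ≠ 0 := norm_pos_iff.mp (by rw [hu i]; exact one_pos)
    refine ⟨fun h => ?_, hunit i _ (by rw [norm_inv, hu i, inv_one]) x⟩
    have := hunit i _ (hu i) _ h
    rwa [smul_inv_smul₀ hu0] at this
  rw [latticeCount, ← Set.ncard_coe_finset, ← Set.ncard_image_of_injective _ hinj]
  congr 1
  ext z
  simp only [Set.mem_image, Set.mem_ofPred_eq, Finset.coe_filter]
  constructor
  · rintro ⟨w, ⟨h1, h2, h3, h4⟩, rfl⟩
    have hzZ : C.map (Int.cast : ℤ → ℚ) *ᵥ w ∈ Z := by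
      rw [hZ]
      refine ⟨⟨grid_mulVec_mem hC hv h1, ?_, fun i => ?_⟩, ?_⟩
      · rw [Set.mem_ofPred_eq, ← hR]; exact h3
      · rw [Set.mem_ofPred_eq, ← hPmem, ← hPp]; exact h4 i
      · intro h
        exact h2 (hinj (by simpa using h))
    refine ⟨hzZ, ?_⟩
    rw [← exists_grid_preimage_iff hN hlP hC hξ hv ((hZ _).mp hzZ).1.1 (hy _ hzZ)]
    exact ⟨w, h1, rfl⟩
  · rintro ⟨hzZ, hξz⟩
    obtain ⟨⟨h1, h2, h3⟩, h0⟩ := (hZ z).mp hzZ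
    obtain ⟨w, hw, rfl⟩ := (exists_grid_preimage_iff hN hlP hC hξ hv h1 (hy z hzZ)).mpr hξz
    refine ⟨w, ⟨hw, ?_, ?_, fun i => ?_⟩, rfl⟩
    · rintro rfl
      exact h0 (mulVec_zero _)
    · rw [hR]; exact h2
    · rw [hPp, hPmem]; exact h3 i

end HeckeGrid

section HeckePoints

/-- Integers congruent to `1` modulo a high power of `q` are `d`-th powers of units. -/
theorem padic_exists_root {q d l : ℕ} [hq : Fact q.Prime] (hd : d ≠ 0)
    (hl : l ≡ 1 [MOD d ^ 2 * q]) : ∃ u : ℚ_[q], u ^ d = l ∧ ‖u‖ = 1 := by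
  have hqR : (1 : ℝ) < q := by exact_mod_cast hq.out.one_lt
  have hdvd : ((d ^ 2 * q : ℕ) : ℤ) ∣ 1 - l := by
    have := (Nat.modEq_iff_dvd.mp hl)
    exact_mod_cast this
  have hdn : 0 < ‖(d : ℤ_[q])‖ := norm_pos_iff.mpr (by exact_mod_cast hd)
  have hsmall : ‖(1 : ℤ_[q]) - l‖ < ‖(d : ℤ_[q])‖ ^ 2 := by
    obtain ⟨t, ht⟩ := hdvd
    have h1 : (1 : ℤ_[q]) - l = (d : ℤ_[q]) ^ 2 * q * t := by
      have : (((1 : ℤ) - l : ℤ) : ℤ_[q]) = (((d ^ 2 * q : ℕ) : ℤ) * t : ℤ) := by rw [ht]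
      push_cast at this
      exact this
    rw [h1, norm_mul, norm_mul, norm_pow, PadicInt.norm_p]
    calc ‖(d : ℤ_[q])‖ ^ 2 * (q : ℝ)⁻¹ * ‖(t : ℤ_[q])‖ ≤ ‖(d : ℤ_[q])‖ ^ 2 * (q : ℝ)⁻¹ * 1 := by
          gcongr
          exact PadicInt.norm_le_one _
      _ < ‖(d : ℤ_[q])‖ ^ 2 := by
          rw [mul_one]
          exact mul_lt_of_lt_one_right (by positivity) (inv_lt_one_of_one_lt₀ hqR)
  obtain ⟨z, hz, -⟩ := hensels_lemma (p := q) (R := ℤ_[q]) (a := 1)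
    (F := Polynomial.X ^ d - Polynomial.C (l : ℤ_[q])) (by
      simpa [Polynomial.derivative_X_pow] using hsmall)
  have hz' : z ^ d = l := by
    rw [map_sub, map_pow, Polynomial.aeval_X, Polynomial.aeval_C, sub_eq_zero] at hz
    simpa using hz
  refine ⟨z, by exact_mod_cast congrArg (Subtype.val) hz', ?_⟩
  have hl1 : ‖(l : ℚ_[q])‖ = 1 := by
    refine padic_norm_natCast_eq_one fun h => hq.out.one_lt.ne' ?_
    have h1 : l ≡ 1 [MOD q] := hl.of_dvd (Dvd.intro_left _ rfl)
    have h2 : (1 : ℕ) ≡ 0 [MOD q] := h1.symm.trans (Nat.modEq_zero_iff_dvd.mpr h)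
    exact Nat.dvd_one.mp (Nat.modEq_zero_iff_dvd.mp h2)
  have h2 : ‖(z : ℚ_[q])‖ ^ d = 1 := by
    have : ((z : ℚ_[q])) ^ d = l := by exact_mod_cast congrArg (Subtype.val) hz'
    rw [← norm_pow, this, hl1]
  exact (pow_eq_one_iff_of_nonneg (norm_nonneg _) hd).mp h2

variable {s d : ℕ} {p : Fin s → ℕ} [hp : ∀ i, Fact (p i).Prime]

/-- The group `SL_d(ℚ_S)`. -/
abbrev SLS (d : ℕ) {s : ℕ} (p : Fin s → ℕ) [∀ i, Fact (p i).Prime] : Type :=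
  Matrix.SpecialLinearGroup (Fin d) ℝ × ∀ i, Matrix.SpecialLinearGroup (Fin d) ℚ_[p i]

/-- `σ` is a normalization of an integral matrix of determinant `l`, congruent to the identity
modulo `N`, whose columns span the hyperplane orthogonal to `ξ` modulo `l`. -/
def IsHecke (N l : ℕ) (X : ℝ) (ξ : Fin d → ZMod l) (σ : SLS d p) : Prop :=
  ∃ (C E : Matrix (Fin d) (Fin d) ℤ) (u : ∀ i, ℚ_[p i]), C = 1 + (N : ℤ) • E ∧ C.det = l ∧
    (∀ y : Fin d → ℤ, (∃ x, y = C *ᵥ x) ↔ ξ ⬝ᵥ redMod l y = 0) ∧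
    (σ.1 : Matrix (Fin d) (Fin d) ℝ) = X⁻¹ • C.map (Int.cast : ℤ → ℝ) ∧ (∀ i, ‖u i‖ = 1) ∧
    ∀ i, (σ.2 i : Matrix (Fin d) (Fin d) ℚ_[p i]) = (u i)⁻¹ • C.map (Int.cast : ℤ → ℚ_[p i])

/-- Elements of `SL_d(ℚ_S)` with bounded entries. -/
def boundedSLS (p : Fin s → ℕ) [∀ i, Fact (p i).Prime] (K : ℝ) : Set (SLS d p) :=
  {σ | (∀ j k, |σ.1 j k| ≤ K) ∧ ∀ i j k, ‖σ.2 i j k‖ ≤ 1}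

theorem isCompact_bounded_SL {𝕜 : Type*} [NormedField 𝕜] [ProperSpace 𝕜] (K : ℝ) :
    IsCompact {σ : Matrix.SpecialLinearGroup (Fin d) 𝕜 | ∀ j k, ‖σ j k‖ ≤ K} := by
  have h1 : IsCompact (Set.univ.pi fun _ : Fin d => Set.univ.pi fun _ : Fin d =>
      Metric.closedBall (0 : 𝕜) K) :=
    isCompact_univ_pi fun _ => isCompact_univ_pi fun _ => isCompact_closedBall _ _
  have h2 := (Matrix.SpecialLinearGroup.isClosedEmbedding_val (n := Fin d)
    (R := 𝕜)).isCompact_preimage h1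
  have h3 : {σ : Matrix.SpecialLinearGroup (Fin d) 𝕜 | ∀ j k, ‖σ j k‖ ≤ K} =
      ((↑) : _ → Matrix (Fin d) (Fin d) 𝕜) ⁻¹' (Set.univ.pi fun _ : Fin d =>
        Set.univ.pi fun _ : Fin d => Metric.closedBall (0 : 𝕜) K) := by
    ext σ
    refine ⟨fun h j _ k _ => ?_, fun h j k => ?_⟩
    · simpa using h j k
    · exact mem_closedBall_zero_iff.mp (h j trivial k trivial)
  rw [h3]
  exact h2

theorem isCompact_boundedSLS (K : ℝ) : IsCompact (boundedSLS (d := d) p K) := by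
  have h := (isCompact_bounded_SL (d := d) (𝕜 := ℝ) K).prod
    (isCompact_univ_pi fun i => isCompact_bounded_SL (d := d) (𝕜 := ℚ_[p i]) 1)
  convert h using 1
  ext σ
  simp [boundedSLS]

theorem exists_hecke_family [NeZero d] (hd : 2 ≤ d) {N : ℕ} (hN : 0 < N) :
    ∃ K : ℝ, ∀ l : ℕ, ∀ _ : Fact l.Prime, l ≡ 1 [MOD N * (d ^ 2 * ∏ i, p i)] → ∀ X : ℝ, 8 ≤ X →
      X ^ d = l → ∃ Good : Finset (Fin d → ZMod l), l ^ d ≤ 2 * Good.card ∧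
        ∃ σ : (Fin d → ZMod l) → SLS d p, ∀ ξ ∈ Good, IsHecke N l X ξ (σ ξ) ∧
          σ ξ ∈ boundedSLS p K := by
  obtain ⟨K, hK, hfam⟩ := exists_reduced_hyperplane_bases d N hd hN
  refine ⟨K, fun l hl hlm X hX hXl => ?_⟩
  obtain ⟨Good, hGood, hbase⟩ := hfam l hl (hlm.of_dvd (Dvd.intro _ rfl)) X hX hXl
  refine ⟨Good, hGood, ?_⟩
  have hX0 : 0 < X := by linarith
  have hroot : ∀ i, ∃ u : ℚ_[p i], u ^ d = l ∧ ‖u‖ = 1 := fun i =>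
    padic_exists_root (by lia) (hlm.of_dvd ((mul_dvd_mul_left _
      (Finset.dvd_prod_of_mem p (Finset.mem_univ i))).trans (Dvd.intro_left _ rfl)))
  choose u hu hu1 using hroot
  have hu0 : ∀ i, u i ≠ 0 := fun i => norm_pos_iff.mp (by rw [hu1 i]; exact one_pos)
  have key : ∀ ξ, ∃ σ : SLS d p, ξ ∈ Good → IsHecke N l X ξ σ ∧ σ ∈ boundedSLS p K := by
    intro ξ
    by_cases hξ : ξ ∈ Good
    swap
    · exact ⟨1, fun h => absurd h hξ⟩
    obtain ⟨C, E, hdet, hC, hb, hy⟩ := hbase ξ hξ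
    have hdetR : (X⁻¹ • C.map (Int.cast : ℤ → ℝ)).det = 1 := by
      rw [det_smul, Fintype.card_fin, inv_pow, hXl,
        show C.map (Int.cast : ℤ → ℝ) = (Int.castRingHom ℝ).mapMatrix C from rfl,
        ← RingHom.map_det, hdet]
      have : (l : ℝ) ≠ 0 := by rw [← hXl]; positivity
      simp [this]
    have hdetP : ∀ i, ((u i)⁻¹ • C.map (Int.cast : ℤ → ℚ_[p i])).det = 1 := by
      intro i
      rw [det_smul, Fintype.card_fin, inv_pow, hu i,
        show C.map (Int.cast : ℤ → ℚ_[p i]) = (Int.castRingHom ℚ_[p i]).mapMatrix C from rfl,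
        ← RingHom.map_det, hdet]
      have : (l : ℚ_[p i]) ≠ 0 := by rw [← hu i]; exact pow_ne_zero _ (hu0 i)
      simp [this]
    refine ⟨⟨⟨_, hdetR⟩, fun i => ⟨_, hdetP i⟩⟩, fun _ =>
      ⟨⟨C, E, u, hC, hdet, hy, rfl, hu1, fun i => rfl⟩, fun j k => ?_, fun i j k => ?_⟩⟩
    · change |X⁻¹ * (C j k : ℝ)| ≤ K
      rw [abs_mul, abs_of_pos (inv_pos.mpr hX0), inv_mul_le_iff₀ hX0, mul_comm]
      exact hb j k
    · change ‖(u i)⁻¹ * (C j k : ℚ_[p i])‖ ≤ 1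
      rw [norm_mul, norm_inv, hu1 i, inv_one, one_mul]
      exact Padic.norm_int_le_one _
  choose σ hσ using key
  exact ⟨σ, hσ⟩

/-- The mean square deviation over a family of Hecke translates. -/
theorem hecke_average_le {N M l : ℕ} [Fact l.Prime] (hN : 0 < N)
    (hlP : Nat.Coprime (∏ i, p i) l) {X : ℝ} {Good : Finset (Fin d → ZMod l)}
    (hGood : l ^ d ≤ 2 * Good.card) {σ : (Fin d → ZMod l) → SLS d p}
    (hσ : ∀ ξ ∈ Good, IsHecke N l X ξ (σ ξ))
    {v : Fin d → ℚ} (hv : ∀ j, IsZS (∏ i, p i) (N * v j))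
    {BR : Set (Fin d → ℝ)} {BP : ∀ i, Set (Fin d → ℚ_[p i])}
    (hunit : ∀ i, ∀ u : ℚ_[p i], ‖u‖ = 1 → ∀ x ∈ BP i, u • x ∈ BP i) (g : SLS d p)
    {Z : Finset (Fin d → ℚ)}
    (hZ : ∀ z, z ∈ Z ↔ z ∈ gridPoints p v {x | (g.1 : Matrix (Fin d) (Fin d) ℝ) *ᵥ x ∈ BR}
      (fun i => {x | (g.2 i : Matrix (Fin d) (Fin d) ℚ_[p i]) *ᵥ x ∈ BP i}) X ∧ z ≠ 0)
    (hintegral : ∀ z ∈ Z, ∀ j, ∃ a : ℤ, ((N : ℚ) * ((∏ i, p i : ℕ) : ℚ) ^ M) * z j = a)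
    {H : ℝ} (hH : 2 * H ^ 2 < l) (hHl : H < l)
    (hZH : ∀ z ∈ Z, ∀ j, |((((N : ℚ) * ((∏ i, p i : ℕ) : ℚ) ^ M) * z j : ℚ) : ℝ)| ≤ H) (V : ℝ) :
    (Good.card : ℝ)⁻¹ * ∑ ξ ∈ Good, ((latticeCount p v BR BP (g * σ ξ) : ℝ) - V) ^ 2 ≤
      2 * (((Z.card : ℝ) / l - V) ^ 2 + parCount Z / l) := by
  classical
  set Q : ℚ := (N : ℚ) * ((∏ i, p i : ℕ) : ℚ) ^ M with hQ
  have hQ0 : Q ≠ 0 := by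
    have := padic_prod_pos p
    positivity
  have hl0 : (0 : ℝ) < l := by exact_mod_cast (Fact.out : l.Prime).pos
  choose! y hy using hintegral
  have hinj : Set.InjOn y (Z : Set (Fin d → ℚ)) := fun z hz w hw h => funext fun j =>
    mul_left_cancel₀ hQ0 (by rw [hy z hz j, hy w hw j, h])
  have hcount : ∀ ξ ∈ Good, latticeCount p v BR BP (g * σ ξ) =
      ((Z.image y).filter fun t => ξ ⬝ᵥ redMod l t = 0).card := by
    intro ξ hξ
    obtain ⟨C, E, u, hC, hdet, hyC, hR, hu, hP⟩ := hσ ξ hξ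
    rw [latticeCount_mul hN hlP hC hdet hyC hv hunit g (σ ξ) hR hu hP hZ hy, Finset.filter_image,
      Finset.card_image_of_injOn (hinj.mono fun z hz => (Finset.mem_filter.mp hz).1)]
  have hpar : (((Z.image y) ×ˢ (Z.image y)).filter fun q => IsParallel q.1 q.2).card ≤
      parCount Z := by
    rw [parCount]
    refine (Finset.card_le_card fun q hq => ?_).trans (Finset.card_image_le (f := Prod.map y y))
    simp only [Finset.mem_filter, Finset.mem_product, Finset.mem_image] at hq
    obtain ⟨⟨⟨z, hz, hz'⟩, w, hw, hw'⟩, hq⟩ := hq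
    rw [Finset.mem_image]
    refine ⟨(z, w), ?_, Prod.ext hz' hw'⟩
    rw [Finset.mem_filter, Finset.mem_product]
    refine ⟨⟨hz, hw⟩, fun i j => ?_⟩
    have h1 := hq i j
    rw [← hz', ← hw'] at h1
    have h2 : ((y z i : ℤ) : ℚ) * y w j = y z j * y w i := by exact_mod_cast h1
    rw [← hy z hz, ← hy z hz, ← hy w hw, ← hy w hw] at h2
    have h3 : (Q * Q) * (z i * w j) = (Q * Q) * (z j * w i) := by linarith
    exact mul_left_cancel₀ (mul_ne_zero hQ0 hQ0) h3
  have hsm := second_moment_mod (Z.image y) H hH hHl (by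
    intro t ht h0
    obtain ⟨z, hz, rfl⟩ := Finset.mem_image.mp ht
    refine ((hZ z).mp hz).2 (funext fun j => mul_left_cancel₀ hQ0 ?_)
    rw [hy z hz j, h0]
    simp) (by
    intro t ht j
    obtain ⟨z, hz, rfl⟩ := Finset.mem_image.mp ht
    have := hZH z hz j
    rw [hy z hz j] at this
    exact_mod_cast this) V
  rw [Finset.card_image_of_injOn hinj] at hsm
  have hGpos : (0 : ℝ) < Good.card := by
    have : 0 < l ^ d := pow_pos (Fact.out : l.Prime).pos _
    exact_mod_cast (by lia : 0 < Good.card)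
  have hGle : (l : ℝ) ^ d ≤ 2 * Good.card := by exact_mod_cast hGood
  have hA0 : 0 ≤ ((Z.card : ℝ) / l - V) ^ 2 + parCount Z / l := by positivity
  rw [inv_mul_le_iff₀ hGpos]
  calc ∑ ξ ∈ Good, ((latticeCount p v BR BP (g * σ ξ) : ℝ) - V) ^ 2
      = ∑ ξ ∈ Good, ((((Z.image y).filter fun t => ξ ⬝ᵥ redMod l t = 0).card : ℝ) - V) ^ 2 :=
        Finset.sum_congr rfl fun ξ hξ => by rw [hcount ξ hξ]
    _ ≤ ∑ ξ : Fin d → ZMod l,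
          ((((Z.image y).filter fun t => ξ ⬝ᵥ redMod l t = 0).card : ℝ) - V) ^ 2 :=
        Finset.sum_le_sum_of_subset_of_nonneg (Finset.subset_univ _) fun _ _ _ => sq_nonneg _
    _ ≤ (l : ℝ) ^ d * (((Z.card : ℝ) / l - V) ^ 2 + parCount Z / l) := by
        refine hsm.trans ?_
        gcongr
    _ ≤ (2 * Good.card) * (((Z.card : ℝ) / l - V) ^ 2 + parCount Z / l) := by gcongr
    _ = _ := by ring

end HeckePoints

section BoundedElements

variable {s d : ℕ} {p : Fin s → ℕ} [hp : ∀ i, Fact (p i).Prime]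

instance secondCountableTopology_SL {𝕜 : Type*} [NormedField 𝕜] [SecondCountableTopology 𝕜] :
    SecondCountableTopology (Matrix.SpecialLinearGroup (Fin d) 𝕜) :=
  have : SecondCountableTopology (Matrix (Fin d) (Fin d) 𝕜) :=
    inferInstanceAs (SecondCountableTopology (Fin d → Fin d → 𝕜))
  Matrix.SpecialLinearGroup.isClosedEmbedding_val.isInducing.secondCountableTopology

/-- Elements of `SL_d(ℚ_S)` all of whose entries are bounded by `K`. -/
def ballSLS (p : Fin s → ℕ) [∀ i, Fact (p i).Prime] (K : ℝ) : Set (SLS d p) :=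
  {σ | (∀ j k, |σ.1 j k| ≤ K) ∧ ∀ i j k, ‖σ.2 i j k‖ ≤ K}

theorem isCompact_ballSLS (K : ℝ) : IsCompact (ballSLS (d := d) p K) := by
  have h := (isCompact_bounded_SL (d := d) (𝕜 := ℝ) K).prod
    (isCompact_univ_pi fun i => isCompact_bounded_SL (d := d) (𝕜 := ℚ_[p i]) K)
  convert h using 1
  ext σ
  simp [ballSLS]

theorem exists_ballSLS_of_isCompact {Ω : Set (SLS d p)} (hΩ : IsCompact Ω) :
    ∃ K : ℝ, 0 < K ∧ Ω ⊆ ballSLS p K := by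
  have hc : Continuous fun σ : SLS d p =>
      (∑ j, ∑ k, |σ.1 j k|) + ∑ i, ∑ j, ∑ k, ‖σ.2 i j k‖ := by
    refine Continuous.add ?_ ?_
    · refine continuous_finsetSum _ fun j _ => continuous_finsetSum _ fun k _ => ?_
      have h1 : Continuous fun σ : SLS d p => (σ.1 : Matrix (Fin d) (Fin d) ℝ) :=
        continuous_subtype_val.comp continuous_fst
      exact (h1.matrix_elem j k).abs
    · refine continuous_finsetSum _ fun i _ => continuous_finsetSum _ fun j _ =>
        continuous_finsetSum _ fun k _ => ?_
      have h1 : Continuous fun σ : SLS d p => (σ.2 i : Matrix (Fin d) (Fin d) ℚ_[p i]) :=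
        continuous_subtype_val.comp ((continuous_apply i).comp continuous_snd)
      exact (h1.matrix_elem j k).norm
  obtain ⟨K, hK⟩ := hΩ.exists_bound_of_continuousOn hc.continuousOn
  refine ⟨max K 1, lt_of_lt_of_le one_pos (le_max_right _ _), fun σ hσ => ?_⟩
  have hb := (le_abs_self _).trans ((hK σ hσ).trans (le_max_left K 1))
  have h1 : 0 ≤ ∑ j, ∑ k, |σ.1 j k| := by positivity
  have h2 : 0 ≤ ∑ i, ∑ j, ∑ k, ‖σ.2 i j k‖ := by positivity
  constructor
  · intro j k
    have h3 : |σ.1 j k| ≤ ∑ k, |σ.1 j k| :=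
      Finset.single_le_sum (f := fun k => |σ.1 j k|) (fun _ _ => abs_nonneg _) (Finset.mem_univ k)
    have h4 : ∑ k, |σ.1 j k| ≤ ∑ j, ∑ k, |σ.1 j k| :=
      Finset.single_le_sum (f := fun j => ∑ k, |σ.1 j k|) (fun _ _ => by positivity)
        (Finset.mem_univ j)
    linarith
  · intro i j k
    have h3 : ‖σ.2 i j k‖ ≤ ∑ k, ‖σ.2 i j k‖ :=
      Finset.single_le_sum (f := fun k => ‖σ.2 i j k‖) (fun _ _ => norm_nonneg _)
        (Finset.mem_univ k)
    have h4 : ∑ k, ‖σ.2 i j k‖ ≤ ∑ j, ∑ k, ‖σ.2 i j k‖ :=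
      Finset.single_le_sum (f := fun j => ∑ k, ‖σ.2 i j k‖) (fun _ _ => by positivity)
        (Finset.mem_univ j)
    have h5 : ∑ j, ∑ k, ‖σ.2 i j k‖ ≤ ∑ i, ∑ j, ∑ k, ‖σ.2 i j k‖ :=
      Finset.single_le_sum (f := fun i => ∑ j, ∑ k, ‖σ.2 i j k‖) (fun _ _ => by positivity)
        (Finset.mem_univ i)
    linarith

/-- Regularity conditions on a subset of `ℝ^d`. -/
structure RealNice (B : Set (Fin d → ℝ)) : Prop where
  bounded : Bornology.IsBounded B
  measurable : MeasurableSet B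
  frontier : volume (frontier B) = 0

theorem eq_inv_mulVec {R : Type*} [CommRing R] (g : Matrix.SpecialLinearGroup (Fin d) R)
    (x : Fin d → R) : x = ((g⁻¹ : Matrix.SpecialLinearGroup (Fin d) R) :
      Matrix (Fin d) (Fin d) R) *ᵥ ((g : Matrix (Fin d) (Fin d) R) *ᵥ x) := by
  rw [mulVec_mulVec, ← Matrix.SpecialLinearGroup.coe_mul, inv_mul_cancel,
    Matrix.SpecialLinearGroup.coe_one, one_mulVec]

theorem norm_le_of_mulVec {𝕜 : Type*} [NormedField 𝕜] {g : Matrix.SpecialLinearGroup (Fin d) 𝕜}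
    {K M : ℝ} (hg : ∀ j k, ‖(g⁻¹ : Matrix.SpecialLinearGroup (Fin d) 𝕜) j k‖ ≤ K)
    (hK : 0 ≤ K) {x : Fin d → 𝕜}
    (hx : ∀ k, ‖((g : Matrix (Fin d) (Fin d) 𝕜) *ᵥ x) k‖ ≤ M) (j : Fin d) :
    ‖x j‖ ≤ d * (K * M) := by
  have h : x j = ∑ k, (g⁻¹ : Matrix.SpecialLinearGroup (Fin d) 𝕜) j k *
      ((g : Matrix (Fin d) (Fin d) 𝕜) *ᵥ x) k := congrFun (eq_inv_mulVec g x) j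
  rw [h]
  have h2 : ‖∑ k, (g⁻¹ : Matrix.SpecialLinearGroup (Fin d) 𝕜) j k *
      ((g : Matrix (Fin d) (Fin d) 𝕜) *ᵥ x) k‖ ≤ ∑ _k : Fin d, K * M :=
    norm_sum_le_of_le _ fun k _ => by
      rw [norm_mul]
      exact mul_le_mul (hg j k) (hx k) (norm_nonneg _) hK
  simpa using h2

theorem volume_mulVec_preimage (g : Matrix.SpecialLinearGroup (Fin d) ℝ) (B : Set (Fin d → ℝ)) :
    volume {x | (g : Matrix (Fin d) (Fin d) ℝ) *ᵥ x ∈ B} = volume B := by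
  have hdet : LinearMap.det (Matrix.toLin' (g : Matrix (Fin d) (Fin d) ℝ)) = 1 := by
    rw [LinearMap.det_toLin']
    exact g.2
  have h := Measure.addHaar_preimage_linearMap (volume : Measure (Fin d → ℝ))
    (f := Matrix.toLin' (g : Matrix (Fin d) (Fin d) ℝ)) (by rw [hdet]; exact one_ne_zero) B
  rw [hdet] at h
  simpa [Set.preimage, Matrix.toLin'_apply] using h

theorem RealNice.preimage {B : Set (Fin d → ℝ)} (h : RealNice B)
    (g : Matrix.SpecialLinearGroup (Fin d) ℝ) :
    RealNice {x | (g : Matrix (Fin d) (Fin d) ℝ) *ᵥ x ∈ B} := by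
  have hcont : ∀ g : Matrix.SpecialLinearGroup (Fin d) ℝ,
      Continuous fun x => (g : Matrix (Fin d) (Fin d) ℝ) *ᵥ x := fun g =>
    Continuous.matrix_mulVec continuous_const continuous_id
  let e : (Fin d → ℝ) ≃ₜ (Fin d → ℝ) :=
    { toFun := fun x => (g : Matrix (Fin d) (Fin d) ℝ) *ᵥ x
      invFun := fun x => ((g⁻¹ : Matrix.SpecialLinearGroup (Fin d) ℝ) :
        Matrix (Fin d) (Fin d) ℝ) *ᵥ x
      left_inv := fun x => (eq_inv_mulVec g x).symm
      right_inv := fun x => by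
        have := (eq_inv_mulVec g⁻¹ x).symm
        rwa [inv_inv] at this
      continuous_toFun := hcont g
      continuous_invFun := hcont g⁻¹ }
  refine ⟨?_, (hcont g).measurable h.measurable, ?_⟩
  · obtain ⟨R, hR⟩ := h.bounded.exists_norm_le
    obtain ⟨K, hK⟩ := (Set.finite_range fun q : Fin d × Fin d =>
      ‖(g⁻¹ : Matrix.SpecialLinearGroup (Fin d) ℝ) q.1 q.2‖).bddAbove
    rw [isBounded_iff_forall_norm_le]
    refine ⟨d * (max K 0 * max R 0), fun x hx => ?_⟩
    rw [pi_norm_le_iff_of_nonneg (by positivity)]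
    refine norm_le_of_mulVec (g := g) (fun j k => ?_) (le_max_right _ _) fun k => ?_
    · exact (hK ⟨(j, k), rfl⟩).trans (le_max_left _ _)
    · exact ((norm_le_pi_norm _ k).trans (hR _ hx)).trans (le_max_left _ _)
  · have : _root_.frontier {x | (g : Matrix (Fin d) (Fin d) ℝ) *ᵥ x ∈ B} =
        {x | (g : Matrix (Fin d) (Fin d) ℝ) *ᵥ x ∈ _root_.frontier B} :=
      (e.preimage_frontier B).symm
    rw [this, volume_mulVec_preimage]
    exact h.frontier

theorem latticeCount_eq_gridPoints (v : Fin d → ℚ) (BR : Set (Fin d → ℝ))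
    (BP : ∀ i, Set (Fin d → ℚ_[p i])) (g : SLS d p) :
    {w : Fin d → ℚ | (∀ j, IsZS (∏ i, p i) (w j - v j)) ∧ w ≠ 0 ∧
      (g.1 : Matrix (Fin d) (Fin d) ℝ) *ᵥ ratR w ∈ BR ∧
      ∀ i, (g.2 i : Matrix (Fin d) (Fin d) ℚ_[p i]) *ᵥ ratP p i w ∈ BP i} =
    gridPoints p v {x | (g.1 : Matrix (Fin d) (Fin d) ℝ) *ᵥ x ∈ BR}
      (fun i => {x | (g.2 i : Matrix (Fin d) (Fin d) ℚ_[p i]) *ᵥ x ∈ BP i}) 1 \ {0} := by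
  ext w
  simp only [gridPoints, div_one, Set.mem_sdiff, Set.mem_ofPred_eq, Set.mem_singleton_iff]
  change _ ↔ ((_ ∧ (g.1 : Matrix (Fin d) (Fin d) ℝ) *ᵥ ratR w ∈ BR ∧ _) ∧ _)
  tauto

variable [∀ i, MeasurableSpace ℚ_[p i]] [∀ i, BorelSpace ℚ_[p i]]

theorem finite_twisted_gridPoints (hpinj : Function.Injective p) (v : Fin d → ℚ)
    {BR : Set (Fin d → ℝ)} (hBR : RealNice BR) {BP : ∀ i, Set (Fin d → ℚ_[p i])}
    (μd : ∀ i, Measure (Fin d → ℚ_[p i])) [∀ i, (μd i).IsAddHaarMeasure]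
    (hμd : ∀ i, μd i {y | ∀ j, ‖y j‖ ≤ 1} = 1)
    (hBP : ∀ i, PadicNice (μd i) (BP i)) (g : SLS d p) {X : ℝ} (hX : 0 < X) :
    (gridPoints p v {x | (g.1 : Matrix (Fin d) (Fin d) ℝ) *ᵥ x ∈ BR}
      (fun i => {x | (g.2 i : Matrix (Fin d) (Fin d) ℚ_[p i]) *ᵥ x ∈ BP i}) X).Finite :=
  finite_gridPoints hpinj v (hBR.preimage g.1).bounded
    (fun i => ((hBP i).preimage (hμd i) (g.2 i)).bounded)
    (fun i => ((hBP i).preimage (hμd i) (g.2 i)).translation) hX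

theorem finite_latticeCount (hpinj : Function.Injective p) (v : Fin d → ℚ)
    {BR : Set (Fin d → ℝ)} (hBR : RealNice BR) {BP : ∀ i, Set (Fin d → ℚ_[p i])}
    (μd : ∀ i, Measure (Fin d → ℚ_[p i])) [∀ i, (μd i).IsAddHaarMeasure]
    (hμd : ∀ i, μd i {y | ∀ j, ‖y j‖ ≤ 1} = 1)
    (hBP : ∀ i, PadicNice (μd i) (BP i)) (g : SLS d p) :
    {w : Fin d → ℚ | (∀ j, IsZS (∏ i, p i) (w j - v j)) ∧ w ≠ 0 ∧
      (g.1 : Matrix (Fin d) (Fin d) ℝ) *ᵥ ratR w ∈ BR ∧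
      ∀ i, (g.2 i : Matrix (Fin d) (Fin d) ℚ_[p i]) *ᵥ ratP p i w ∈ BP i}.Finite := by
  rw [latticeCount_eq_gridPoints]
  exact (finite_twisted_gridPoints hpinj v hBR μd hμd hBP g one_pos).subset Set.sdiff_subset

variable [MeasurableSpace (Matrix.SpecialLinearGroup (Fin d) ℝ)]
  [BorelSpace (Matrix.SpecialLinearGroup (Fin d) ℝ)]
  [∀ i, MeasurableSpace (Matrix.SpecialLinearGroup (Fin d) ℚ_[p i])]
  [∀ i, BorelSpace (Matrix.SpecialLinearGroup (Fin d) ℚ_[p i])]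

theorem measurable_act_real (w : Fin d → ℝ) :
    Measurable fun g : SLS d p => (g.1 : Matrix (Fin d) (Fin d) ℝ) *ᵥ w :=
  (Continuous.matrix_mulVec continuous_subtype_val continuous_const :
    Continuous fun g : Matrix.SpecialLinearGroup (Fin d) ℝ =>
      (g : Matrix (Fin d) (Fin d) ℝ) *ᵥ w).measurable.comp measurable_fst

theorem measurable_act_padic (i : Fin s) (w : Fin d → ℚ_[p i]) :
    Measurable fun g : SLS d p => (g.2 i : Matrix (Fin d) (Fin d) ℚ_[p i]) *ᵥ w :=
  (Continuous.matrix_mulVec continuous_subtype_val continuous_const :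
    Continuous fun g : Matrix.SpecialLinearGroup (Fin d) ℚ_[p i] =>
      (g : Matrix (Fin d) (Fin d) ℚ_[p i]) *ᵥ w).measurable.comp
    ((measurable_pi_apply i).comp measurable_snd)

theorem measurableSet_ballSLS (K : ℝ) : MeasurableSet (ballSLS (d := d) p K) := by
  have h1 : MeasurableSet {σ : Matrix.SpecialLinearGroup (Fin d) ℝ | ∀ j k, ‖σ j k‖ ≤ K} :=
    (isCompact_bounded_SL (d := d) (𝕜 := ℝ) K).isClosed.measurableSet
  have h2 : ∀ i, MeasurableSet {σ : Matrix.SpecialLinearGroup (Fin d) ℚ_[p i] |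
      ∀ j k, ‖σ j k‖ ≤ K} := fun i =>
    (isCompact_bounded_SL (d := d) (𝕜 := ℚ_[p i]) K).isClosed.measurableSet
  have h := h1.prod (MeasurableSet.univ_pi h2)
  convert h using 1
  ext σ
  simp [ballSLS]

theorem measurable_latticeCount (hpinj : Function.Injective p) (v : Fin d → ℚ)
    {BR : Set (Fin d → ℝ)} (hBR : RealNice BR) {BP : ∀ i, Set (Fin d → ℚ_[p i])}
    (μd : ∀ i, Measure (Fin d → ℚ_[p i])) [∀ i, (μd i).IsAddHaarMeasure]
    (hμd : ∀ i, μd i {y | ∀ j, ‖y j‖ ≤ 1} = 1)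
    (hBP : ∀ i, PadicNice (μd i) (BP i)) :
    Measurable fun g : SLS d p => (latticeCount p v BR BP g : ℝ) := by
  have hset : ∀ w : Fin d → ℚ, MeasurableSet {g : SLS d p |
      (∀ j, IsZS (∏ i, p i) (w j - v j)) ∧ w ≠ 0 ∧
      (g.1 : Matrix (Fin d) (Fin d) ℝ) *ᵥ ratR w ∈ BR ∧
      ∀ i, (g.2 i : Matrix (Fin d) (Fin d) ℚ_[p i]) *ᵥ ratP p i w ∈ BP i} := by
    intro w
    have h1 : MeasurableSet {g : SLS d p |
        ∀ i, (g.2 i : Matrix (Fin d) (Fin d) ℚ_[p i]) *ᵥ ratP p i w ∈ BP i} := by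
      rw [Set.ofPred_forall]
      exact MeasurableSet.iInter fun i => measurable_act_padic i _ (hBP i).measurableSet
    exact (MeasurableSet.const _).inter ((MeasurableSet.const _).inter
      ((measurable_act_real _ hBR.measurable).inter h1))
  have heq : (fun g : SLS d p => (latticeCount p v BR BP g : ℝ)) = fun g =>
      (∑' w : Fin d → ℚ, Set.indicator {g : SLS d p |
      (∀ j, IsZS (∏ i, p i) (w j - v j)) ∧ w ≠ 0 ∧
      (g.1 : Matrix (Fin d) (Fin d) ℝ) *ᵥ ratR w ∈ BR ∧
      ∀ i, (g.2 i : Matrix (Fin d) (Fin d) ℚ_[p i]) *ᵥ ratP p i w ∈ BP i}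
        (fun _ => (1 : ENNReal)) g).toReal := by
    funext g
    set A := {w : Fin d → ℚ | (∀ j, IsZS (∏ i, p i) (w j - v j)) ∧ w ≠ 0 ∧
      (g.1 : Matrix (Fin d) (Fin d) ℝ) *ᵥ ratR w ∈ BR ∧
      ∀ i, (g.2 i : Matrix (Fin d) (Fin d) ℚ_[p i]) *ᵥ ratP p i w ∈ BP i} with hA
    have hfin : A.Finite := finite_latticeCount hpinj v hBR μd hμd hBP g
    have h1 : ∑' w : Fin d → ℚ, A.indicator (fun _ => (1 : ENNReal)) w = A.encard := by
      rw [← tsum_subtype, ENNReal.tsum_set_one]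
    have h2 : (A.encard : ENNReal) = (A.ncard : ENNReal) := by
      rw [← hfin.cast_ncard_eq]
      rfl
    change (A.ncard : ℝ) = (∑' w : Fin d → ℚ, A.indicator (fun _ => (1 : ENNReal)) w).toReal
    rw [h1, h2, ENNReal.toReal_natCast]
  rw [heq]
  exact (Measurable.tsum fun w => measurable_const.indicator (hset w)).ennreal_toReal

end BoundedElements

section Variance

theorem setLIntegral_le_average {G ι : Type*} [Group G] [MeasurableSpace G] [MeasurableMul G]
    (ρ : Measure G) [ρ.IsMulRightInvariant] {F : G → ENNReal} (hF : Measurable F)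
    {Ω Ω' : Set G} (hΩ : MeasurableSet Ω) (hΩ' : MeasurableSet Ω') {S : Finset ι}
    (hS : S.Nonempty) {σ : ι → G} (h : ∀ ξ ∈ S, ∀ g ∈ Ω, g * (σ ξ)⁻¹ ∈ Ω') :
    ∫⁻ g in Ω, F g ∂ρ ≤ ∫⁻ g in Ω', (S.card : ENNReal)⁻¹ * ∑ ξ ∈ S, F (g * σ ξ) ∂ρ := by
  have hmeas : ∀ ξ, Measurable fun g => F (g * σ ξ) := fun ξ =>
    hF.comp (measurable_mul_const _)
  rw [lintegral_const_mul _ (Finset.measurable_fun_sum S fun ξ _ => hmeas ξ),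
    lintegral_finsetSum S fun ξ _ => hmeas ξ]
  have h1 : ∀ ξ ∈ S, ∫⁻ g in Ω, F g ∂ρ ≤ ∫⁻ g in Ω', F (g * σ ξ) ∂ρ := by
    intro ξ hξ
    rw [← lintegral_indicator hΩ, ← lintegral_indicator hΩ',
      ← lintegral_mul_right_eq_self (μ := ρ) (Ω.indicator F) (σ ξ)]
    refine lintegral_mono fun g => ?_
    by_cases hg : g * σ ξ ∈ Ω
    · have : g ∈ Ω' := by simpa using h ξ hξ _ hg
      simp [hg, this]
    · simp [hg]
  have h2 : (S.card : ENNReal) * ∫⁻ g in Ω, F g ∂ρ ≤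
      ∑ ξ ∈ S, ∫⁻ g in Ω', F (g * σ ξ) ∂ρ := by
    rw [← nsmul_eq_mul]
    exact Finset.card_nsmul_le_sum S _ _ h1
  have hc : (S.card : ENNReal) ≠ 0 := by exact_mod_cast hS.card_pos.ne'
  calc ∫⁻ g in Ω, F g ∂ρ = (S.card : ENNReal)⁻¹ * ((S.card : ENNReal) * ∫⁻ g in Ω, F g ∂ρ) := by
        rw [← mul_assoc, ENNReal.inv_mul_cancel hc (ENNReal.natCast_ne_top _), one_mul]
    _ ≤ _ := by gcongr

variable {s d : ℕ} {p : Fin s → ℕ} [hp : ∀ i, Fact (p i).Prime]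
variable [∀ i, MeasurableSpace ℚ_[p i]] [∀ i, BorelSpace ℚ_[p i]]
  [MeasurableSpace (Matrix.SpecialLinearGroup (Fin d) ℝ)]
  [BorelSpace (Matrix.SpecialLinearGroup (Fin d) ℝ)]
  [∀ i, MeasurableSpace (Matrix.SpecialLinearGroup (Fin d) ℚ_[p i])]
  [∀ i, BorelSpace (Matrix.SpecialLinearGroup (Fin d) ℚ_[p i])]

/-- Mean square bound for the lattice point discrepancy. -/
theorem variance_le (hpinj : Function.Injective p) (hd : 3 ≤ d)
    {N : ℕ} (hN : 0 < N) (hNS : Nat.Coprime N (∏ i, p i))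
    {v : Fin d → ℚ} (hv : ∀ j, IsZS (∏ i, p i) (N * v j))
    (μd : ∀ i, Measure (Fin d → ℚ_[p i])) [∀ i, (μd i).IsAddHaarMeasure]
    (hμd : ∀ i, μd i {y | ∀ j, ‖y j‖ ≤ 1} = 1) (ρ : Measure (SLS d p)) [ρ.IsMulRightInvariant]
    (hρ : ∀ K, ρ (ballSLS p K) ≠ ⊤) (K₀ : ℝ) :
    ∃ C : ℝ, 0 ≤ C ∧ ∀ (BR : Set (Fin d → ℝ)) (BP : ∀ i, Set (Fin d → ℚ_[p i])), RealNice BR →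
      (∀ i, PadicNice (μd i) (BP i)) →
      ∫⁻ g in ballSLS p K₀, ENNReal.ofReal (((latticeCount p v BR BP g : ℝ) -
        (volume BR).toReal * ∏ i, (μd i (BP i)).toReal) ^ 2) ∂ρ ≤
      ENNReal.ofReal (C * ((volume BR).toReal * ∏ i, (μd i (BP i)).toReal)) := by
  have : NeZero d := ⟨by lia⟩
  obtain ⟨Kb, hKb⟩ := exists_hecke_family (p := p) (d := d) (by lia) hN
  obtain ⟨K₁, -, hK₁⟩ := exists_ballSLS_of_isCompact
    ((isCompact_ballSLS (p := p) (d := d) K₀).mul (isCompact_boundedSLS (p := p) (d := d) Kb).inv)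
  obtain ⟨K₂, hK₂, hinv⟩ := exists_ballSLS_of_isCompact
    (isCompact_ballSLS (p := p) (d := d) K₁).inv
  set Ω' : Set (SLS d p) := ballSLS p K₁ with hΩ'
  have hc0 : 0 ≤ parConst p d N := parConst_nonneg p d N
  refine ⟨2 * parConst p d N * (ρ Ω').toReal, by positivity, fun BR BP hBR hBP => ?_⟩
  set V := (volume BR).toReal * ∏ i, (μd i (BP i)).toReal with hV
  have hV0 : 0 ≤ V := mul_nonneg ENNReal.toReal_nonneg
    (Finset.prod_nonneg fun _ _ => ENNReal.toReal_nonneg)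
  obtain ⟨M, hM⟩ := padic_exists_pow_bound fun i => (hBP i).bounded
  obtain ⟨R, hR⟩ := hBR.bounded.exists_norm_le
  obtain ⟨M', hM'⟩ := padic_exists_pow_bound (p := p)
    (SP := fun i => {x : Fin d → ℚ_[p i] | ∀ j, ‖x j‖ ≤ d * (K₂ * (p i : ℝ) ^ M)})
    fun i => ⟨_, fun x hx => hx⟩
  set b : ℝ := d * (K₂ * max R 1) with hb
  have hd0 : (0 : ℝ) < d := by exact_mod_cast (by lia : 0 < d)
  have hb0 : 0 < b := by
    have : 0 < max R 1 := lt_of_lt_of_le one_pos (le_max_right _ _)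
    positivity
  set Q : ℚ := (N : ℚ) * ((∏ i, p i : ℕ) : ℚ) ^ M' with hQ
  have hQ0 : 0 < Q := by
    have := padic_prod_pos p
    positivity
  have hQR : (0 : ℝ) < Q := by exact_mod_cast hQ0
  -- the twisted sets
  set SR : SLS d p → Set (Fin d → ℝ) := fun g => {x | (g.1 : Matrix (Fin d) (Fin d) ℝ) *ᵥ x ∈ BR}
    with hSR
  set SP : SLS d p → ∀ i, Set (Fin d → ℚ_[p i]) := fun g i =>
    {x | (g.2 i : Matrix (Fin d) (Fin d) ℚ_[p i]) *ᵥ x ∈ BP i} with hSP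
  have hZex : ∀ (g : SLS d p) (X : ℝ), ∃ Z : Finset (Fin d → ℚ), 0 < X →
      ∀ z, z ∈ Z ↔ z ∈ gridPoints p v (SR g) (SP g) X ∧ z ≠ 0 := by
    intro g X
    by_cases hX : 0 < X
    · refine ⟨((finite_twisted_gridPoints hpinj v hBR μd hμd hBP g hX).subset
        (Set.sdiff_subset (t := {0}))).toFinset, fun _ z => ?_⟩
      simp [hSR, hSP]
    · exact ⟨∅, fun h => absurd h hX⟩
  choose Z hZ using hZex
  have hZint : ∀ g ∈ Ω', ∀ X, 0 < X → ∀ z ∈ Z g X, ∀ j, ∃ a : ℤ, Q * z j = a := by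
    intro g hg X hX z hz j
    have h1 := ((hZ g X hX z).mp hz).1
    refine grid_exists_int hpinj hv h1.1 (fun i => ?_) j
    refine hM' i _ fun j => ?_
    exact norm_le_of_mulVec (g := g.2 i) (fun j k => (hinv (Set.inv_mem_inv.mpr hg)).2 i j k) hK₂.le
      (fun k => hM i _ (h1.2.2 i) k) j
  have hZb : ∀ g ∈ Ω', ∀ X, 0 < X → ∀ z ∈ Z g X, ∀ j, |((Q * z j : ℚ) : ℝ)| ≤ Q * b * X := by
    intro g hg X hX z hz j
    have h1 := ((hZ g X hX z).mp hz).1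
    have h2 : ‖(z j : ℝ) / X‖ ≤ b :=
      norm_le_of_mulVec (g := g.1) (x := fun j => (z j : ℝ) / X)
        (fun j k => (hinv (Set.inv_mem_inv.mpr hg)).1 j k) hK₂.le
        (fun k => ((norm_le_pi_norm _ k).trans (hR _ h1.2.1)).trans (le_max_left R 1)) j
    rw [Real.norm_eq_abs, abs_div, abs_of_pos hX, div_le_iff₀ hX] at h2
    push_cast
    rw [abs_mul, abs_of_pos hQR, mul_assoc]
    gcongr
  -- the primes
  set X₀ : ℝ := max 8 (max (2 * (Q * b) ^ 2 + 1) (Q * b + 1)) with hX₀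
  have hmod : N * (d ^ 2 * ∏ i, p i) ≠ 0 := by
    have := padic_prod_pos p
    positivity
  have hprime : ∀ k : ℕ, ∃ l : ℕ, l.Prime ∧ ((k : ℝ) ^ d + X₀ ^ d) ≤ l ∧
      l ≡ 1 [MOD N * (d ^ 2 * ∏ i, p i)] := by
    intro k
    obtain ⟨l, hl, hkl, hlm⟩ := Nat.exists_prime_gt_modEq_one ⌈(k : ℝ) ^ d + X₀ ^ d⌉₊ hmod
    exact ⟨l, hl, (Nat.le_ceil _).trans (by exact_mod_cast hkl.le), hlm⟩
  choose l hl hkl hlm using hprime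
  have hl0 : ∀ k, (0 : ℝ) < l k := fun k => by exact_mod_cast (hl k).pos
  set X : ℕ → ℝ := fun k => (l k : ℝ) ^ ((d : ℝ)⁻¹) with hX
  have hXl : ∀ k, X k ^ d = l k := fun k =>
    Real.rpow_inv_natCast_pow (hl0 k).le (by lia)
  have hXpos : ∀ k, 0 < X k := fun k => Real.rpow_pos_of_pos (hl0 k) _
  have hX₀pos : 0 < X₀ := lt_of_lt_of_le (by norm_num) (le_max_left _ _)
  have hX0X : ∀ k, X₀ ≤ X k := fun k => by
    refine le_of_pow_le_pow_left₀ (by lia : d ≠ 0) (hXpos k).le ?_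
    rw [hXl]
    have : (0 : ℝ) ≤ (k : ℝ) ^ d := by positivity
    linarith [hkl k]
  have hkX : ∀ k : ℕ, (k : ℝ) ≤ X k := fun k => by
    refine le_of_pow_le_pow_left₀ (by lia : d ≠ 0) (hXpos k).le ?_
    rw [hXl]
    have : (0 : ℝ) ≤ X₀ ^ d := by positivity
    linarith [hkl k]
  have hXtop : Tendsto X atTop atTop :=
    tendsto_atTop_mono hkX tendsto_natCast_atTop_atTop
  have hX8 : ∀ k, 8 ≤ X k := fun k => (le_max_left _ _).trans (hX0X k)
  have hX3 : ∀ k, X k ^ 3 ≤ l k := fun k => by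
    rw [← hXl]
    exact pow_le_pow_right₀ (by linarith [hX8 k]) hd
  have hH1 : ∀ k, 2 * (Q * b * X k) ^ 2 < l k := fun k => by
    refine lt_of_lt_of_le ?_ (hX3 k)
    have h1 : 2 * (Q * b) ^ 2 + 1 ≤ X k :=
      ((le_max_left _ _).trans (le_max_right _ _)).trans (hX0X k)
    have h2 : 0 < X k ^ 2 := pow_pos (hXpos k) 2
    nlinarith
  have hH2 : ∀ k, Q * b * X k < l k := fun k => by
    refine lt_of_lt_of_le ?_ (hX3 k)
    have h1 : Q * b + 1 ≤ X k := ((le_max_right _ _).trans (le_max_right _ _)).trans (hX0X k)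
    have h2 := hX8 k
    have h3 : X k * X k ≤ X k ^ 3 := by nlinarith [mul_pos (hXpos k) (hXpos k)]
    nlinarith [hXpos k]
  -- the averages
  have hfam : ∀ k, ∃ Good : Finset (Fin d → ZMod (l k)), l k ^ d ≤ 2 * Good.card ∧
      ∃ σ : (Fin d → ZMod (l k)) → SLS d p, ∀ ξ ∈ Good, IsHecke N (l k) (X k) ξ (σ ξ) ∧
        σ ξ ∈ boundedSLS p Kb := fun k => hKb (l k) ⟨hl k⟩ (hlm k) (X k) (hX8 k) (hXl k)
  choose Good hGood σ hσ using hfam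
  have hGne : ∀ k, (Good k).Nonempty := fun k => by
    have : 0 < l k ^ d := pow_pos (hl k).pos _
    exact Finset.card_pos.mp (by have := hGood k; lia)
  set F : SLS d p → ENNReal := fun g =>
    ENNReal.ofReal (((latticeCount p v BR BP g : ℝ) - V) ^ 2) with hF
  have hFm : Measurable F :=
    (((measurable_latticeCount hpinj v hBR μd hμd hBP).sub_const V).pow_const 2).ennreal_ofReal
  set f : ℕ → SLS d p → ENNReal := fun k g =>
    ((Good k).card : ENNReal)⁻¹ * ∑ ξ ∈ Good k, F (g * σ k ξ) with hf
  have hfm : ∀ k, Measurable (f k) := fun k => by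
    refine Measurable.const_mul (Finset.measurable_fun_sum _ fun ξ _ => ?_) _
    exact hFm.comp (measurable_mul_const _)
  set B : ℕ → SLS d p → ℝ := fun k g =>
    2 * ((((Z g (X k)).card : ℝ) / l k - V) ^ 2 + (parCount (Z g (X k)) : ℝ) / l k) with hB
  have hfB : ∀ k, ∀ g ∈ Ω', f k g ≤ ENNReal.ofReal (B k g) := by
    intro k g hg
    have : Fact (l k).Prime := ⟨hl k⟩
    have hcop : Nat.Coprime (∏ i, p i) (l k) := by
      have h1 : l k ≡ 1 [MOD ∏ i, p i] :=
        (hlm k).of_dvd ((Dvd.intro_left _ rfl).trans (Dvd.intro_left _ rfl))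
      have h2 := h1.gcd_eq
      rw [Nat.gcd_one_left] at h2
      exact Nat.Coprime.symm h2
    have h := hecke_average_le hN hcop (hGood k) (fun ξ hξ => (hσ k ξ hξ).1) hv
      (fun i => (hBP i).unit) g (hZ g (X k) (hXpos k)) (hZint g hg (X k) (hXpos k)) (hH1 k) (hH2 k)
      (hZb g hg (X k) (hXpos k)) V
    refine le_trans (le_of_eq ?_) (ENNReal.ofReal_le_ofReal h)
    rw [ENNReal.ofReal_mul (by positivity), ENNReal.ofReal_sum_of_nonneg fun _ _ => sq_nonneg _,
      ENNReal.ofReal_inv_of_pos (by exact_mod_cast (hGne k).card_pos), ENNReal.ofReal_natCast]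
  set D : ℝ := (3 * (Q * b)) ^ d * ∑' c, ratioWeight c with hD
  have hParD : ∀ k, ∀ g ∈ Ω', (parCount (Z g (X k)) : ℝ) / l k ≤ D := by
    intro k g hg
    have h := parCount_le hd (fun z hz => ((hZ g (X k) (hXpos k) z).mp hz).2) hQ0.ne'
      (hZint g hg (X k) (hXpos k)) (hZb g hg (X k) (hXpos k)) (by have := hXpos k; positivity)
    rw [div_le_iff₀ (hl0 k)]
    refine h.trans (le_of_eq ?_)
    rw [hD, ← hXl k, ← mul_assoc, mul_pow, mul_pow]
    ring
  have hunif : ∀ k, ∀ g ∈ Ω', B k g ≤ 2 * ((D + V) ^ 2 + D) := by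
    intro k g hg
    have h1 := hParD k g hg
    have h2 : ((Z g (X k)).card : ℝ) / l k ≤ D := by
      refine le_trans ?_ h1
      have := card_le_parCount (Z g (X k))
      gcongr
    have h3 : 0 ≤ ((Z g (X k)).card : ℝ) / l k := by have := hl0 k; positivity
    have h4 : (((Z g (X k)).card : ℝ) / l k - V) ^ 2 ≤ (D + V) ^ 2 := by
      apply sq_le_sq'
      · linarith
      · linarith
    simp only [hB]
    linarith
  have hVg : ∀ g : SLS d p, (volume (SR g)).toReal * ∏ i, (μd i (SP g i)).toReal = V := by
    intro g
    rw [hV, volume_mulVec_preimage]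
    congr 1
    refine Finset.prod_congr rfl fun i _ => ?_
    rw [padic_measure_mulVec_preimage (μd i) (hμd i) (hBP i).measurableSet _
      (by rw [(g.2 i).2]; exact one_ne_zero), (g.2 i).2]
    simp
  have hlim : ∀ g ∈ Ω', limsup (fun k => f k g) atTop ≤
      ENNReal.ofReal (2 * parConst p d N * V) := by
    intro g hg
    have hnR := hBR.preimage g.1
    have hnP := fun i => (hBP i).preimage (hμd i) (g.2 i)
    have hcard : Tendsto (fun k => ((Z g (X k)).card : ℝ) / l k) atTop (𝓝 V) := by
      have h1 := (tendsto_grid_count hpinj v hnR.bounded hnR.frontier μd hμd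
        (fun i => (hnP i).bounded) (fun i => (hnP i).translation)).comp hXtop
      rw [hVg g] at h1
      have hltop : Tendsto (fun k => (l k : ℝ)) atTop atTop := by
        refine tendsto_atTop_mono (fun k => ?_) hXtop
        have h2 := hX8 k
        refine le_trans ?_ (hX3 k)
        nlinarith [mul_pos (hXpos k) (hXpos k)]
      have h2 : Tendsto (fun k => 1 / (l k : ℝ)) atTop (𝓝 0) :=
        tendsto_const_nhds.div_atTop hltop
      have h3 := h1.sub h2
      rw [sub_zero] at h3
      have hset : ∀ k, ((Z g (X k) : Finset (Fin d → ℚ)) : Set (Fin d → ℚ)) =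
          gridPoints p v (SR g) (SP g) (X k) \ {0} := fun k => by
        ext z
        simpa using hZ g (X k) (hXpos k) z
      have hncard : ∀ k, (Z g (X k)).card = (gridPoints p v (SR g) (SP g) (X k) \ {0}).ncard :=
        fun k => by rw [← hset k, Set.ncard_coe_finset]
      refine tendsto_of_tendsto_of_tendsto_of_le_of_le h3 h1 (fun k => ?_) fun k => ?_
      · have h4 := Set.ncard_le_ncard_sdiff_add_ncard (gridPoints p v (SR g) (SP g) (X k)) {0}
        rw [Set.ncard_singleton, ← hncard k] at h4
        have h5 : ((gridPoints p v (SR g) (SP g) (X k)).ncard : ℝ) ≤ (Z g (X k)).card + 1 := by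
          exact_mod_cast h4
        simp only [Function.comp]
        rw [hXl k, ← sub_div, div_le_div_iff_of_pos_right (hl0 k)]
        linarith
      · have h4 := Set.ncard_le_ncard (Set.sdiff_subset (t := {0}))
          (finite_twisted_gridPoints hpinj v hBR μd hμd hBP g (hXpos k))
        simp only [Function.comp]
        rw [hXl k, div_le_div_iff_of_pos_right (hl0 k), hncard k]
        exact_mod_cast h4
    have hsq : Tendsto (fun k => (((Z g (X k)).card : ℝ) / l k - V) ^ 2) atTop (𝓝 0) := by
      have := (hcard.sub_const V).pow 2
      simpa using this
    refine ENNReal.le_of_forall_pos_le_add fun ε hε _ => ?_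
    have hε' : (0 : ℝ) < ε / 4 := by
      have : (0 : ℝ) < ε := hε
      positivity
    have hpar := hXtop.eventually (eventually_parCount_le hpinj hd hN hNS hv μd hμd hnR.bounded
      hnR.frontier hnP (Z := Z g) (fun X hX z hz => (hZ g X hX z).mp hz) hε')
    rw [show ((ε : NNReal) : ENNReal) = ENNReal.ofReal ε by rw [ENNReal.ofReal_coe_nnreal],
      ← ENNReal.ofReal_add (by positivity) ε.coe_nonneg]
    refine limsup_le_of_le (by isBoundedDefault) ?_
    filter_upwards [hpar, hsq.eventually_le_const hε'] with k h1 h2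
    refine (hfB k g hg).trans (ENNReal.ofReal_le_ofReal ?_)
    have h3 := hVg g
    simp only [hSR, hSP] at h3
    rw [hXl k, h3] at h1
    simp only [hB]
    nlinarith
  have hΩm : MeasurableSet (ballSLS (d := d) p K₀) := measurableSet_ballSLS K₀
  have hΩ'm : MeasurableSet Ω' := measurableSet_ballSLS K₁
  have hstep : ∀ k, ∫⁻ g in ballSLS p K₀, F g ∂ρ ≤ ∫⁻ g in Ω', f k g ∂ρ := fun k =>
    setLIntegral_le_average ρ hFm hΩm hΩ'm (hGne k) fun ξ hξ g hg =>
      hK₁ (Set.mul_mem_mul hg (Set.inv_mem_inv.mpr (hσ k ξ hξ).2))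
  calc ∫⁻ g in ballSLS p K₀, F g ∂ρ
      ≤ limsup (fun k => ∫⁻ g in Ω', f k g ∂ρ) atTop :=
        le_limsup_of_frequently_le (Eventually.of_forall hstep).frequently (by isBoundedDefault)
    _ ≤ ∫⁻ g in Ω', limsup (fun k => f k g) atTop ∂ρ := by
        refine limsup_lintegral_le (fun _ => ENNReal.ofReal (2 * ((D + V) ^ 2 + D))) hfm
          (fun k => ?_) ?_
        · exact (ae_restrict_iff' hΩ'm).mpr (Eventually.of_forall fun g hg =>
            (hfB k g hg).trans (ENNReal.ofReal_le_ofReal (hunif k g hg)))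
        · rw [setLIntegral_const]
          exact ENNReal.mul_ne_top ENNReal.ofReal_ne_top (hρ K₁)
    _ ≤ ∫⁻ _ in Ω', ENNReal.ofReal (2 * parConst p d N * V) ∂ρ :=
        setLIntegral_mono' hΩ'm hlim
    _ = ENNReal.ofReal (2 * parConst p d N * (ρ Ω').toReal * V) := by
        rw [setLIntegral_const, ← ENNReal.ofReal_toReal (hρ K₁),
          ← ENNReal.ofReal_mul (by positivity),
          ENNReal.toReal_ofReal ENNReal.toReal_nonneg]
        congr 1
        ring

end Variance

section Chaining

variable {ι : Type*} [Fintype ι] [DecidableEq ι]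

/-- Truncation of the last `l` binary digits. -/
def dyadicFloor (u l : ℕ) : ℕ := u / 2 ^ l * 2 ^ l

theorem sum_dyadicFloor_sub (φ : ℕ → ℝ) (h0 : φ 0 = 0) {u L : ℕ} (hu : u < 2 ^ L) :
    φ u = ∑ l ∈ Finset.range L, (φ (dyadicFloor u l) - φ (dyadicFloor u (l + 1))) := by
  rw [Finset.sum_range_sub']
  simp [dyadicFloor, Nat.div_eq_of_lt hu, h0]

/-- The difference between the number of points in a box of increments and its volume. -/
noncomputable def boxError {α : Type*} (W : Finset α) (f : ι → α → ℕ → ℝ) (w : ι → ℕ → ℝ)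
    (a b : ι → ℕ) : ℝ :=
  ∑ x ∈ W, ∏ o, (f o x (b o) - f o x (a o)) - ∏ o, (w o (b o) - w o (a o))

theorem boxError_eq_sum {α : Type*} (W : Finset α) {f : ι → α → ℕ → ℝ} {w : ι → ℕ → ℝ}
    (hf : ∀ o x, f o x 0 = 0) (hw : ∀ o, w o 0 = 0) {u : ι → ℕ} {L : ℕ} (hu : ∀ o, u o < 2 ^ L) :
    boxError W f w 0 u = ∑ l ∈ Fintype.piFinset fun _ : ι => Finset.range L,
      boxError W f w (fun o => dyadicFloor (u o) (l o + 1)) (fun o => dyadicFloor (u o) (l o)) := by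
  have h1 : ∀ x ∈ W, ∏ o, (f o x (u o) - f o x 0) =
      ∑ l ∈ Fintype.piFinset fun _ : ι => Finset.range L,
        ∏ o, (f o x (dyadicFloor (u o) (l o)) - f o x (dyadicFloor (u o) (l o + 1))) := by
    intro x _
    rw [Finset.sum_prod_piFinset (Finset.range L)
      (fun o l => f o x (dyadicFloor (u o) l) - f o x (dyadicFloor (u o) (l + 1)))]
    refine Finset.prod_congr rfl fun o _ => ?_
    rw [hf, sub_zero, ← sum_dyadicFloor_sub _ (hf o x) (hu o)]
  have h2 : ∏ o, (w o (u o) - w o 0) = ∑ l ∈ Fintype.piFinset fun _ : ι => Finset.range L,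
        ∏ o, (w o (dyadicFloor (u o) (l o)) - w o (dyadicFloor (u o) (l o + 1))) := by
    rw [Finset.sum_prod_piFinset (Finset.range L)
      (fun o l => w o (dyadicFloor (u o) l) - w o (dyadicFloor (u o) (l + 1)))]
    refine Finset.prod_congr rfl fun o _ => ?_
    rw [hw, sub_zero, ← sum_dyadicFloor_sub _ (hw o) (hu o)]
  simp only [boxError, Pi.zero_apply]
  rw [Finset.sum_congr rfl h1, h2, Finset.sum_comm, ← Finset.sum_sub_distrib]

/-- The lower end of the `k`-th interval of level `l`. -/
def intervalLow (l k : ι → ℕ) : ι → ℕ := fun o => 2 * (k o / 2) * 2 ^ l o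

/-- The upper end of the `k`-th interval of level `l`. -/
def intervalHigh (l k : ι → ℕ) : ι → ℕ := fun o => k o * 2 ^ l o

theorem intervalLow_le (l k : ι → ℕ) : intervalLow l k ≤ intervalHigh l k := fun _ =>
  Nat.mul_le_mul_right _ (Nat.mul_div_le _ _)

theorem boxError_sq_le {α : Type*} (W : Finset α) {f : ι → α → ℕ → ℝ} {w : ι → ℕ → ℝ}
    (hf : ∀ o x, f o x 0 = 0) (hw : ∀ o, w o 0 = 0) {u : ι → ℕ} {L : ℕ} (hu : ∀ o, u o < 2 ^ L) :
    boxError W f w 0 u ^ 2 ≤ (L : ℝ) ^ Fintype.card ι *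
      ∑ l ∈ Fintype.piFinset fun _ : ι => Finset.range L,
        ∑ k ∈ Fintype.piFinset fun _ : ι => Finset.range (2 ^ L),
          boxError W f w (intervalLow l k) (intervalHigh l k) ^ 2 := by
  rw [boxError_eq_sum W hf hw hu]
  refine (sq_sum_le_card_mul_sum_sq).trans ?_
  rw [Fintype.card_piFinset]
  simp only [Finset.card_range, Finset.prod_const, Finset.card_univ, Nat.cast_pow]
  refine mul_le_mul_of_nonneg_left (Finset.sum_le_sum fun l _ => ?_) (by positivity)
  have h1 : (fun o => dyadicFloor (u o) (l o + 1)) = intervalLow l fun o => u o / 2 ^ l o := by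
    funext o
    rw [dyadicFloor, intervalLow, pow_succ, Nat.div_div_eq_div_mul]
    ring
  have h2 : (fun o => dyadicFloor (u o) (l o)) = intervalHigh l fun o => u o / 2 ^ l o := rfl
  rw [h1, h2]
  refine Finset.single_le_sum
    (f := fun k => boxError W f w (intervalLow l k) (intervalHigh l k) ^ 2)
    (fun _ _ => sq_nonneg _) ?_
  rw [Fintype.mem_piFinset]
  exact fun o => Finset.mem_range.mpr ((Nat.div_le_self _ _).trans_lt (hu o))

theorem sum_interval_le {w : ℕ → ℝ} (hw : Monotone w) (h0 : w 0 = 0) {B : ℝ} (hB : ∀ j, w j ≤ B)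
    (h K : ℕ) : ∑ k ∈ Finset.range K, (w (k * h) - w (2 * (k / 2) * h)) ≤ B := by
  rcases K with _ | K
  · simpa using h0 ▸ hB 0
  have h1 : ∀ K : ℕ, ∑ k ∈ Finset.range (K + 1), (w (k * h) - w (2 * (k / 2) * h)) ≤ w (K * h) := by
    intro K
    induction K with
    | zero => simp [h0]
    | succ K ih =>
      rw [Finset.sum_range_succ]
      have h2 : w (K * h) ≤ w (2 * ((K + 1) / 2) * h) :=
        hw (Nat.mul_le_mul_right _ (by lia))
      linarith
  exact (h1 K).trans (hB _)

theorem sum_box_volume_le {w : ι → ℕ → ℝ} (hw : ∀ o, Monotone (w o)) (h0 : ∀ o, w o 0 = 0)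
    {B : ι → ℝ} (hB : ∀ o j, w o j ≤ B o) (L : ℕ) :
    ∑ l ∈ Fintype.piFinset fun _ : ι => Finset.range L,
        ∑ k ∈ Fintype.piFinset fun _ : ι => Finset.range (2 ^ L),
          ∏ o, (w o (intervalHigh l k o) - w o (intervalLow l k o)) ≤
      (L : ℝ) ^ Fintype.card ι * ∏ o, B o := by
  have h1 : ∀ l ∈ Fintype.piFinset fun _ : ι => Finset.range L,
      ∑ k ∈ Fintype.piFinset fun _ : ι => Finset.range (2 ^ L),
          ∏ o, (w o (intervalHigh l k o) - w o (intervalLow l k o)) ≤ ∏ o, B o := by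
    intro l _
    simp only [intervalHigh, intervalLow]
    rw [Finset.sum_prod_piFinset (Finset.range (2 ^ L))
      (fun o k => w o (k * 2 ^ l o) - w o (2 * (k / 2) * 2 ^ l o))]
    refine Finset.prod_le_prod (fun o _ => Finset.sum_nonneg fun k _ => sub_nonneg.mpr
      (hw o (Nat.mul_le_mul_right _ (Nat.mul_div_le _ _)))) fun o _ =>
      sum_interval_le (hw o) (h0 o) (hB o) _ _
  refine (Finset.sum_le_sum h1).trans (le_of_eq ?_)
  rw [Finset.sum_const, Fintype.card_piFinset]
  simp

/-- A finite set of parameters can be thinned out to a short chain which approximates every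
element from both sides. -/
theorem exists_chain {v : ℝ → ℝ} (hv : Monotone v) (hv0 : v 0 = 0) (F : Finset ℝ)
    (hF : ∀ t ∈ F, 0 ≤ t) {h : ℝ} (hh : 0 < h) {K : ℕ} (hK : ∀ t ∈ F, v t ≤ h * K) :
    ∃ S : ℕ → ℝ, Monotone S ∧ S 0 = 0 ∧ (∀ j, S j = 0 ∨ S j ∈ F) ∧
      ∀ t ∈ F, ∃ j, j ≤ 2 * K + 1 ∧ S j ≤ t ∧ t ≤ S (j + 1) ∧ v (S (j + 1)) ≤ v (S j) + h := by
  classical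
  set b : ℝ → ℕ := fun t => ⌊v t / h⌋₊ with hb
  have hvpos : ∀ t ∈ F, 0 ≤ v t / h := fun t ht =>
    div_nonneg (hv0 ▸ hv (hF t ht)) hh.le
  have hble : ∀ t ∈ F, b t * h ≤ v t := fun t ht =>
    (le_div_iff₀ hh).mp (Nat.floor_le (hvpos t ht))
  have hblt : ∀ t, v t < (b t + 1) * h := fun t =>
    (div_lt_iff₀ hh).mp (Nat.lt_floor_add_one _)
  have hbmono : ∀ t t', t ≤ t' → b t ≤ b t' := fun t t' htt =>
    Nat.floor_le_floor (div_le_div_of_nonneg_right (hv htt) hh.le)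
  set key : ℝ → ℕ := fun t => if ∃ t' ∈ F, t' < t ∧ b t' = b t then 2 * b t + 1 else 2 * b t
    with hkey
  have hkey1 : ∀ t, 2 * b t ≤ key t := fun t => by simp only [hkey]; split_ifs <;> lia
  have hkey2 : ∀ t, key t ≤ 2 * b t + 1 := fun t => by simp only [hkey]; split_ifs <;> lia
  let A : ℕ → Finset ℝ := fun j => insert 0 (F.filter fun t => key t < j)
  have hne : ∀ j, (A j).Nonempty := fun j => Finset.insert_nonempty _ _
  refine ⟨fun j => (A j).max' (hne j), fun i j hij => ?_, ?_, fun j => ?_, fun t ht => ?_⟩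
  · refine Finset.max'_subset _ (Finset.insert_subset_insert _ fun t ht => ?_)
    rw [Finset.mem_filter] at ht ⊢
    exact ⟨ht.1, ht.2.trans_le hij⟩
  · simp [A]
  · have := (A j).max'_mem (hne j)
    rcases Finset.mem_insert.mp this with h1 | h1
    · exact Or.inl h1
    · exact Or.inr (Finset.mem_filter.mp h1).1
  · have hbK : b t ≤ K := by
      have h1 : v t / h ≤ K := by rw [div_le_iff₀ hh, mul_comm]; exact hK t ht
      exact Nat.floor_le_of_le h1
    refine ⟨2 * b t + 1, by lia, ?_, ?_, ?_⟩
    · refine Finset.max'_le _ _ _ fun t' ht' => ?_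
      rcases Finset.mem_insert.mp ht' with rfl | ht'
      · exact hF t ht
      obtain ⟨ht'F, hlt⟩ := Finset.mem_filter.mp ht'
      by_contra! hcon
      have h1 := hbmono _ _ hcon.le
      have h2 : b t = b t' := by have := hkey1 t'; lia
      have h3 : key t' = 2 * b t' + 1 := by
        simp only [hkey]
        rw [if_pos ⟨t, ht, hcon, h2⟩]
      lia
    · refine Finset.le_max' _ _ (Finset.mem_insert_of_mem (Finset.mem_filter.mpr ⟨ht, ?_⟩))
      have := hkey2 t
      lia
    · obtain ⟨t₁, ht₁, hmin⟩ := (F.filter fun t' => b t' = b t).exists_min_image id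
        ⟨t, Finset.mem_filter.mpr ⟨ht, rfl⟩⟩
      obtain ⟨ht₁F, hbt₁⟩ := Finset.mem_filter.mp ht₁
      have hk1 : key t₁ = 2 * b t := by
        simp only [hkey]
        rw [if_neg, hbt₁]
        rintro ⟨t', ht', hlt, hbt'⟩
        have := hmin t' (Finset.mem_filter.mpr ⟨ht', hbt'.trans hbt₁⟩)
        simp only [id] at this
        linarith
      have h1 : t₁ ≤ (A (2 * b t + 1)).max' (hne _) :=
        Finset.le_max' _ _ (Finset.mem_insert_of_mem (Finset.mem_filter.mpr ⟨ht₁F, by lia⟩))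
      have h2 : (b t : ℝ) * h ≤ v ((A (2 * b t + 1)).max' (hne _)) := by
        have h4 := hble t₁ ht₁F
        rw [hbt₁] at h4
        exact h4.trans (hv h1)
      have h3 : v ((A (2 * b t + 1 + 1)).max' (hne _)) ≤ (b t + 1) * h := by
        have hm := (A (2 * b t + 1 + 1)).max'_mem (hne _)
        rcases Finset.mem_insert.mp hm with h4 | h4
        · rw [h4, hv0]
          positivity
        · obtain ⟨-, hlt⟩ := Finset.mem_filter.mp h4
          have h5 := hkey1 ((A (2 * b t + 1 + 1)).max' (hne _))
          have h6 : b ((A (2 * b t + 1 + 1)).max' (hne _)) ≤ b t := by lia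
          refine (hblt _).le.trans ?_
          gcongr
      linarith

theorem prod_sub_prod_le {a b c : ι → ℝ} {ε : ℝ} (ha : ∀ o, 0 ≤ a o) (hb : ∀ o, b o ≤ c o)
    (hab : ∀ o, a o ≤ b o) (hε : ∀ o, b o ≤ a o + ε * c o) :
    ∏ o, b o - ∏ o, a o ≤ Fintype.card ι * ε * ∏ o, c o := by
  have key : ∀ S : Finset ι, ∏ o ∈ S, b o - ∏ o ∈ S, a o ≤ S.card * ε * ∏ o ∈ S, c o := by
    intro S
    induction S using Finset.induction_on with
    | empty => simp
    | insert o S ho ih =>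
      rw [Finset.prod_insert ho, Finset.prod_insert ho, Finset.prod_insert ho,
        Finset.card_insert_of_notMem ho]
      have h1 : 0 ≤ ∏ o ∈ S, a o := Finset.prod_nonneg fun o _ => ha o
      have h2 : ∏ o ∈ S, a o ≤ ∏ o ∈ S, c o :=
        Finset.prod_le_prod (fun o _ => ha o) fun o _ => (hab o).trans (hb o)
      have h3 : ∏ o ∈ S, b o ≤ ∏ o ∈ S, c o :=
        Finset.prod_le_prod (fun o _ => (ha o).trans (hab o)) fun o _ => hb o
      have h0b : 0 ≤ b o := (ha o).trans (hab o)
      have h4 := mul_le_mul_of_nonneg_left ih h0b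
      have h6 : 0 ≤ ∏ o ∈ S, b o - ∏ o ∈ S, a o :=
        sub_nonneg.mpr (Finset.prod_le_prod (fun o _ => ha o) fun o _ => hab o)
      have h5 : b o * (∏ o ∈ S, b o - ∏ o ∈ S, a o) ≤ c o * (S.card * ε * ∏ o ∈ S, c o) :=
        mul_le_mul (hb o) ih h6 (h0b.trans (hb o))
      have h7 : (b o - a o) * ∏ o ∈ S, a o ≤ ε * c o * ∏ o ∈ S, c o :=
        mul_le_mul (by linarith [hε o]) h2 h1 (by linarith [hε o, hab o])
      push_cast
      nlinarith
  simpa using key Finset.univ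

end Chaining

section Shells

variable {ι : Type*} [Fintype ι] [DecidableEq ι] {α : Type*}

/-- The number of points of `Λ` which at each place lie in the shell between the parameters
`a` and `b`. -/
noncomputable def shellCount (Λ : Set α) (A : ι → ℝ → Set α) (a b : ι → ℝ) : ℕ :=
  Set.ncard {x | x ∈ Λ ∧ ∀ o, x ∈ A o (b o) ∧ x ∉ A o (a o)}

/-- The difference between the number of points in a product of shells and its volume. -/
noncomputable def shellError (Λ : Set α) (A : ι → ℝ → Set α) (v : ι → ℝ → ℝ) (a b : ι → ℝ) : ℝ :=
  shellCount Λ A a b - ∏ o, (v o (b o) - v o (a o))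

/-- The sum of the squares of the errors over all dyadic intervals of a chain. -/
noncomputable def chainSum (Λ : Set α) (A : ι → ℝ → Set α) (v : ι → ℝ → ℝ) (S : ι → ℕ → ℝ)
    (L : ℕ) : ℝ :=
  (L : ℝ) ^ Fintype.card ι * ∑ l ∈ Fintype.piFinset fun _ : ι => Finset.range L,
    ∑ k ∈ Fintype.piFinset fun _ : ι => Finset.range (2 ^ L),
      shellError Λ A v (fun o => S o (intervalLow l k o)) (fun o => S o (intervalHigh l k o)) ^ 2

theorem chainSum_nonneg (Λ : Set α) (A : ι → ℝ → Set α) (v : ι → ℝ → ℝ) (S : ι → ℕ → ℝ)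
    (L : ℕ) : 0 ≤ chainSum Λ A v S L := by
  unfold chainSum
  positivity

theorem shellError_sq_le_chainSum {Λ : Set α} {A : ι → ℝ → Set α} (hA : ∀ o, Monotone (A o))
    (hA0 : ∀ o, A o 0 = ∅) (hfin : ∀ T : ι → ℝ, {x | x ∈ Λ ∧ ∀ o, x ∈ A o (T o)}.Finite)
    {v : ι → ℝ → ℝ} (hv0 : ∀ o, v o 0 = 0) {S : ι → ℕ → ℝ} (hS : ∀ o, Monotone (S o))
    (hS0 : ∀ o, S o 0 = 0) {L : ℕ} {u : ι → ℕ} (hu : ∀ o, u o < 2 ^ L) :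
    shellError Λ A v 0 (fun o => S o (u o)) ^ 2 ≤ chainSum Λ A v S L := by
  classical
  set W := (hfin fun o => S o (2 ^ L * 2 ^ L)).toFinset with hW
  set f : ι → α → ℕ → ℝ := fun o x j => if x ∈ A o (S o j) then 1 else 0 with hf
  have key : ∀ a b : ι → ℕ, a ≤ b → (∀ o, b o ≤ 2 ^ L * 2 ^ L) →
      boxError W f (fun o j => v o (S o j)) a b =
        shellError Λ A v (fun o => S o (a o)) (fun o => S o (b o)) := by
    intro a b hab hb
    rw [boxError, shellError]
    congr 1
    have h1 : ∀ x ∈ W, ∏ o, (f o x (b o) - f o x (a o)) =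
        if ∀ o, x ∈ A o (S o (b o)) ∧ x ∉ A o (S o (a o)) then 1 else 0 := by
      intro x _
      split_ifs with h
      · refine Finset.prod_eq_one fun o _ => ?_
        simp [hf, (h o).1, (h o).2]
      · push Not at h
        obtain ⟨o, ho⟩ := h
        refine Finset.prod_eq_zero (Finset.mem_univ o) ?_
        by_cases hb1 : x ∈ A o (S o (b o))
        · simp [hf, hb1, ho hb1]
        · have hb2 : x ∉ A o (S o (a o)) := fun h => hb1 (hA o (hS o (hab o)) h)
          simp [hf, hb1, hb2]
    rw [Finset.sum_congr rfl h1, Finset.sum_boole, shellCount, ← Set.ncard_coe_finset]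
    congr 2
    ext x
    simp only [hW, Finset.coe_filter, Set.Finite.mem_toFinset, Set.mem_ofPred_eq]
    exact ⟨fun h => ⟨h.1.1, h.2⟩, fun h => ⟨⟨h.1, fun o => hA o (hS o (hb o)) (h.2 o).1⟩, h.2⟩⟩
  have h0 : (fun o => S o ((0 : ι → ℕ) o)) = 0 := funext fun o => hS0 o
  have h1 := key 0 u (fun _ => Nat.zero_le _) fun o =>
    (hu o).le.trans (Nat.le_mul_of_pos_right _ (by positivity))
  rw [h0] at h1
  rw [← h1]
  refine (boxError_sq_le W (fun o x => by simp [hf, hS0, hA0])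
    (fun o => by rw [hS0, hv0]) hu).trans (le_of_eq ?_)
  rw [chainSum]
  congr 1
  refine Finset.sum_congr rfl fun l hl => Finset.sum_congr rfl fun k hk => ?_
  rw [Fintype.mem_piFinset] at hl hk
  rw [key _ _ (intervalLow_le l k) fun o => Nat.mul_le_mul (Finset.mem_range.mp (hk o)).le
    (Nat.pow_le_pow_right two_pos (Finset.mem_range.mp (hl o)).le)]

theorem shellCount_mono {Λ : Set α} {A : ι → ℝ → Set α} (hA : ∀ o, Monotone (A o))
    (hfin : ∀ T : ι → ℝ, {x | x ∈ Λ ∧ ∀ o, x ∈ A o (T o)}.Finite) (a : ι → ℝ) {b b' : ι → ℝ}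
    (hb : b ≤ b') : shellCount Λ A a b ≤ shellCount Λ A a b' :=
  Set.ncard_le_ncard (fun _ hx => ⟨hx.1, fun o => ⟨hA o (hb o) (hx.2 o).1, (hx.2 o).2⟩⟩)
    ((hfin b').subset fun _ hx => ⟨hx.1, fun o => (hx.2 o).1⟩)

theorem shellError_sq_le {Λ : Set α} {A : ι → ℝ → Set α} (hA : ∀ o, Monotone (A o))
    (hA0 : ∀ o, A o 0 = ∅) (hfin : ∀ T : ι → ℝ, {x | x ∈ Λ ∧ ∀ o, x ∈ A o (T o)}.Finite)
    {v : ι → ℝ → ℝ} (hv : ∀ o, Monotone (v o)) (hv0 : ∀ o, v o 0 = 0) {S : ι → ℕ → ℝ}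
    (hS : ∀ o, Monotone (S o)) (hS0 : ∀ o, S o 0 = 0) {L : ℕ} {u : ι → ℕ}
    (hu : ∀ o, u o + 1 < 2 ^ L) {T : ι → ℝ} (hT : ∀ o, S o (u o) ≤ T o)
    (hT' : ∀ o, T o ≤ S o (u o + 1)) {c : ι → ℝ} {ε : ℝ}
    (hc : ∀ o, v o (S o (u o + 1)) ≤ c o)
    (hε : ∀ o, v o (S o (u o + 1)) ≤ v o (S o (u o)) + ε * c o) :
    shellError Λ A v 0 T ^ 2 ≤
      2 * chainSum Λ A v S L + 2 * (Fintype.card ι * ε * ∏ o, c o) ^ 2 := by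
  have h1 := shellError_sq_le_chainSum hA hA0 hfin hv0 hS hS0
    (u := u) (fun o => (Nat.lt_succ_self _).trans (hu o))
  have h2 := shellError_sq_le_chainSum hA hA0 hfin hv0 hS hS0 (u := fun o => u o + 1) hu
  set R := chainSum Λ A v S L
  have hpos : ∀ o, 0 ≤ v o (S o (u o)) := fun o => by
    have := hv o (hS o (Nat.zero_le (u o)))
    rwa [hS0, hv0] at this
  have h3 : ∏ o, v o (S o (u o + 1)) - ∏ o, v o (S o (u o)) ≤
      Fintype.card ι * ε * ∏ o, c o :=
    prod_sub_prod_le hpos hc (fun o => hv o ((hT o).trans (hT' o))) hε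
  have h4 : ∏ o, v o (S o (u o)) ≤ ∏ o, v o (T o) :=
    Finset.prod_le_prod (fun o _ => hpos o) fun o _ => hv o (hT o)
  have h5 : ∏ o, v o (T o) ≤ ∏ o, v o (S o (u o + 1)) :=
    Finset.prod_le_prod (fun o _ => (hpos o).trans (hv o (hT o))) fun o _ => hv o (hT' o)
  have h6 : (shellCount Λ A 0 (fun o => S o (u o)) : ℝ) ≤ shellCount Λ A 0 T :=
    Nat.cast_le.mpr (shellCount_mono hA hfin 0 hT)
  have h7 : (shellCount Λ A 0 T : ℝ) ≤ shellCount Λ A 0 (fun o => S o (u o + 1)) :=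
    Nat.cast_le.mpr (shellCount_mono hA hfin 0 hT')
  simp only [shellError, Pi.zero_apply, hv0, sub_zero] at h1 h2 ⊢
  set q := (Fintype.card ι : ℝ) * ε * ∏ o, c o
  have h8 := Real.abs_le_sqrt h1
  have h9 := Real.abs_le_sqrt h2
  have hR : 0 ≤ R := chainSum_nonneg _ _ _ _ _
  rw [abs_le] at h8 h9
  have h10 : |(shellCount Λ A 0 T : ℝ) - ∏ o, v o (T o)| ≤ √R + q := by
    rw [abs_le]
    constructor <;> linarith
  have h11 : ((shellCount Λ A 0 T : ℝ) - ∏ o, v o (T o)) ^ 2 ≤ (√R + q) ^ 2 := by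
    rw [← sq_abs]
    gcongr
  nlinarith [sq_nonneg (√R - q), Real.sq_sqrt hR]

end Shells

section AlmostEverywhere

theorem lintegral_iSup_le_of_finset {G : Type*} [MeasurableSpace G] {ν : Measure G} {β : Type*}
    [Countable β] {f : β → G → ENNReal} (hf : ∀ b, Measurable (f b)) {B : ENNReal}
    (hB : ∀ E : Finset β, ∫⁻ g, ⨆ b ∈ E, f b g ∂ν ≤ B) : ∫⁻ g, ⨆ b, f b g ∂ν ≤ B := by
  have h1 : ∀ g, ⨆ b, f b g = ⨆ E : Finset β, ⨆ b ∈ E, f b g := fun g =>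
    iSup_eq_iSup_finset _
  simp_rw [h1]
  rw [lintegral_iSup_directed (f := fun (E : Finset β) g => ⨆ b ∈ E, f b g)
    (fun E => (Measurable.biSup _ E.countable_toSet fun b _ => hf b).aemeasurable)]
  · exact iSup_le hB
  · classical
    intro E E'
    exact ⟨E ∪ E', fun g => biSup_mono fun b hb => Finset.mem_union_left _ hb,
      fun g => biSup_mono fun b hb => Finset.mem_union_right _ hb⟩

variable {ι : Type*} [Fintype ι] [DecidableEq ι] {α : Type*}

theorem tsum_prod_pow_ne_top {x : ENNReal} (hx : x < 1) : ∑' J : ι → ℕ, ∏ o, x ^ J o ≠ ⊤ := by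
  have h1 : ∑' J : ι → ℕ, ∏ o, x ^ J o ≤ ((1 - x)⁻¹) ^ Fintype.card ι := by
    rw [ENNReal.tsum_eq_iSup_sum]
    refine iSup_le fun E => ?_
    obtain ⟨M, hM⟩ : ∃ M, ∀ J ∈ E, ∀ o, J o < M := by
      refine ⟨∑ J ∈ E, ∑ o, J o + 1, fun J hJ o => Nat.lt_succ_of_le ?_⟩
      exact (Finset.single_le_sum (f := fun o => J o) (fun _ _ => Nat.zero_le _)
        (Finset.mem_univ o)).trans
        (Finset.single_le_sum (f := fun J : ι → ℕ => ∑ o, J o) (fun _ _ => Nat.zero_le _) hJ)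
    calc ∑ J ∈ E, ∏ o, x ^ J o
        ≤ ∑ J ∈ Fintype.piFinset fun _ : ι => Finset.range M, ∏ o, x ^ J o :=
          Finset.sum_le_sum_of_subset fun J hJ =>
            Fintype.mem_piFinset.mpr fun o => Finset.mem_range.mpr (hM J hJ o)
      _ = ∏ _o : ι, ∑ j ∈ Finset.range M, x ^ j :=
          Finset.sum_prod_piFinset (Finset.range M) (fun _ j => x ^ j)
      _ ≤ _ := by
          rw [Finset.prod_const, Finset.card_univ, ← ENNReal.tsum_geometric]
          gcongr
          exact ENNReal.sum_le_tsum _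
  refine ne_top_of_le_ne_top (ENNReal.pow_ne_top ?_) h1
  rw [ENNReal.inv_ne_top]
  exact (tsub_pos_of_lt hx).ne'

theorem exists_pow_le_mul_pow (k : ℕ) {b : ℝ} (hb : 1 < b) :
    ∃ K : ℝ, 0 ≤ K ∧ ∀ x : ℕ, ((x : ℝ) + 3) ^ k ≤ K * b ^ x := by
  obtain ⟨K, hK⟩ := (tendsto_pow_const_div_const_pow_of_one_lt k hb).bddAbove_range
  have h1 : ∀ x : ℕ, ((x : ℝ) + 3) ^ k ≤ (K * b ^ 3) * b ^ x := by
    intro x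
    have h2 : ((x + 3 : ℕ) : ℝ) ^ k / b ^ (x + 3) ≤ K := hK ⟨x + 3, rfl⟩
    rw [div_le_iff₀ (by positivity)] at h2
    push_cast at h2
    calc ((x : ℝ) + 3) ^ k ≤ K * b ^ (x + 3) := h2
      _ = _ := by ring
  refine ⟨max (K * b ^ 3) 0, le_max_right _ _, fun x => (h1 x).trans ?_⟩
  gcongr
  exact le_max_left _ _

variable {G : Type*} [MeasurableSpace G]

/-- A random family of sets whose shells, with parameters in `P`, have a measurable number of
points in `Λ` with variance bounded by a multiple of the volume. -/
structure ShellFamily (ν : Measure G) (Λ : Set α) (A : G → ι → ℝ → Set α) (v : ι → ℝ → ℝ)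
    (P : ι → Set ℝ) (C : ℝ) : Prop where
  mono : ∀ g o, Monotone (A g o)
  zero : ∀ g o, A g o 0 = ∅
  finite : ∀ g (T : ι → ℝ), {x | x ∈ Λ ∧ ∀ o, x ∈ A g o (T o)}.Finite
  vmono : ∀ o, Monotone (v o)
  vzero : ∀ o, v o 0 = 0
  countable : ∀ o, (P o).Countable
  nonneg : ∀ o, ∀ t ∈ P o, 0 ≤ t
  meas : ∀ a b : ι → ℝ, (∀ o, a o = 0 ∨ a o ∈ P o) → (∀ o, b o = 0 ∨ b o ∈ P o) →
    Measurable fun g => (shellCount Λ (A g) a b : ℝ)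
  var : ∀ a b : ι → ℝ, (∀ o, a o = 0 ∨ a o ∈ P o) → (∀ o, b o = 0 ∨ b o ∈ P o) → a ≤ b →
    ∫⁻ g, ENNReal.ofReal (shellError Λ (A g) v a b ^ 2) ∂ν ≤
      ENNReal.ofReal (C * ∏ o, (v o (b o) - v o (a o)))

variable {ν : Measure G} {Λ : Set α} {A : G → ι → ℝ → Set α} {v : ι → ℝ → ℝ} {P : ι → Set ℝ}
  {C : ℝ}

theorem ShellFamily.measurable_shellError (h : ShellFamily ν Λ A v P C) {a b : ι → ℝ}
    (ha : ∀ o, a o = 0 ∨ a o ∈ P o) (hb : ∀ o, b o = 0 ∨ b o ∈ P o) :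
    Measurable fun g => shellError Λ (A g) v a b :=
  (h.meas a b ha hb).sub_const _

theorem ShellFamily.measurable_chainSum (h : ShellFamily ν Λ A v P C) {S : ι → ℕ → ℝ}
    (hSP : ∀ o j, S o j = 0 ∨ S o j ∈ P o) (L : ℕ) :
    Measurable fun g => chainSum Λ (A g) v S L := by
  unfold chainSum
  exact (Finset.measurable_fun_sum _ fun l _ => Finset.measurable_fun_sum _ fun k _ =>
    (h.measurable_shellError (fun o => hSP o _) fun o => hSP o _).pow_const 2).const_mul _

theorem ShellFamily.lintegral_chainSum_le (h : ShellFamily ν Λ A v P C) (hC : 0 ≤ C)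
    {S : ι → ℕ → ℝ} (hSP : ∀ o j, S o j = 0 ∨ S o j ∈ P o) (hS : ∀ o, Monotone (S o))
    (hS0 : ∀ o, S o 0 = 0) {B : ι → ℝ} (hB : ∀ o j, v o (S o j) ≤ B o) (L : ℕ) :
    ∫⁻ g, ENNReal.ofReal (chainSum Λ (A g) v S L) ∂ν ≤
      ENNReal.ofReal (C * (L : ℝ) ^ (2 * Fintype.card ι) * ∏ o, B o) := by
  have hm : ∀ l k : ι → ℕ, Measurable fun g => shellError Λ (A g) v
      (fun o => S o (intervalLow l k o)) (fun o => S o (intervalHigh l k o)) ^ 2 := fun l k =>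
    (h.measurable_shellError (fun o => hSP o _) fun o => hSP o _).pow_const 2
  have hle : ∀ (l k : ι → ℕ) (o : ι), S o (intervalLow l k o) ≤ S o (intervalHigh l k o) :=
    fun l k o => hS o (intervalLow_le l k o)
  have hnn : ∀ l k : ι → ℕ,
      0 ≤ ∏ o, (v o (S o (intervalHigh l k o)) - v o (S o (intervalLow l k o))) := fun l k =>
    Finset.prod_nonneg fun o _ => sub_nonneg.mpr (h.vmono o (hle l k o))
  have hof : ∀ g, ENNReal.ofReal (chainSum Λ (A g) v S L) =
      ENNReal.ofReal ((L : ℝ) ^ Fintype.card ι) *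
        ∑ l ∈ Fintype.piFinset fun _ : ι => Finset.range L,
          ∑ k ∈ Fintype.piFinset fun _ : ι => Finset.range (2 ^ L),
            ENNReal.ofReal (shellError Λ (A g) v
              (fun o => S o (intervalLow l k o)) (fun o => S o (intervalHigh l k o)) ^ 2) := by
    intro g
    rw [chainSum, ENNReal.ofReal_mul (by positivity),
      ENNReal.ofReal_sum_of_nonneg fun l _ => Finset.sum_nonneg fun k _ => sq_nonneg _]
    congr 1
    exact Finset.sum_congr rfl fun l _ => ENNReal.ofReal_sum_of_nonneg fun k _ => sq_nonneg _
  simp_rw [hof]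
  rw [lintegral_const_mul' _ _ ENNReal.ofReal_ne_top, lintegral_finsetSum _ fun l _ =>
    Finset.measurable_fun_sum _ fun k _ => (hm l k).ennreal_ofReal]
  have hintegral : ∀ l : ι → ℕ, ∫⁻ g, ∑ k ∈ Fintype.piFinset fun _ : ι => Finset.range (2 ^ L),
      ENNReal.ofReal (shellError Λ (A g) v (fun o => S o (intervalLow l k o))
        (fun o => S o (intervalHigh l k o)) ^ 2) ∂ν =
      ∑ k ∈ Fintype.piFinset fun _ : ι => Finset.range (2 ^ L),
        ∫⁻ g, ENNReal.ofReal (shellError Λ (A g) v (fun o => S o (intervalLow l k o))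
          (fun o => S o (intervalHigh l k o)) ^ 2) ∂ν := fun l =>
    lintegral_finsetSum _ fun k _ => (hm l k).ennreal_ofReal
  simp_rw [hintegral]
  refine (mul_le_mul' le_rfl (Finset.sum_le_sum fun l _ => Finset.sum_le_sum fun k _ =>
    h.var _ _ (fun o => hSP o _) (fun o => hSP o _) (hle l k))).trans ?_
  calc ENNReal.ofReal ((L : ℝ) ^ Fintype.card ι) *
        ∑ l ∈ Fintype.piFinset fun _ : ι => Finset.range L,
          ∑ k ∈ Fintype.piFinset fun _ : ι => Finset.range (2 ^ L), ENNReal.ofReal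
            (C * ∏ o, (v o (S o (intervalHigh l k o)) - v o (S o (intervalLow l k o))))
      = ENNReal.ofReal ((L : ℝ) ^ Fintype.card ι * (C *
        ∑ l ∈ Fintype.piFinset fun _ : ι => Finset.range L,
          ∑ k ∈ Fintype.piFinset fun _ : ι => Finset.range (2 ^ L),
            ∏ o, (v o (S o (intervalHigh l k o)) - v o (S o (intervalLow l k o))))) := by
        rw [ENNReal.ofReal_mul (by positivity)]
        congr 1
        simp_rw [Finset.mul_sum]
        rw [ENNReal.ofReal_sum_of_nonneg fun l _ => Finset.sum_nonneg fun k _ =>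
          mul_nonneg hC (hnn l k)]
        refine Finset.sum_congr rfl fun l _ => ?_
        rw [ENNReal.ofReal_sum_of_nonneg fun k _ => mul_nonneg hC (hnn l k)]
    _ ≤ _ := by
        refine ENNReal.ofReal_le_ofReal ?_
        have := sum_box_volume_le (w := fun o j => v o (S o j))
          (fun o => (h.vmono o).comp (hS o)) (fun o => by rw [hS0, h.vzero]) hB L
        calc (L : ℝ) ^ Fintype.card ι * (C * _)
            ≤ (L : ℝ) ^ Fintype.card ι * (C * ((L : ℝ) ^ Fintype.card ι * ∏ o, B o)) := by gcongr
          _ = _ := by ring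

theorem ShellFamily.lintegral_biSup_le [IsFiniteMeasure ν] (h : ShellFamily ν Λ A v P C)
    (hC : 0 ≤ C) {c : ι → ℝ} (hc : ∀ o, 0 < c o) :
    ∃ K : ℝ, 0 ≤ K ∧ ∀ (J : ι → ℕ) (E : Finset (ι → ℝ)),
      (∀ T ∈ E, ∀ o, T o ∈ P o ∧ v o (T o) ≤ c o * 2 ^ (J o + 1)) →
      ∫⁻ g, ⨆ T ∈ E, ENNReal.ofReal (shellError Λ (A g) v 0 T ^ 2) ∂ν ≤
        ENNReal.ofReal (K * ((∑ o, J o : ℕ) + 3 : ℝ) ^ (2 * Fintype.card ι) * 2 ^ (∑ o, J o)) := by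
  set r := Fintype.card ι with hr
  set q : ℝ := r * (2 ^ r * ∏ o, c o) with hq
  have hcp : 0 < ∏ o, c o := Finset.prod_pos fun o _ => hc o
  refine ⟨2 * C * (2 ^ r * ∏ o, c o) + 2 * q ^ 2 * ν.real Set.univ, by positivity,
    fun J E hE => ?_⟩
  set I := ∑ o, J o with hI
  set B : ι → ℝ := fun o => c o * 2 ^ (J o + 1) with hB
  have hBpos : ∀ o, 0 < B o := fun o => mul_pos (hc o) (by positivity)
  have hBprod : ∏ o, B o = 2 ^ I * (2 ^ r * ∏ o, c o) := by
    simp only [hB, pow_succ, Finset.prod_mul_distrib, Finset.prod_const, Finset.card_univ,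
      Finset.prod_pow_eq_pow_sum]
    ring
  have hch : ∀ o, ∃ S : ℕ → ℝ, Monotone S ∧ S 0 = 0 ∧
      (∀ j, S j = 0 ∨ S j ∈ E.image fun T => T o) ∧
      ∀ t ∈ E.image fun T => T o, ∃ j, j ≤ 2 * 2 ^ I + 1 ∧ S j ≤ t ∧ t ≤ S (j + 1) ∧
        v o (S (j + 1)) ≤ v o (S j) + (2 ^ I)⁻¹ * B o := by
    intro o
    refine exists_chain (h.vmono o) (h.vzero o) _ (fun t ht => ?_)
      (mul_pos (by positivity) (hBpos o)) (fun t ht => ?_)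
    · obtain ⟨T, hT, rfl⟩ := Finset.mem_image.mp ht
      exact h.nonneg o _ (hE T hT o).1
    · obtain ⟨T, hT, rfl⟩ := Finset.mem_image.mp ht
      refine (hE T hT o).2.trans (le_of_eq ?_)
      push_cast
      field_simp
      rfl
  choose S hS hS0 hSE hSj using hch
  have hSP : ∀ o j, S o j = 0 ∨ S o j ∈ P o := fun o j => (hSE o j).imp_right fun h1 => by
    obtain ⟨T, hT, h2⟩ := Finset.mem_image.mp h1
    exact h2 ▸ (hE T hT o).1
  have hSB : ∀ o j, v o (S o j) ≤ B o := fun o j => by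
    rcases hSE o j with h1 | h1
    · rw [h1, h.vzero]
      exact (hBpos o).le
    · obtain ⟨T, hT, h2⟩ := Finset.mem_image.mp h1
      exact h2 ▸ (hE T hT o).2
  have hpt : ∀ g, ⨆ T ∈ E, ENNReal.ofReal (shellError Λ (A g) v 0 T ^ 2) ≤
      2 * ENNReal.ofReal (chainSum Λ (A g) v S (I + 3)) + ENNReal.ofReal (2 * q ^ 2) := by
    intro g
    refine iSup₂_le fun T hT => ?_
    choose u hu hu1 hu2 hu3 using fun o => hSj o (T o) (Finset.mem_image_of_mem _ hT)
    have h1 := shellError_sq_le (h.mono g) (h.zero g) (h.finite g) h.vmono h.vzero hS hS0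
      (L := I + 3) (u := u) (fun o => by
        have := hu o
        have h2 : 2 ^ (I + 3) = 8 * 2 ^ I := by ring
        have h3 := Nat.one_le_two_pow (n := I)
        lia) hu1 hu2 (fun o => hSB o _) hu3
    have h2 : (Fintype.card ι : ℝ) * (2 ^ I)⁻¹ * ∏ o, B o = q := by
      rw [hBprod, hq, ← hr]
      field_simp
    rw [h2] at h1
    refine (ENNReal.ofReal_le_ofReal h1).trans (le_of_eq ?_)
    rw [ENNReal.ofReal_add (mul_nonneg two_pos.le (chainSum_nonneg _ _ _ _ _)) (by positivity),
      ENNReal.ofReal_mul two_pos.le, ENNReal.ofReal_ofNat]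
  have hM := (h.measurable_chainSum hSP (I + 3)).ennreal_ofReal
  have h3 := h.lintegral_chainSum_le hC hSP hS hS0 hSB (I + 3)
  have hBnn : 0 ≤ ∏ o, B o := Finset.prod_nonneg fun o _ => (hBpos o).le
  calc ∫⁻ g, ⨆ T ∈ E, ENNReal.ofReal (shellError Λ (A g) v 0 T ^ 2) ∂ν
      ≤ ∫⁻ g, (2 * ENNReal.ofReal (chainSum Λ (A g) v S (I + 3)) +
          ENNReal.ofReal (2 * q ^ 2)) ∂ν := lintegral_mono hpt
    _ = 2 * ∫⁻ g, ENNReal.ofReal (chainSum Λ (A g) v S (I + 3)) ∂ν +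
          ENNReal.ofReal (2 * q ^ 2) * ν Set.univ := by
        rw [lintegral_add_right _ measurable_const, lintegral_const_mul _ hM, lintegral_const]
    _ ≤ 2 * ENNReal.ofReal (C * ((I + 3 : ℕ) : ℝ) ^ (2 * Fintype.card ι) * ∏ o, B o) +
          ENNReal.ofReal (2 * q ^ 2) * ENNReal.ofReal (ν.real Set.univ) := by
        gcongr
        rw [ofReal_measureReal]
    _ = ENNReal.ofReal (2 * (C * ((I + 3 : ℕ) : ℝ) ^ (2 * r) * ∏ o, B o) +
          2 * q ^ 2 * ν.real Set.univ) := by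
        rw [ENNReal.ofReal_add (by positivity) (by positivity)]
        congr 1
        · rw [ENNReal.ofReal_mul two_pos.le, ENNReal.ofReal_ofNat]
        · exact (ENNReal.ofReal_mul (by positivity)).symm
    _ ≤ _ := by
        refine ENNReal.ofReal_le_ofReal ?_
        rw [hBprod]
        push_cast
        have h5 : (1 : ℝ) ≤ (I + 3 : ℝ) ^ (2 * r) * 2 ^ I :=
          one_le_mul_of_one_le_of_one_le (one_le_pow₀ (by linarith [Nat.cast_nonneg (α := ℝ) I]))
            (one_le_pow₀ one_le_two)
        have h6 : 0 ≤ 2 * q ^ 2 * ν.real Set.univ := by positivity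
        nlinarith [mul_le_mul_of_nonneg_left h5 h6]

end AlmostEverywhere

section AlmostEverywhere

variable {ι : Type*} [Fintype ι] [DecidableEq ι] {α : Type*} {G : Type*} [MeasurableSpace G]
  {ν : Measure G} {Λ : Set α} {A : G → ι → ℝ → Set α} {v : ι → ℝ → ℝ} {P : ι → Set ℝ} {C : ℝ}

theorem ShellFamily.lintegral_iSup_le [IsFiniteMeasure ν] (h : ShellFamily ν Λ A v P C)
    (hC : 0 ≤ C) {c : ι → ℝ} (hc : ∀ o, 0 < c o) :
    ∃ K : ℝ, 0 ≤ K ∧ ∀ J : ι → ℕ,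
      Measurable (fun g => ⨆ T : {T : ι → ℝ // ∀ o, T o ∈ P o ∧ v o (T o) ≤ c o * 2 ^ (J o + 1)},
        ENNReal.ofReal (shellError Λ (A g) v 0 T ^ 2)) ∧
      ∫⁻ g, ⨆ T : {T : ι → ℝ // ∀ o, T o ∈ P o ∧ v o (T o) ≤ c o * 2 ^ (J o + 1)},
        ENNReal.ofReal (shellError Λ (A g) v 0 T ^ 2) ∂ν ≤
        ENNReal.ofReal (K * ((∑ o, J o : ℕ) + 3 : ℝ) ^ (2 * Fintype.card ι) * 2 ^ (∑ o, J o)) := by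
  obtain ⟨K, hK, hKJ⟩ := h.lintegral_biSup_le hC hc
  refine ⟨K, hK, fun J => ?_⟩
  have hcount : {T : ι → ℝ | ∀ o, T o ∈ P o ∧ v o (T o) ≤ c o * 2 ^ (J o + 1)}.Countable :=
    (Set.countable_pi h.countable).mono fun T hT o => (hT o).1
  have : Countable {T : ι → ℝ // ∀ o, T o ∈ P o ∧ v o (T o) ≤ c o * 2 ^ (J o + 1)} :=
    hcount.to_subtype
  have hmeas : ∀ T : {T : ι → ℝ // ∀ o, T o ∈ P o ∧ v o (T o) ≤ c o * 2 ^ (J o + 1)},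
      Measurable fun g => ENNReal.ofReal (shellError Λ (A g) v 0 T ^ 2) := fun T =>
    ((h.measurable_shellError (fun o => Or.inl rfl) fun o => Or.inr (T.2 o).1).pow_const
      2).ennreal_ofReal
  refine ⟨Measurable.iSup hmeas, lintegral_iSup_le_of_finset hmeas fun E => ?_⟩
  refine le_trans (lintegral_mono fun g => ?_) (hKJ J (E.image Subtype.val) fun T hT => ?_)
  · exact iSup₂_le fun T hT => le_iSup₂_of_le T.1 (Finset.mem_image_of_mem _ hT) le_rfl
  · obtain ⟨T', -, rfl⟩ := Finset.mem_image.mp hT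
    exact T'.2

theorem ShellFamily.ae_discrepancy [IsFiniteMeasure ν] (h : ShellFamily ν Λ A v P C)
    (hC : 0 ≤ C) {c : ι → ℝ} (hc : ∀ o, 0 < c o) (hcv : ∀ o, ∀ t ∈ P o, c o ≤ v o t) {δ : ℝ}
    (hδ : 1 / 2 < δ) :
    ∀ᵐ g ∂ν, ∃ C' : ℝ, 0 ≤ C' ∧ ∀ T : ι → ℝ, (∀ o, T o ∈ P o) →
      |shellError Λ (A g) v 0 T| ≤ C' * (∏ o, v o (T o)) ^ δ := by
  obtain ⟨K, hK, hKJ⟩ := h.lintegral_iSup_le hC hc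
  set X : (ι → ℕ) → G → ENNReal := fun J g =>
    ⨆ T : {T : ι → ℝ // ∀ o, T o ∈ P o ∧ v o (T o) ≤ c o * 2 ^ (J o + 1)},
        ENNReal.ofReal (shellError Λ (A g) v 0 T ^ 2) with hX
  obtain ⟨K₂, hK₂, hpow⟩ := exists_pow_le_mul_pow (2 * Fintype.card ι)
    (b := (2 : ℝ) ^ (δ - 1 / 2)) (Real.one_lt_rpow one_lt_two (by linarith))
  set y : ℝ := (2 : ℝ) ^ (-(2 * δ)) with hy
  have hypos : 0 < y := Real.rpow_pos_of_pos two_pos _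
  set x : ℝ := (2 : ℝ) ^ (1 / 2 - δ) with hx
  have hxpos : 0 < x := Real.rpow_pos_of_pos two_pos _
  have hx1 : x < 1 := Real.rpow_lt_one_of_one_lt_of_neg one_lt_two (by linarith)
  have hyx : y * ((2 : ℝ) ^ (δ - 1 / 2) * 2) = x := by
    rw [hy, hx]
    rw [← Real.rpow_add_one two_ne_zero, ← Real.rpow_add two_pos]
    congr 1
    ring
  have hle : ∀ J : ι → ℕ, ENNReal.ofReal (y ^ (∑ o, J o)) * ∫⁻ g, X J g ∂ν ≤
      ENNReal.ofReal (K * K₂) * ∏ o, ENNReal.ofReal x ^ J o := by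
    intro J
    rw [Finset.prod_pow_eq_pow_sum, ← ENNReal.ofReal_pow hxpos.le,
      ← ENNReal.ofReal_mul (mul_nonneg hK hK₂)]
    refine (mul_le_mul' le_rfl (hKJ J).2).trans ?_
    rw [← ENNReal.ofReal_mul (by positivity)]
    refine ENNReal.ofReal_le_ofReal ?_
    have h1 := hpow (∑ o, J o)
    calc y ^ (∑ o, J o) * (K * ((∑ o, J o : ℕ) + 3 : ℝ) ^ (2 * Fintype.card ι) * 2 ^ (∑ o, J o))
        ≤ y ^ (∑ o, J o) * (K * (K₂ * ((2 : ℝ) ^ (δ - 1 / 2)) ^ (∑ o, J o)) *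
          2 ^ (∑ o, J o)) := by gcongr
      _ = K * K₂ * (y * ((2 : ℝ) ^ (δ - 1 / 2) * 2)) ^ (∑ o, J o) := by
          rw [mul_pow, mul_pow]
          ring
      _ = _ := by rw [hyx]
  have hXm : ∀ J, Measurable fun g => ENNReal.ofReal (y ^ (∑ o, J o)) * X J g := fun J =>
    (hKJ J).1.const_mul _
  have hintegral : ∫⁻ g, ∑' J : ι → ℕ, ENNReal.ofReal (y ^ (∑ o, J o)) * X J g ∂ν ≠ ⊤ := by
    rw [lintegral_tsum fun J => (hXm J).aemeasurable]
    simp_rw [lintegral_const_mul' _ _ ENNReal.ofReal_ne_top]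
    refine ne_top_of_le_ne_top ?_ (ENNReal.tsum_le_tsum hle)
    rw [ENNReal.tsum_mul_left]
    exact ENNReal.mul_ne_top ENNReal.ofReal_ne_top
      (tsum_prod_pow_ne_top (by rwa [ENNReal.ofReal_lt_one]))
  filter_upwards [ae_lt_top (Measurable.tsum hXm) hintegral] with g hg
  set θ := ∑' J : ι → ℕ, ENNReal.ofReal (y ^ (∑ o, J o)) * X J g with hθ
  have hcp : 0 < ∏ o, c o := Finset.prod_pos fun o _ => hc o
  refine ⟨√θ.toReal / (∏ o, c o) ^ δ, by positivity, fun T hT => ?_⟩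
  choose J hJ1 hJ2 using fun o => exists_nat_pow_near (x := v o (T o) / c o) (y := 2)
    ((one_le_div (hc o)).mpr (hcv o _ (hT o))) one_lt_two
  have h1 : ENNReal.ofReal (y ^ (∑ o, J o) * shellError Λ (A g) v 0 T ^ 2) ≤ θ := by
    rw [ENNReal.ofReal_mul (by positivity)]
    refine le_trans (mul_le_mul' le_rfl ?_) (ENNReal.le_tsum J)
    refine le_iSup_of_le ⟨T, fun o => ⟨hT o, ?_⟩⟩ le_rfl
    have := (hJ2 o).le
    rwa [div_le_iff₀ (hc o), mul_comm] at this
  have h2 : y ^ (∑ o, J o) * shellError Λ (A g) v 0 T ^ 2 ≤ θ.toReal := by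
    rwa [← ENNReal.ofReal_le_iff_le_toReal hg.ne]
  set q := (∏ o, v o (T o)) / ∏ o, c o with hq
  have hvpos : ∀ o, 0 < v o (T o) := fun o => (hc o).trans_le (hcv o _ (hT o))
  have hqpos : 0 < q := div_pos (Finset.prod_pos fun o _ => hvpos o) hcp
  have h3 : (2 : ℝ) ^ (∑ o, J o) ≤ q := by
    rw [hq, ← Finset.prod_div_distrib, ← Finset.prod_pow_eq_pow_sum]
    exact Finset.prod_le_prod (fun o _ => by positivity) fun o _ => hJ1 o
  have h4 : (y ^ (∑ o, J o))⁻¹ ≤ (q ^ δ) ^ 2 := by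
    have h5 : (y ^ (∑ o, J o))⁻¹ = ((2 : ℝ) ^ (∑ o, J o)) ^ (2 * δ) := by
      rw [hy, Real.rpow_neg two_pos.le, inv_pow, inv_inv, ← Real.rpow_natCast,
        ← Real.rpow_natCast, ← Real.rpow_mul two_pos.le, ← Real.rpow_mul two_pos.le, mul_comm]
    have h6 : (q ^ δ) ^ 2 = q ^ (2 * δ) := by
      rw [← Real.rpow_natCast, ← Real.rpow_mul hqpos.le, mul_comm]
      norm_num
    rw [h5, h6]
    exact Real.rpow_le_rpow (by positivity) h3 (by linarith)
  have h7 : shellError Λ (A g) v 0 T ^ 2 ≤ (√θ.toReal * q ^ δ) ^ 2 := by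
    rw [mul_pow, Real.sq_sqrt ENNReal.toReal_nonneg]
    calc shellError Λ (A g) v 0 T ^ 2
        = (y ^ (∑ o, J o) * shellError Λ (A g) v 0 T ^ 2) * (y ^ (∑ o, J o))⁻¹ := by
          field_simp
      _ ≤ θ.toReal * (q ^ δ) ^ 2 := by gcongr
  refine (abs_le_of_sq_le_sq h7 (by positivity)).trans (le_of_eq ?_)
  rw [hq, Real.div_rpow (Finset.prod_nonneg fun o _ => (hvpos o).le) hcp.le]
  ring

end AlmostEverywhere

section Regions

/-- The local factor of the region `E_φ(t)`. -/
def localRegion (𝕜 : Type*) [NormedField 𝕜] (m n : ℕ) (φ : ℝ → ℝ) (t : ℝ) :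
    Set (Fin (m + n) → 𝕜) :=
  {z | ‖fun a : Fin m => z (Fin.castAdd n a)‖ ^ m ≤ φ (‖fun b : Fin n => z (Fin.natAdd m b)‖ ^ n) ∧
    ‖fun b : Fin n => z (Fin.natAdd m b)‖ ^ n ≤ t}

/-- The local region, replaced by the empty set for `t < 1`. -/
def truncRegion (𝕜 : Type*) [NormedField 𝕜] (m n : ℕ) (φ : ℝ → ℝ) (t : ℝ) :
    Set (Fin (m + n) → 𝕜) := {z | 1 ≤ t ∧ z ∈ localRegion 𝕜 m n φ t}

variable {𝕜 : Type*} [NormedField 𝕜] {m n : ℕ} {φ : ℝ → ℝ}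

theorem truncRegion_of_one_le {t : ℝ} (ht : 1 ≤ t) :
    truncRegion 𝕜 m n φ t = localRegion 𝕜 m n φ t := by
  ext z
  simp [truncRegion, ht]

theorem truncRegion_of_lt_one {t : ℝ} (ht : t < 1) : truncRegion 𝕜 m n φ t = ∅ := by
  ext z
  simp [truncRegion, ht]

theorem localRegion_mono : Monotone (localRegion 𝕜 m n φ) :=
  fun _ _ h _ hz => ⟨hz.1, hz.2.trans h⟩

theorem truncRegion_mono : Monotone (truncRegion 𝕜 m n φ) :=
  fun _ _ h _ hz => ⟨hz.1.trans h, localRegion_mono h hz.2⟩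

theorem norm_le_of_mem_localRegion (hm : 0 < m) (hn : 0 < n) (hφ1 : ∀ t, φ t ≤ 1) {t : ℝ}
    {z : Fin (m + n) → 𝕜} (hz : z ∈ localRegion 𝕜 m n φ t) (j : Fin (m + n)) :
    ‖z j‖ ≤ max 1 t := by
  have key : ∀ {k : ℕ} {x c : ℝ}, 0 < k → 0 ≤ x → x ^ k ≤ c → x ≤ max 1 c := by
    intro k x c hk hx h
    rcases le_total x 1 with h1 | h1
    · exact h1.trans (le_max_left _ _)
    · exact ((le_self_pow₀ h1 hk.ne').trans h).trans (le_max_right _ _)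
  induction j using Fin.addCases with
  | left a =>
    refine (norm_le_pi_norm (fun a : Fin m => z (Fin.castAdd n a)) a).trans ?_
    have := key hm (norm_nonneg _) (hz.1.trans (hφ1 _))
    exact this.trans (by simp)
  | right b =>
    exact (norm_le_pi_norm (fun b : Fin n => z (Fin.natAdd m b)) b).trans
      (key hn (norm_nonneg _) hz.2)

theorem mem_localRegion_of_norm_le (hφ : Antitone φ) {t : ℝ} {x z : Fin (m + n) → 𝕜}
    (hz : z ∈ localRegion 𝕜 m n φ t) (hx : ∀ j, ‖x j‖ ≤ ‖z j‖) : x ∈ localRegion 𝕜 m n φ t := by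
  have h1 : ‖fun a : Fin m => x (Fin.castAdd n a)‖ ≤ ‖fun a : Fin m => z (Fin.castAdd n a)‖ :=
    (pi_norm_le_iff_of_nonneg (norm_nonneg _)).mpr fun a => (hx _).trans
      (norm_le_pi_norm (fun a : Fin m => z (Fin.castAdd n a)) a)
  have h2 : ‖fun b : Fin n => x (Fin.natAdd m b)‖ ≤ ‖fun b : Fin n => z (Fin.natAdd m b)‖ :=
    (pi_norm_le_iff_of_nonneg (norm_nonneg _)).mpr fun b => (hx _).trans
      (norm_le_pi_norm (fun b : Fin n => z (Fin.natAdd m b)) b)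
  have h3 := pow_le_pow_left₀ (norm_nonneg _) h2 n
  exact ⟨((pow_le_pow_left₀ (norm_nonneg _) h1 m).trans hz.1).trans (hφ h3), h3.trans hz.2⟩

/-- A bounded set which is closed under decreasing the absolute values of the coordinates has
a boundary of measure zero. -/
theorem volume_frontier_of_solid {d : ℕ} {A : Set (Fin d → ℝ)} (hb : Bornology.IsBounded A)
    (hA : ∀ x z : Fin d → ℝ, z ∈ A → (∀ j, |x j| ≤ |z j|) → x ∈ A) : volume (frontier A) = 0 := by
  have hH : volume (⋃ j, {z : Fin d → ℝ | z j = 0}) = 0 := by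
    refine measure_iUnion_null fun j => ?_
    have h1 := Measure.addHaar_affineSubspace (volume : Measure (Fin d → ℝ))
      (LinearMap.ker (LinearMap.proj (R := ℝ) (φ := fun _ : Fin d => ℝ) j)).toAffineSubspace
      (fun h => by
        have : (fun _ => 1 : Fin d → ℝ) ∈ (LinearMap.ker (LinearMap.proj (R := ℝ)
          (φ := fun _ : Fin d => ℝ) j)).toAffineSubspace := h ▸ AffineSubspace.mem_top _ _ _
        simp at this)
    convert h1 using 2
    ext z
    simp
  have hfin : volume (closure A) ≠ ⊤ := hb.closure.measure_lt_top.ne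
  have hsub : ∀ r : ℝ, 0 < r → r < 1 →
      closure A \ (⋃ j, {z : Fin d → ℝ | z j = 0}) ⊆ (r • ·) ⁻¹' interior A := by
    rintro r hr0 hr1 z ⟨hz, hz0⟩
    have hz0' : ∀ j, 0 < |z j| := fun j =>
      abs_pos.mpr fun h => hz0 (Set.mem_iUnion.mpr ⟨j, h⟩)
    obtain ⟨r', hr', hr'1⟩ := exists_between hr1
    have hU : IsOpen {a : Fin d → ℝ | ∀ j, r' * |z j| < |a j|} := by
      rw [Set.ofPred_forall]
      exact isOpen_iInter_of_finite fun j =>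
        isOpen_lt continuous_const ((continuous_apply j).abs)
    obtain ⟨a, haU, haA⟩ := mem_closure_iff.mp hz _ hU fun j => by nlinarith [hz0' j]
    have hV : IsOpen {x : Fin d → ℝ | ∀ j, |x j| < r' * |z j|} := by
      rw [Set.ofPred_forall]
      exact isOpen_iInter_of_finite fun j =>
        isOpen_lt ((continuous_apply j).abs) continuous_const
    refine mem_interior.mpr ⟨_, fun x hx => hA x a haA fun j =>
      ((hx j).trans (haU j)).le, hV, fun j => ?_⟩
    change |r * z j| < r' * |z j|
    rw [abs_mul, abs_of_pos hr0]
    nlinarith [hz0' j]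
  have hle : ∀ r : ℝ, 0 < r → r < 1 →
      volume (closure A) ≤ ENNReal.ofReal ((r ^ d)⁻¹) * volume (interior A) := by
    intro r hr0 hr1
    calc volume (closure A) ≤ volume ((closure A \ ⋃ j, {z : Fin d → ℝ | z j = 0}) ∪
          ⋃ j, {z : Fin d → ℝ | z j = 0}) := measure_mono (by simp)
      _ ≤ volume (closure A \ ⋃ j, {z : Fin d → ℝ | z j = 0}) + 0 := by
          rw [← hH]
          exact measure_union_le _ _
      _ ≤ volume ((r • ·) ⁻¹' interior A) := by
          rw [add_zero]
          exact measure_mono (hsub r hr0 hr1)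
      _ = _ := by
          rw [Measure.addHaar_preimage_smul _ hr0.ne']
          simp [abs_of_pos hr0]
  have hlim : volume (closure A) ≤ volume (interior A) := by
    have h1 : Tendsto (fun r : ℝ => ENNReal.ofReal ((r ^ d)⁻¹) * volume (interior A)) (𝓝[<] 1)
        (𝓝 (ENNReal.ofReal (((1 : ℝ) ^ d)⁻¹) * volume (interior A))) := by
      refine ENNReal.Tendsto.mul_const ?_ (Or.inl (by simp))
      refine ENNReal.tendsto_ofReal ?_
      exact (((continuous_pow d).tendsto 1).inv₀ (by simp)).mono_left nhdsWithin_le_nhds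
    simp only [one_pow, inv_one, ENNReal.ofReal_one, one_mul] at h1
    refine ge_of_tendsto h1 ?_
    filter_upwards [Ioo_mem_nhdsLT zero_lt_one] with r hr using hle r hr.1 hr.2
  rw [frontier, measure_sdiff interior_subset_closure isOpen_interior.nullMeasurableSet
    (ne_top_of_le_ne_top hfin (measure_mono interior_subset_closure)), tsub_eq_zero_of_le hlim]

theorem RealNice.diff {d : ℕ} {A B : Set (Fin d → ℝ)} (hA : RealNice A) (hB : RealNice B) :
    RealNice (A \ B) where
  bounded := hA.bounded.subset Set.sdiff_subset
  measurable := hA.measurable.diff hB.measurable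
  frontier := by
    refine measure_mono_null ?_ (measure_union_null hA.frontier hB.frontier)
    rw [Set.sdiff_eq]
    refine (frontier_inter_subset _ _).trans (Set.union_subset_union Set.inter_subset_left ?_)
    rw [frontier_compl]
    exact Set.inter_subset_right

theorem realNice_truncRegion (hm : 0 < m) (hn : 0 < n) (hφ : Antitone φ) (hφ1 : ∀ t, φ t ≤ 1)
    (t : ℝ) : RealNice (truncRegion ℝ m n φ t) := by
  rcases lt_or_ge t 1 with ht | ht
  · rw [truncRegion_of_lt_one ht]
    exact ⟨Bornology.isBounded_empty, MeasurableSet.empty, by simp⟩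
  rw [truncRegion_of_one_le ht]
  have hb : Bornology.IsBounded (localRegion ℝ m n φ t) := by
    rw [isBounded_iff_forall_norm_le]
    exact ⟨max 1 t, fun z hz => (pi_norm_le_iff_of_nonneg (zero_le_one.trans
      (le_max_left _ _))).mpr (norm_le_of_mem_localRegion hm hn hφ1 hz)⟩
  refine ⟨hb, ?_, volume_frontier_of_solid hb fun x z hz hx => mem_localRegion_of_norm_le hφ hz hx⟩
  have h1 : Measurable fun z : Fin (m + n) → ℝ => ‖fun a : Fin m => z (Fin.castAdd n a)‖ ^ m :=
    ((measurable_pi_lambda _ fun a => measurable_pi_apply _).norm).pow_const m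
  have h2 : Measurable fun z : Fin (m + n) → ℝ => ‖fun b : Fin n => z (Fin.natAdd m b)‖ ^ n :=
    ((measurable_pi_lambda _ fun b => measurable_pi_apply _).norm).pow_const n
  exact (measurableSet_le h1 (hφ.measurable.comp h2)).inter (measurableSet_le h2 measurable_const)

end Regions

section PadicRegions

variable {m n : ℕ} {φ : ℝ → ℝ} {q : ℕ} [hq : Fact q.Prime]

theorem padic_pi_norm_add_eq {k : ℕ} {x y : Fin k → ℚ_[q]} (hy : ‖y‖ ≤ 1) (hx : 1 < ‖x‖) :
    ‖x + y‖ = ‖x‖ := by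
  have h1 : ‖x + y‖ ≤ max ‖x‖ ‖y‖ := IsUltrametricDist.norm_add_le_max _ _
  have h2 := IsUltrametricDist.norm_add_le_max (x + y) (-y)
  rw [add_neg_cancel_right, norm_neg] at h2
  refine le_antisymm (h1.trans (max_le le_rfl (hy.trans hx.le))) ?_
  rcases le_max_iff.mp h2 with h | h
  · exact h
  · linarith

variable [MeasurableSpace ℚ_[q]] [BorelSpace ℚ_[q]]

theorem padicNice_localShell (hm : 0 < m) (hn : 0 < n) (hφ : Antitone φ)
    (hφ1 : ∀ t, t ≤ 1 → φ t = 1) (hφ0 : ∀ t, 0 < φ t) (μ : Measure (Fin (m + n) → ℚ_[q]))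
    [μ.IsAddHaarMeasure]
    (hμ : μ {y | ∀ j, ‖y j‖ ≤ 1} = 1) {a b : ℝ} (hb : 1 ≤ b) (ha : a < 0 ∨ 1 ≤ a) :
    PadicNice μ {z | z ∈ localRegion ℚ_[q] m n φ b ∧
      a < ‖fun b : Fin n => z (Fin.natAdd m b)‖ ^ n} := by
  have hφle : ∀ t, φ t ≤ 1 := fun t => by
    rcases le_total t 1 with h | h
    · exact (hφ1 t h).le
    · exact (hφ h).trans (hφ1 1 le_rfl).le
  have hq1 : (1 : ℝ) < q := by exact_mod_cast hq.out.one_lt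
  have htrans : ∃ k : ℕ, ∀ x ∈ {z | z ∈ localRegion ℚ_[q] m n φ b ∧
      a < ‖fun b : Fin n => z (Fin.natAdd m b)‖ ^ n}, ∀ y ∈ padicBall q (m + n) k,
      x + y ∈ {z | z ∈ localRegion ℚ_[q] m n φ b ∧
        a < ‖fun b : Fin n => z (Fin.natAdd m b)‖ ^ n} := by
    obtain ⟨k, hk⟩ := exists_pow_lt_of_lt_one (hφ0 b) (inv_lt_one_of_one_lt₀ hq1)
    have hk' : (q : ℝ) ^ (-(k : ℤ)) = (q : ℝ)⁻¹ ^ k := by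
      rw [_root_.zpow_neg, zpow_natCast, inv_pow]
    have hk1 : (q : ℝ)⁻¹ ^ k ≤ 1 := hk.le.trans (hφle b)
    refine ⟨k, fun z hz y hy => ?_⟩
    rw [mem_padicBall, hk'] at hy
    have hk0 : 0 ≤ (q : ℝ)⁻¹ ^ k := by positivity
    have hy1 : ‖fun a : Fin m => y (Fin.castAdd n a)‖ ≤ (q : ℝ)⁻¹ ^ k :=
      (pi_norm_le_iff_of_nonneg hk0).mpr fun a => hy _
    have hy2 : ‖fun b : Fin n => y (Fin.natAdd m b)‖ ≤ 1 :=
      (pi_norm_le_iff_of_nonneg zero_le_one).mpr fun a => (hy _).trans hk1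
    obtain ⟨⟨hz1, hz2⟩, hz3⟩ := hz
    have hadd1 : (fun a : Fin m => (z + y) (Fin.castAdd n a)) =
      (fun a : Fin m => z (Fin.castAdd n a)) + fun a : Fin m => y (Fin.castAdd n a) := rfl
    have hadd2 : (fun b : Fin n => (z + y) (Fin.natAdd m b)) =
      (fun b : Fin n => z (Fin.natAdd m b)) + fun b : Fin n => y (Fin.natAdd m b) := rfl
    simp only [localRegion, Set.mem_ofPred_eq, hadd1, hadd2]
    set x1 := fun a : Fin m => z (Fin.castAdd n a)
    set x2 := fun b : Fin n => z (Fin.natAdd m b)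
    set y1 := fun a : Fin m => y (Fin.castAdd n a)
    set y2 := fun b : Fin n => y (Fin.natAdd m b)
    have hφb : ‖y1‖ ^ m ≤ φ (‖x2‖ ^ n) :=
      ((pow_le_of_le_one (norm_nonneg _) (hy1.trans hk1) hm.ne').trans (hy1.trans hk.le)).trans
        (hφ hz2)
    have hx1 : ‖x1 + y1‖ ^ m ≤ φ (‖x2‖ ^ n) := by
      rcases le_max_iff.mp (IsUltrametricDist.norm_add_le_max x1 y1) with h | h
      · exact (pow_le_pow_left₀ (norm_nonneg _) h m).trans hz1
      · exact (pow_le_pow_left₀ (norm_nonneg _) h m).trans hφb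
    rcases lt_or_ge 1 ‖x2‖ with h1 | h1
    · rw [padic_pi_norm_add_eq hy2 h1]
      exact ⟨⟨hx1, hz2⟩, hz3⟩
    · have h2 : ‖x2 + y2‖ ^ n ≤ 1 := pow_le_one₀ (norm_nonneg _)
        ((IsUltrametricDist.norm_add_le_max x2 y2).trans (max_le h1 hy2))
      refine ⟨⟨?_, h2.trans hb⟩, ?_⟩
      · rw [hφ1 _ h2]
        exact hx1.trans (hφle _)
      · rcases ha with ha | ha
        · exact ha.trans_le (by positivity)
        · exact absurd (pow_le_one₀ (norm_nonneg _) h1) (not_le.mpr (ha.trans_lt hz3))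
  have hbdd : ∀ z ∈ {z | z ∈ localRegion ℚ_[q] m n φ b ∧
      a < ‖fun b : Fin n => z (Fin.natAdd m b)‖ ^ n}, ∀ j, ‖z j‖ ≤ max 1 b := fun z hz j =>
    norm_le_of_mem_localRegion hm hn hφle hz.1 j
  refine ⟨⟨_, hbdd⟩, htrans, fun u hu z hz => ?_, fun c hc => ?_⟩
  · have h1 : (fun a : Fin m => (u • z) (Fin.castAdd n a)) =
      u • fun a : Fin m => z (Fin.castAdd n a) := rfl
    have h2 : (fun b : Fin n => (u • z) (Fin.natAdd m b)) =
      u • fun b : Fin n => z (Fin.natAdd m b) := rfl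
    simp only [localRegion, Set.mem_ofPred_eq, h1, h2, norm_smul, hu, one_mul]
    exact hz
  · set S := {z | z ∈ localRegion ℚ_[q] m n φ b ∧ a < ‖fun b : Fin n => z (Fin.natAdd m b)‖ ^ n}
      with hS
    have hc0 : c ≠ 0 := norm_pos_iff.mp (zero_lt_one.trans hc)
    set D : Fin (m + n) → ℚ_[q] := Fin.append (fun _ : Fin m => c) fun _ : Fin n => 1 with hD
    have hdet : (Matrix.diagonal D).det = c ^ m := by
      rw [Matrix.det_diagonal, Fin.prod_univ_add]
      simp [hD]
    have h1 := padic_measure_mulVec_preimage μ hμ (padic_isOpen_of_translation htrans).measurableSet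
      (Matrix.diagonal D) (by rw [hdet]; exact pow_ne_zero _ hc0)
    have hsub : S ∩ {x | c • x ∈ S} ⊆ {x | Matrix.diagonal D *ᵥ x ∈ S} := by
      rintro z ⟨⟨⟨hz1, hz2⟩, hz3⟩, ⟨⟨hz4, hz5⟩, hz6⟩⟩
      have e1 : (fun a : Fin m => (Matrix.diagonal D *ᵥ z) (Fin.castAdd n a)) =
          fun a : Fin m => (c • z) (Fin.castAdd n a) := by
        funext a
        simp [Matrix.mulVec_diagonal, hD]
      have e2 : (fun b : Fin n => (Matrix.diagonal D *ᵥ z) (Fin.natAdd m b)) =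
          fun b : Fin n => z (Fin.natAdd m b) := by
        funext a
        simp [Matrix.mulVec_diagonal, hD]
      simp only [hS, localRegion, Set.mem_ofPred_eq, e1, e2]
      refine ⟨⟨hz4.trans (hφ ?_), hz2⟩, hz3⟩
      have h2 : (fun b : Fin n => (c • z) (Fin.natAdd m b)) =
        c • fun b : Fin n => z (Fin.natAdd m b) := rfl
      rw [h2, norm_smul]
      exact pow_le_pow_left₀ (norm_nonneg _) (le_mul_of_one_le_left (norm_nonneg _) hc.le) n
    have hfin : μ {x | Matrix.diagonal D *ᵥ x ∈ S} ≠ ⊤ := by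
      refine (padic_measure_lt_top μ (M := max 1 b) fun x hx j => ?_).ne
      refine le_trans ?_ (hbdd _ hx j)
      rw [Matrix.mulVec_diagonal, norm_mul]
      refine le_mul_of_one_le_left (norm_nonneg _) ?_
      induction j using Fin.addCases with
      | left a => simpa [hD] using hc.le
      | right a => simp [hD]
    refine (ENNReal.toReal_mono hfin (measure_mono hsub)).trans ?_
    rw [h1, hdet, norm_pow]
    refine mul_le_mul_of_nonneg_right ?_ ENNReal.toReal_nonneg
    exact inv_anti₀ (zero_lt_one.trans hc) (le_self_pow₀ hc.le hm.ne')

theorem padicNice_truncRegion_diff (hm : 0 < m) (hn : 0 < n) (hφ : Antitone φ)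
    (hφ1 : ∀ t, t ≤ 1 → φ t = 1) (hφ0 : ∀ t, 0 < φ t) (μ : Measure (Fin (m + n) → ℚ_[q]))
    [μ.IsAddHaarMeasure] (hμ : μ {y | ∀ j, ‖y j‖ ≤ 1} = 1) (a b : ℝ) :
    PadicNice μ (truncRegion ℚ_[q] m n φ b \ truncRegion ℚ_[q] m n φ a) := by
  rcases lt_or_ge b 1 with hb | hb
  · rw [truncRegion_of_lt_one hb, Set.empty_sdiff]
    exact ⟨⟨0, by simp⟩, ⟨0, by simp⟩, by simp, by simp⟩
  rcases lt_or_ge a 1 with ha | ha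
  · have h := padicNice_localShell hm hn hφ hφ1 hφ0 μ hμ hb (a := -1) (Or.inl (by norm_num))
    convert h using 1
    ext z
    rw [truncRegion_of_lt_one ha, Set.sdiff_empty, truncRegion_of_one_le hb]
    refine ⟨fun hz => ⟨hz, (by norm_num : (-1 : ℝ) < 0).trans_le (by positivity)⟩, fun hz => hz.1⟩
  · have h := padicNice_localShell hm hn hφ hφ1 hφ0 μ hμ hb (Or.inr ha)
    convert h using 1
    ext z
    rw [truncRegion_of_one_le ha, truncRegion_of_one_le hb]
    refine ⟨fun hz => ⟨hz.1, ?_⟩, fun hz => ⟨hz.1, fun h' => not_le.mpr hz.2 h'.2⟩⟩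
    by_contra h'
    exact hz.2 ⟨hz.1.1, not_lt.mp h'⟩

end PadicRegions

section LocalPoints

variable {m n s : ℕ} {p : Fin s → ℕ} [hp : ∀ i, Fact (p i).Prime] {φ : ℝ → ℝ} {χ : Fin s → ℝ → ℝ}

/-- The rational vectors whose image under `g` lies in the local region at a given place. -/
def localPoints (m n : ℕ) (φ : ℝ → ℝ) (χ : Fin s → ℝ → ℝ) (g : SLS (m + n) p) :
    Option (Fin s) → ℝ → Set (Fin (m + n) → ℚ)
  | none, t => {w | (g.1 : Matrix (Fin (m + n)) (Fin (m + n)) ℝ) *ᵥ ratR w ∈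
      truncRegion ℝ m n φ t}
  | some i, t => {w | (g.2 i : Matrix (Fin (m + n)) (Fin (m + n)) ℚ_[p i]) *ᵥ ratP p i w ∈
      truncRegion ℚ_[p i] m n (χ i) t}

/-- The nonzero points of the grid `v + ℤ_S^d`. -/
def nonzeroGrid (p : Fin s → ℕ) {d : ℕ} (v : Fin d → ℚ) : Set (Fin d → ℚ) :=
  {w | (∀ j, IsZS (∏ i, p i) (w j - v j)) ∧ w ≠ 0}

/-- A countable set of heights at each place. -/
def heights (p : Fin s → ℕ) : Option (Fin s) → Set ℝ
  | none => {t | 1 ≤ t ∧ t ∈ Set.range ((↑) : ℚ → ℝ)}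
  | some i => Set.range fun k : ℕ => (p i : ℝ) ^ k

variable [∀ i, MeasurableSpace ℚ_[p i]]

/-- The volume of the local region at a given place. -/
noncomputable def localVolume (m n : ℕ) (φ : ℝ → ℝ) (χ : Fin s → ℝ → ℝ)
    (μd : ∀ i, Measure (Fin (m + n) → ℚ_[p i])) : Option (Fin s) → ℝ → ℝ
  | none, t => (volume (truncRegion ℝ m n φ t)).toReal
  | some i, t => (μd i (truncRegion ℚ_[p i] m n (χ i) t)).toReal

variable [∀ i, BorelSpace ℚ_[p i]]

theorem shellCount_localPoints (v : Fin (m + n) → ℚ) (g : SLS (m + n) p)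
    (a b : Option (Fin s) → ℝ) :
    shellCount (nonzeroGrid p v) (localPoints m n φ χ g) a b =
      latticeCount p v (truncRegion ℝ m n φ (b none) \ truncRegion ℝ m n φ (a none))
        (fun i => truncRegion ℚ_[p i] m n (χ i) (b (some i)) \
          truncRegion ℚ_[p i] m n (χ i) (a (some i))) g := by
  rw [shellCount, latticeCount]
  congr 1
  ext w
  simp only [nonzeroGrid, Set.mem_ofPred_eq, Option.forall, localPoints, Set.mem_sdiff, and_assoc]

theorem one_le_of_mem_heights {o : Option (Fin s)} {t : ℝ} (ht : t ∈ heights p o) : 1 ≤ t := by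
  cases o with
  | none => exact ht.1
  | some i =>
    obtain ⟨k, rfl⟩ := ht
    exact one_le_pow₀ (by exact_mod_cast (hp i).out.one_lt.le)

theorem countable_heights (o : Option (Fin s)) : (heights p o).Countable := by
  cases o with
  | none => exact (Set.countable_range _).mono fun t ht => ht.2
  | some i => exact Set.countable_range _

/-- The standing assumptions on the approximating functions. -/
structure NiceFunctions (φ : ℝ → ℝ) (χ : Fin s → ℝ → ℝ) : Prop where
  antitone_real : Antitone φ
  le_one_real : ∀ t, φ t ≤ 1
  pos_real : ∀ t, 0 < φ t
  antitone_padic : ∀ i, Antitone (χ i)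
  eq_one_padic : ∀ i t, t ≤ 1 → χ i t = 1
  pos_padic : ∀ i t, 0 < χ i t

variable (μd : ∀ i, Measure (Fin (m + n) → ℚ_[p i])) [∀ i, (μd i).IsAddHaarMeasure]

theorem padicNice_truncRegion (hm : 0 < m) (hn : 0 < n) (hf : NiceFunctions φ χ)
    (hμd : ∀ i, μd i {y | ∀ j, ‖y j‖ ≤ 1} = 1) (i : Fin s) (t : ℝ) :
    PadicNice (μd i) (truncRegion ℚ_[p i] m n (χ i) t) := by
  have h := padicNice_truncRegion_diff hm hn (hf.antitone_padic i) (hf.eq_one_padic i)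
    (hf.pos_padic i) (μd i) (hμd i) 0 t
  rwa [truncRegion_of_lt_one zero_lt_one, Set.sdiff_empty] at h

theorem volume_truncRegion_ne_top (hm : 0 < m) (hn : 0 < n) (hf : NiceFunctions φ χ) (t : ℝ) :
    volume (truncRegion ℝ m n φ t) ≠ ⊤ :=
  (realNice_truncRegion hm hn hf.antitone_real hf.le_one_real t).bounded.measure_lt_top.ne

theorem measure_truncRegion_ne_top (hm : 0 < m) (hn : 0 < n) (hf : NiceFunctions φ χ)
    (hμd : ∀ i, μd i {y | ∀ j, ‖y j‖ ≤ 1} = 1) (i : Fin s) (t : ℝ) :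
    μd i (truncRegion ℚ_[p i] m n (χ i) t) ≠ ⊤ := by
  obtain ⟨M, hM⟩ := (padicNice_truncRegion μd hm hn hf hμd i t).bounded
  exact (padic_measure_lt_top (μd i) hM).ne

theorem localVolume_mono (hm : 0 < m) (hn : 0 < n) (hf : NiceFunctions φ χ)
    (hμd : ∀ i, μd i {y | ∀ j, ‖y j‖ ≤ 1} = 1) (o : Option (Fin s)) :
    Monotone (localVolume m n φ χ μd o) := by
  intro a b hab
  cases o with
  | none =>
    exact ENNReal.toReal_mono (volume_truncRegion_ne_top hm hn hf b)
      (measure_mono (truncRegion_mono hab))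
  | some i =>
    exact ENNReal.toReal_mono (measure_truncRegion_ne_top μd hm hn hf hμd i b)
      (measure_mono (truncRegion_mono hab))

theorem prod_localVolume_sub (hm : 0 < m) (hn : 0 < n) (hf : NiceFunctions φ χ)
    (hμd : ∀ i, μd i {y | ∀ j, ‖y j‖ ≤ 1} = 1) {a b : Option (Fin s) → ℝ} (hab : a ≤ b) :
    ∏ o, (localVolume m n φ χ μd o (b o) - localVolume m n φ χ μd o (a o)) =
      (volume (truncRegion ℝ m n φ (b none) \ truncRegion ℝ m n φ (a none))).toReal *
        ∏ i, (μd i (truncRegion ℚ_[p i] m n (χ i) (b (some i)) \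
          truncRegion ℚ_[p i] m n (χ i) (a (some i)))).toReal := by
  rw [Fintype.prod_option]
  congr 1
  · exact (measureReal_sdiff (truncRegion_mono (hab none))
      (realNice_truncRegion hm hn hf.antitone_real hf.le_one_real _).measurable
      (volume_truncRegion_ne_top hm hn hf _)).symm
  · exact Finset.prod_congr rfl fun i _ => (measureReal_sdiff (truncRegion_mono (hab (some i)))
      (padicNice_truncRegion μd hm hn hf hμd i _).measurableSet
      (measure_truncRegion_ne_top μd hm hn hf hμd i _)).symm

theorem localVolume_zero (o : Option (Fin s)) : localVolume m n φ χ μd o 0 = 0 := by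
  cases o <;> simp [localVolume, truncRegion_of_lt_one]

theorem localPoints_zero (g : SLS (m + n) p) (o : Option (Fin s)) :
    localPoints m n φ χ g o 0 = ∅ := by
  cases o <;> simp [localPoints, truncRegion_of_lt_one]

theorem localPoints_mono (g : SLS (m + n) p) (o : Option (Fin s)) :
    Monotone (localPoints m n φ χ g o) := by
  intro a b hab
  cases o with
  | none => exact Set.preimage_mono (f := fun w : Fin (m + n) → ℚ =>
      (g.1 : Matrix (Fin (m + n)) (Fin (m + n)) ℝ) *ᵥ ratR w) (truncRegion_mono hab)
  | some i => exact Set.preimage_mono (f := fun w : Fin (m + n) → ℚ =>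
      (g.2 i : Matrix (Fin (m + n)) (Fin (m + n)) ℚ_[p i]) *ᵥ ratP p i w) (truncRegion_mono hab)

theorem finite_localPoints (hpinj : Function.Injective p) (hm : 0 < m) (hn : 0 < n)
    (hf : NiceFunctions φ χ) (hμd : ∀ i, μd i {y | ∀ j, ‖y j‖ ≤ 1} = 1) (v : Fin (m + n) → ℚ)
    (g : SLS (m + n) p) (T : Option (Fin s) → ℝ) :
    {x | x ∈ nonzeroGrid p v ∧ ∀ o, x ∈ localPoints m n φ χ g o (T o)}.Finite := by
  convert finite_latticeCount hpinj v
    (realNice_truncRegion hm hn hf.antitone_real hf.le_one_real (T none)) μd hμd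
    (fun i => padicNice_truncRegion μd hm hn hf hμd i (T (some i))) g using 2
  simp only [nonzeroGrid, Set.mem_ofPred_eq, Option.forall, localPoints, and_assoc]

/-- The volume of the real region for height one; the `p`-adic ones have volume at least one. -/
noncomputable def minVolume (m n : ℕ) (φ : ℝ → ℝ) : Option (Fin s) → ℝ
  | none => (volume (truncRegion ℝ m n φ 1)).toReal
  | some _ => 1

theorem minVolume_pos (hm : 0 < m) (hn : 0 < n) (hf : NiceFunctions φ χ) (o : Option (Fin s)) :
    0 < minVolume m n φ o := by
  cases o with
  | some i => exact zero_lt_one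
  | none =>
    refine ENNReal.toReal_pos ?_ (volume_truncRegion_ne_top hm hn hf 1)
    have hφ1 := hf.pos_real 1
    have hsub : Metric.ball (0 : Fin (m + n) → ℝ) (φ 1) ⊆ truncRegion ℝ m n φ 1 := by
      intro z hz
      rw [mem_ball_zero_iff] at hz
      have h1 : ‖fun a : Fin m => z (Fin.castAdd n a)‖ ≤ φ 1 :=
        (pi_norm_le_iff_of_nonneg hφ1.le).mpr fun a => (norm_le_pi_norm z _).trans hz.le
      have h2 : ‖fun b : Fin n => z (Fin.natAdd m b)‖ ≤ 1 :=
        (pi_norm_le_iff_of_nonneg zero_le_one).mpr fun a =>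
          ((norm_le_pi_norm z _).trans hz.le).trans (hf.le_one_real 1)
      have h3 : ‖fun b : Fin n => z (Fin.natAdd m b)‖ ^ n ≤ 1 := pow_le_one₀ (norm_nonneg _) h2
      exact ⟨le_rfl, ((pow_le_of_le_one (norm_nonneg _) (h1.trans (hf.le_one_real 1))
        hm.ne').trans h1).trans (hf.antitone_real h3), h3⟩
    exact ((Metric.measure_ball_pos volume _ hφ1).trans_le (measure_mono hsub)).ne'

theorem minVolume_le (hm : 0 < m) (hn : 0 < n) (hf : NiceFunctions φ χ)
    (hμd : ∀ i, μd i {y | ∀ j, ‖y j‖ ≤ 1} = 1) (o : Option (Fin s)) {t : ℝ} (ht : 1 ≤ t) :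
    minVolume m n φ o ≤ localVolume m n φ χ μd o t := by
  cases o with
  | none => exact localVolume_mono μd hm hn hf hμd none ht
  | some i =>
    have h1 : (μd i {y | ∀ j, ‖y j‖ ≤ 1}).toReal = 1 := by rw [hμd i, ENNReal.toReal_one]
    refine h1.symm.le.trans (ENNReal.toReal_mono (measure_truncRegion_ne_top μd hm hn hf hμd i t)
      (measure_mono fun z hz => ⟨ht, ?_⟩))
    have h2 : ‖fun a : Fin m => z (Fin.castAdd n a)‖ ≤ 1 :=
      (pi_norm_le_iff_of_nonneg zero_le_one).mpr fun a => hz _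
    have h3 : ‖fun b : Fin n => z (Fin.natAdd m b)‖ ≤ 1 :=
      (pi_norm_le_iff_of_nonneg zero_le_one).mpr fun a => hz _
    have h4 := pow_le_one₀ (n := n) (norm_nonneg _) h3
    refine ⟨?_, h4.trans ht⟩
    rw [hf.eq_one_padic i _ h4]
    exact pow_le_one₀ (norm_nonneg _) h2

/-- The volume of the real region is right continuous in the height. -/
theorem tendsto_volume_truncRegion (hm : 0 < m) (hn : 0 < n) (hf : NiceFunctions φ χ) {T : ℝ}
    (hT : 1 ≤ T) : Tendsto (fun t => (volume (truncRegion ℝ m n φ t)).toReal) (𝓝[>] T)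
      (𝓝 (volume (truncRegion ℝ m n φ T)).toReal) := by
  have h := tendsto_measure_biInter_gt (μ := (volume : Measure (Fin (m + n) → ℝ)))
    (s := truncRegion ℝ m n φ) (a := T)
    (fun r _ => (realNice_truncRegion hm hn hf.antitone_real hf.le_one_real
      r).measurable.nullMeasurableSet)
    (fun i j _ hij => truncRegion_mono hij)
    ⟨T + 1, by simp, volume_truncRegion_ne_top hm hn hf _⟩
  have hI : (⋂ r, ⋂ (_ : r > T), truncRegion ℝ m n φ r) = truncRegion ℝ m n φ T := by
    refine subset_antisymm (fun z hz => ?_)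
      (Set.subset_iInter₂ fun r hr => truncRegion_mono (le_of_lt hr))
    rw [Set.mem_iInter₂] at hz
    exact ⟨hT, (hz (T + 1) (by simp)).2.1,
      le_of_forall_gt_imp_ge_of_dense fun r hr => (hz r hr).2.2⟩
  rw [hI] at h
  exact (ENNReal.tendsto_toReal (volume_truncRegion_ne_top hm hn hf T)).comp h

/-- The number of points in the region is locally constant on the right in the real height. -/
theorem eventually_localPoints_eq (hpinj : Function.Injective p) (hm : 0 < m) (hn : 0 < n)
    (hf : NiceFunctions φ χ) (hμd : ∀ i, μd i {y | ∀ j, ‖y j‖ ≤ 1} = 1) (v : Fin (m + n) → ℚ)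
    (g : SLS (m + n) p) {T : Option (Fin s) → ℝ} (hT : 1 ≤ T none) :
    ∀ᶠ t in 𝓝[>] (T none), {x | x ∈ nonzeroGrid p v ∧
        ∀ o, x ∈ localPoints m n φ χ g o (Function.update T none t o)} =
      {x | x ∈ nonzeroGrid p v ∧ ∀ o, x ∈ localPoints m n φ χ g o (T o)} := by
  have hfin := finite_localPoints μd hpinj hm hn hf hμd v g (Function.update T none (T none + 1))
  have h1 : ∀ w ∈ {x | x ∈ nonzeroGrid p v ∧
      ∀ o, x ∈ localPoints m n φ χ g o (Function.update T none (T none + 1) o)},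
      ∀ᶠ t in 𝓝[>] (T none), w ∈ localPoints m n φ χ g none t →
        w ∈ localPoints m n φ χ g none (T none) := by
    rintro w ⟨-, hw⟩
    set y := ‖fun b : Fin n => ((g.1 : Matrix (Fin (m + n)) (Fin (m + n)) ℝ) *ᵥ ratR w)
      (Fin.natAdd m b)‖ ^ n with hy
    rcases le_or_gt y (T none) with h | h
    · exact Eventually.of_forall fun t ht => ⟨hT, ht.2.1, h⟩
    · filter_upwards [Ioo_mem_nhdsGT h] with t ht hwt
      exact absurd hwt.2.2 (not_le.mpr ht.2)
  filter_upwards [(hfin.eventually_all).mpr h1, Ioo_mem_nhdsGT (lt_add_one (T none))]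
    with t ht htI
  ext w
  simp only [Set.mem_ofPred_eq, Option.forall, Function.update_self, ne_eq, reduceCtorEq,
    not_false_eq_true, Function.update_of_ne]
  refine and_congr_right fun hw => ⟨fun h => ⟨ht w ⟨hw, ?_⟩ h.1, h.2⟩,
    fun h => ⟨localPoints_mono g none htI.1.le h.1, h.2⟩⟩
  simp only [Option.forall, Function.update_self, ne_eq, reduceCtorEq,
    not_false_eq_true, Function.update_of_ne]
  exact ⟨localPoints_mono g none htI.2.le h.1, h.2⟩

variable [MeasurableSpace (Matrix.SpecialLinearGroup (Fin (m + n)) ℝ)]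
  [BorelSpace (Matrix.SpecialLinearGroup (Fin (m + n)) ℝ)]
  [∀ i, MeasurableSpace (Matrix.SpecialLinearGroup (Fin (m + n)) ℚ_[p i])]
  [∀ i, BorelSpace (Matrix.SpecialLinearGroup (Fin (m + n)) ℚ_[p i])]

theorem shellFamily_localPoints (hpinj : Function.Injective p) (hm : 0 < m) (hn : 0 < n)
    (hd : 3 ≤ m + n) {N : ℕ} (hN : 0 < N) (hNS : Nat.Coprime N (∏ i, p i)) {v : Fin (m + n) → ℚ}
    (hv : ∀ j, IsZS (∏ i, p i) (N * v j)) (hf : NiceFunctions φ χ)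
    (hμd : ∀ i, μd i {y | ∀ j, ‖y j‖ ≤ 1} = 1) (ρ : Measure (SLS (m + n) p))
    [ρ.IsMulRightInvariant] (hρ : ∀ K, ρ (ballSLS p K) ≠ ⊤) (K₀ : ℝ) :
    ∃ C : ℝ, 0 ≤ C ∧ ShellFamily (ρ.restrict (ballSLS p K₀)) (nonzeroGrid p v)
      (localPoints m n φ χ) (localVolume m n φ χ μd) (heights p) C := by
  obtain ⟨C, hC, hvar⟩ := variance_le hpinj hd hN hNS hv μd hμd ρ hρ K₀
  have hR : ∀ a b, RealNice (truncRegion ℝ m n φ b \ truncRegion ℝ m n φ a) := fun a b =>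
    (realNice_truncRegion hm hn hf.antitone_real hf.le_one_real b).diff
      (realNice_truncRegion hm hn hf.antitone_real hf.le_one_real a)
  have hP : ∀ i a b, PadicNice (μd i)
      (truncRegion ℚ_[p i] m n (χ i) b \ truncRegion ℚ_[p i] m n (χ i) a) := fun i a b =>
    padicNice_truncRegion_diff hm hn (hf.antitone_padic i) (hf.eq_one_padic i)
      (hf.pos_padic i) (μd i) (hμd i) a b
  refine ⟨C, hC, ?_⟩
  constructor
  case mono => exact localPoints_mono
  case zero => exact localPoints_zero
  case finite => exact finite_localPoints μd hpinj hm hn hf hμd v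
  case vmono => exact localVolume_mono μd hm hn hf hμd
  case vzero => exact localVolume_zero μd
  case countable => exact countable_heights
  case nonneg => exact fun o t ht => zero_le_one.trans (one_le_of_mem_heights ht)
  case meas =>
    intro a b _ _
    simp only [shellCount_localPoints]
    exact measurable_latticeCount hpinj v (hR _ _) μd hμd fun i => hP i _ _
  case var =>
    intro a b _ _ hab
    simp only [shellError, shellCount_localPoints, prod_localVolume_sub μd hm hn hf hμd hab]
    exact hvar _ _ (hR _ _) fun i => hP i _ _

end LocalPoints

section Assembly

variable {m n s : ℕ} {p : Fin s → ℕ} [hp : ∀ i, Fact (p i).Prime] {φ : ℝ → ℝ} {χ : Fin s → ℝ → ℝ}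
theorem iUnion_ballSLS {d : ℕ} : (⋃ k : ℕ, ballSLS (d := d) p (k : ℝ)) = Set.univ := by
  refine Set.eq_univ_of_forall fun g => ?_
  obtain ⟨K, -, hK⟩ := exists_ballSLS_of_isCompact (isCompact_singleton (x := g))
  obtain ⟨k, hk⟩ := exists_nat_ge K
  have hg := hK (Set.mem_singleton g)
  exact Set.mem_iUnion.mpr ⟨k, fun a b => (hg.1 a b).trans hk,
    fun i a b => (hg.2 i a b).trans hk⟩

variable [∀ i, MeasurableSpace ℚ_[p i]] [∀ i, BorelSpace ℚ_[p i]]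
variable (μd : ∀ i, Measure (Fin (m + n) → ℚ_[p i])) [∀ i, (μd i).IsAddHaarMeasure]

theorem shellError_zero_localPoints (v : Fin (m + n) → ℚ) (g : SLS (m + n) p)
    (T : Option (Fin s) → ℝ) :
    shellError (nonzeroGrid p v) (localPoints m n φ χ g) (localVolume m n φ χ μd) 0 T =
      ({x | x ∈ nonzeroGrid p v ∧ ∀ o, x ∈ localPoints m n φ χ g o (T o)}.ncard : ℝ) -
        ∏ o, localVolume m n φ χ μd o (T o) := by
  simp only [shellError, shellCount, Pi.zero_apply, localPoints_zero, localVolume_zero, sub_zero,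
    Set.mem_empty_iff_false, not_false_eq_true, and_true]

theorem discrepancy_of_rational_heights (hpinj : Function.Injective p) (hm : 0 < m) (hn : 0 < n)
    (hf : NiceFunctions φ χ) (hμd : ∀ i, μd i {y | ∀ j, ‖y j‖ ≤ 1} = 1) (v : Fin (m + n) → ℚ)
    (g : SLS (m + n) p) {C δ : ℝ} (hδ : 0 < δ)
    (h : ∀ T : Option (Fin s) → ℝ, (∀ o, T o ∈ heights p o) →
      |shellError (nonzeroGrid p v) (localPoints m n φ χ g) (localVolume m n φ χ μd) 0 T| ≤
        C * (∏ o, localVolume m n φ χ μd o (T o)) ^ δ)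
    {T : Option (Fin s) → ℝ} (hT : 1 ≤ T none) (hTP : ∀ i, T (some i) ∈ heights p (some i)) :
    |({x | x ∈ nonzeroGrid p v ∧ ∀ o, x ∈ localPoints m n φ χ g o (T o)}.ncard : ℝ) -
        ∏ o, localVolume m n φ χ μd o (T o)| ≤ C * (∏ o, localVolume m n φ χ μd o (T o)) ^ δ := by
  set c : ℝ := ({x | x ∈ nonzeroGrid p v ∧
    ∀ o, x ∈ localPoints m n φ χ g o (T o)}.ncard : ℝ) with hc
  set V := ∏ i, localVolume m n φ χ μd (some i) (T (some i)) with hV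
  set f : ℝ → ℝ := fun t => localVolume m n φ χ μd none t * V with hfdef
  have hprod : ∀ t, ∏ o, localVolume m n φ χ μd o (Function.update T none t o) = f t := fun t => by
    rw [Fintype.prod_option]
    simp [hfdef, hV]
  have hprodT : ∏ o, localVolume m n φ χ μd o (T o) = f (T none) := Fintype.prod_option _
  have hlim : Tendsto f (𝓝[>] (T none)) (𝓝 (f (T none))) :=
    (tendsto_volume_truncRegion hm hn hf hT).mul_const V
  have hlim2 : Tendsto (fun t => C * f t ^ δ - |c - f t|) (𝓝[>] (T none))
      (𝓝 (C * f (T none) ^ δ - |c - f (T none)|)) :=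
    ((hlim.rpow_const (Or.inr hδ.le)).const_mul C).sub (tendsto_const_nhds.sub hlim).abs
  rw [hprodT, ← sub_nonneg]
  refine ge_of_tendsto_of_frequently hlim2 ?_
  have hrat : ∃ᶠ t in 𝓝[>] (T none), t ∈ Set.range ((↑) : ℚ → ℝ) := by
    rw [frequently_iff]
    intro U hU
    obtain ⟨u, hu, hsub⟩ := mem_nhdsGT_iff_exists_Ioo_subset.mp hU
    obtain ⟨q, hq1, hq2⟩ := exists_rat_btwn (show T none < u from hu)
    exact ⟨q, hsub ⟨hq1, hq2⟩, q, rfl⟩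
  refine (hrat.and_eventually ((eventually_localPoints_eq μd hpinj hm hn hf hμd v g hT).and
    self_mem_nhdsWithin)).mono ?_
  rintro t ⟨htq, hteq, htT⟩
  have hmem : ∀ o, Function.update T none t o ∈ heights p o := by
    rw [Option.forall]
    refine ⟨?_, fun i => ?_⟩
    · rw [Function.update_self]
      exact ⟨hT.trans (le_of_lt htT), htq⟩
    · rw [Function.update_of_ne (by simp)]
      exact hTP i
  have := h _ hmem
  rw [shellError_zero_localPoints, hteq, hprod] at this
  exact sub_nonneg.mpr this

theorem Efull_eq_prod {TR : ℝ} {TP : Fin s → ℝ} (hTR : 1 ≤ TR) (hTP : ∀ i, 1 ≤ TP i) :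
    Efull m n p φ χ TR TP = truncRegion ℝ m n φ TR ×ˢ
      Set.univ.pi fun i => truncRegion ℚ_[p i] m n (χ i) (TP i) := by
  ext z
  rw [truncRegion_of_one_le hTR]
  simp only [Efull, Set.mem_ofPred_eq, Set.mem_prod, Set.mem_pi, Set.mem_univ, true_imp_iff,
    truncRegion_of_one_le (hTP _), localRegion, and_assoc]

theorem measure_Efull {TR : ℝ} {TP : Fin s → ℝ} (hTR : 1 ≤ TR) (hTP : ∀ i, 1 ≤ TP i) :
    (((volume : Measure (Fin (m + n) → ℝ)).prod (Measure.pi μd))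
      (Efull m n p φ χ TR TP)).toReal =
      ∏ o : Option (Fin s), localVolume m n φ χ μd o (o.elim TR TP) := by
  rw [Efull_eq_prod hTR hTP, Measure.prod_prod, Measure.pi_pi, ENNReal.toReal_mul,
    ENNReal.toReal_prod, Fintype.prod_option]
  rfl

theorem abs_gridCount_sub_le (hpinj : Function.Injective p) (hm : 0 < m) (hn : 0 < n)
    (hf : NiceFunctions φ χ) (hμd : ∀ i, μd i {y | ∀ j, ‖y j‖ ≤ 1} = 1) (v : Fin (m + n) → ℚ)
    (g : SLS (m + n) p) {TR : ℝ} {TP : Fin s → ℝ} (hTR : 1 ≤ TR) (hTP : ∀ i, 1 ≤ TP i) :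
    |(gridCount m n p g {w | ∀ j, IsZS (∏ i, p i) (w j - v j)} (Efull m n p φ χ TR TP) : ℝ) -
      ({x | x ∈ nonzeroGrid p v ∧
        ∀ o : Option (Fin s), x ∈ localPoints m n φ χ g o (o.elim TR TP)}.ncard : ℝ)| ≤ 1 := by
  have hfin := finite_localPoints μd hpinj hm hn hf hμd v g fun o => o.elim TR TP
  set A := {x | x ∈ nonzeroGrid p v ∧
        ∀ o : Option (Fin s), x ∈ localPoints m n φ χ g o (o.elim TR TP)} with hA
  set B := {w : Fin (m + n) → ℚ | w ∈ {w : Fin (m + n) → ℚ | ∀ j, IsZS (∏ i, p i) (w j - v j)} ∧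
    (((g.1 : Matrix (Fin (m + n)) (Fin (m + n)) ℝ).mulVec (ratR w),
      fun i => ((g.2 i : Matrix (Fin (m + n)) (Fin (m + n)) ℚ_[p i]).mulVec (ratP p i w)))
      ∈ Efull m n p φ χ TR TP)} with hB
  have hAB : ∀ w, w ∈ A ↔ w ∈ B ∧ w ≠ 0 := by
    intro w
    rw [hB, Efull_eq_prod hTR hTP]
    simp only [hA, nonzeroGrid, localPoints, Option.forall, Option.elim, Set.mem_ofPred_eq,
      Set.mem_prod, Set.mem_pi, Set.mem_univ, true_imp_iff]
    tauto
  have h1 : A ⊆ B := fun w hw => ((hAB w).mp hw).1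
  have h2 : B ⊆ insert 0 A := fun w hw => by
    by_cases h0 : w = 0
    · exact Or.inl h0
    · exact Or.inr ((hAB w).mpr ⟨hw, h0⟩)
  have h3 : A.ncard ≤ B.ncard := Set.ncard_le_ncard h1 ((hfin.insert 0).subset h2)
  have h4 : B.ncard ≤ A.ncard + 1 :=
    (Set.ncard_le_ncard h2 (hfin.insert 0)).trans (Set.ncard_insert_le _ _)
  have h3' : (A.ncard : ℝ) ≤ B.ncard := by exact_mod_cast h3
  have h4' : (B.ncard : ℝ) ≤ A.ncard + 1 := by exact_mod_cast h4
  change |(B.ncard : ℝ) - A.ncard| ≤ 1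
  rw [abs_le]
  constructor <;> linarith

variable [MeasurableSpace (Matrix.SpecialLinearGroup (Fin (m + n)) ℝ)]
  [BorelSpace (Matrix.SpecialLinearGroup (Fin (m + n)) ℝ)]
  [∀ i, MeasurableSpace (Matrix.SpecialLinearGroup (Fin (m + n)) ℚ_[p i])]
  [∀ i, BorelSpace (Matrix.SpecialLinearGroup (Fin (m + n)) ℚ_[p i])]

/-- Almost everywhere discrepancy bound with respect to a right invariant measure. -/
theorem ae_discrepancy_localPoints (hpinj : Function.Injective p) (hm : 0 < m) (hn : 0 < n)
    (hd : 3 ≤ m + n) {N : ℕ} (hN : 0 < N) (hNS : Nat.Coprime N (∏ i, p i)) {v : Fin (m + n) → ℚ}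
    (hv : ∀ j, IsZS (∏ i, p i) (N * v j)) (hf : NiceFunctions φ χ)
    (hμd : ∀ i, μd i {y | ∀ j, ‖y j‖ ≤ 1} = 1) (ρ : Measure (SLS (m + n) p))
    [ρ.IsMulRightInvariant] (hρ : ∀ K, ρ (ballSLS p K) ≠ ⊤) {δ : ℝ} (hδ : 1 / 2 < δ) :
    ∀ᵐ g ∂ρ, ∃ C : ℝ, 0 ≤ C ∧ ∀ T : Option (Fin s) → ℝ, (∀ o, T o ∈ heights p o) →
      |shellError (nonzeroGrid p v) (localPoints m n φ χ g) (localVolume m n φ χ μd) 0 T| ≤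
        C * (∏ o, localVolume m n φ χ μd o (T o)) ^ δ := by
  rw [← Measure.restrict_univ (μ := ρ), ← iUnion_ballSLS, ae_restrict_iUnion_iff]
  intro k
  obtain ⟨C, hC, hF⟩ := shellFamily_localPoints μd hpinj hm hn hd hN hNS hv hf hμd ρ hρ k
  have : IsFiniteMeasure (ρ.restrict (ballSLS (d := m + n) p (k : ℝ))) :=
    ⟨by rw [Measure.restrict_apply_univ]; exact (hρ k).lt_top⟩
  exact hF.ae_discrepancy hC (minVolume_pos hm hn hf)
    (fun o t ht => minVolume_le μd hm hn hf hμd o (one_le_of_mem_heights ht)) hδ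

end Assembly

section Main

variable {m n s : ℕ} {p : Fin s → ℕ} [hp : ∀ i, Fact (p i).Prime]

theorem ApproxFamily.niceFunctions (ψ : ApproxFamily m n s p) {N : ℕ} (hN : 0 < N) :
    NiceFunctions (fun t => ψ.psiR ((N : ℝ) ^ n * t) / (N : ℝ) ^ m) ψ.psiP := by
  have hN1 : (1 : ℝ) ≤ N := by exact_mod_cast hN
  have hNn : (0 : ℝ) < (N : ℝ) ^ n := by positivity
  have hNm : (0 : ℝ) < (N : ℝ) ^ m := by positivity
  have key : ∀ f : ℝ → ℝ, (∀ ⦃t₁ t₂ : ℝ⦄, 0 < t₁ → t₁ ≤ t₂ → f t₂ ≤ f t₁) →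
      (∀ ⦃t : ℝ⦄, t ≤ 1 → f t = 1) → Antitone f ∧ ∀ t, f t ≤ 1 := by
    intro f hanti hone
    have hle : ∀ t, f t ≤ 1 := fun t => by
      rcases le_total t 1 with h | h
      · exact (hone h).le
      · exact (hanti one_pos h).trans (hone le_rfl).le
    refine ⟨fun a b hab => ?_, hle⟩
    rcases le_or_gt a 1 with h | h
    · exact (hle b).trans (hone h).ge
    · exact hanti (one_pos.trans h) hab
  obtain ⟨hR, hR1⟩ := key ψ.psiR ψ.antiR ψ.oneR
  exact
    { antitone_real := fun a b hab =>
        div_le_div_of_nonneg_right (hR (mul_le_mul_of_nonneg_left hab hNn.le)) hNm.le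
      le_one_real := fun t => div_le_one_of_le₀ ((hR1 _).trans (one_le_pow₀ hN1)) hNm.le
      pos_real := fun t => div_pos (ψ.posR _) hNm
      antitone_padic := fun i => (key (ψ.psiP i) (ψ.antiP i) (ψ.oneP i)).1
      eq_one_padic := fun i t ht => ψ.oneP i ht
      pos_padic := ψ.posP }

variable [∀ i, MeasurableSpace ℚ_[p i]] [∀ i, BorelSpace ℚ_[p i]]
variable (μd : ∀ i, Measure (Fin (m + n) → ℚ_[p i])) [∀ i, (μd i).IsAddHaarMeasure]
variable {φ : ℝ → ℝ} {χ : Fin s → ℝ → ℝ}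

theorem abs_gridCount_sub_measure_le (hpinj : Function.Injective p) (hm : 0 < m) (hn : 0 < n)
    (hf : NiceFunctions φ χ) (hμd : ∀ i, μd i {y | ∀ j, ‖y j‖ ≤ 1} = 1) (v : Fin (m + n) → ℚ)
    (g : SLS (m + n) p) {C δ : ℝ} (hC : 0 ≤ C) (hδ : 0 < δ)
    (h : ∀ T : Option (Fin s) → ℝ, (∀ o, T o ∈ heights p o) →
      |shellError (nonzeroGrid p v) (localPoints m n φ χ g) (localVolume m n φ χ μd) 0 T| ≤
        C * (∏ o, localVolume m n φ χ μd o (T o)) ^ δ) :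
    ∃ C : ℝ, 0 < C ∧ ∃ (T0R : ℝ) (T0P : Fin s → ℝ),
      ∀ (TR : ℝ) (TP : Fin s → ℝ), 0 ≤ TR → (∀ i, ∃ k : ℤ, TP i = (p i : ℝ) ^ k) →
        T0R ≤ TR → (∀ i, T0P i ≤ TP i) →
        |(gridCount m n p g {w : Fin (m + n) → ℚ | ∀ j, IsZS (∏ i, p i) (w j - v j)}
            (Efull m n p φ χ TR TP) : ℝ) -
          (((volume : Measure (Fin (m + n) → ℝ)).prod (Measure.pi μd))
            (Efull m n p φ χ TR TP)).toReal| ≤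
        C * (((volume : Measure (Fin (m + n) → ℝ)).prod (Measure.pi μd))
            (Efull m n p φ χ TR TP)).toReal ^ δ := by
  set V₀ := ∏ o : Option (Fin s), minVolume m n φ o with hV₀
  have hV₀pos : 0 < V₀ := Finset.prod_pos fun o _ => minVolume_pos hm hn hf o
  have hV₀δ : 0 < V₀ ^ δ := Real.rpow_pos_of_pos hV₀pos δ
  refine ⟨C + (V₀ ^ δ)⁻¹, by positivity, 1, fun _ => 1, fun TR TP _ hTP hTR1 hTP1 => ?_⟩
  rw [measure_Efull μd hTR1 hTP1]
  set V := ∏ o : Option (Fin s), localVolume m n φ χ μd o (o.elim TR TP) with hV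
  have h1le : ∀ o : Option (Fin s), 1 ≤ o.elim TR TP := by
    rw [Option.forall]
    exact ⟨hTR1, hTP1⟩
  have hVV : V₀ ≤ V := Finset.prod_le_prod (fun o _ => (minVolume_pos hm hn hf o).le)
    fun o _ => minVolume_le μd hm hn hf hμd o (h1le o)
  have hone : 1 ≤ (V₀ ^ δ)⁻¹ * V ^ δ := by
    rw [inv_mul_eq_div, one_le_div hV₀δ]
    exact Real.rpow_le_rpow hV₀pos.le hVV hδ.le
  have hheights : ∀ i, TP i ∈ heights p (some i) := by
    intro i
    obtain ⟨k, hk⟩ := hTP i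
    have hp1 : (1 : ℝ) < p i := by exact_mod_cast (hp i).out.one_lt
    have hk0 : 0 ≤ k := by
      by_contra hneg
      exact absurd (hTP1 i) (not_le.mpr (hk ▸ zpow_lt_one_of_neg₀ hp1 (not_le.mp hneg)))
    lift k to ℕ using hk0
    exact ⟨k, by rw [hk, zpow_natCast]⟩
  have h1 := discrepancy_of_rational_heights μd hpinj hm hn hf hμd v g hδ h
    (T := fun o => o.elim TR TP) hTR1 hheights
  have h2 := abs_gridCount_sub_le μd hpinj hm hn hf hμd v g hTR1 hTP1
  calc _ ≤ _ := abs_sub_le _ _ _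
    _ ≤ 1 + C * V ^ δ := add_le_add h2 h1
    _ ≤ (C + (V₀ ^ δ)⁻¹) * V ^ δ := by linarith

variable [MeasurableSpace (Matrix.SpecialLinearGroup (Fin (m + n)) ℝ)]
  [BorelSpace (Matrix.SpecialLinearGroup (Fin (m + n)) ℝ)]
  [∀ i, MeasurableSpace (Matrix.SpecialLinearGroup (Fin (m + n)) ℚ_[p i])]
  [∀ i, BorelSpace (Matrix.SpecialLinearGroup (Fin (m + n)) ℚ_[p i])]

/-- The counting theorem for the standard topology on `SL_d(ℚ_S)`. -/
theorem ae_abs_gridCount_sub_measure_le (hpinj : Function.Injective p) (hm : 0 < m) (hn : 0 < n)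
    (hd : 3 ≤ m + n) {N : ℕ} (hN : 0 < N) (hNS : Nat.Coprime N (∏ i, p i)) {v : Fin (m + n) → ℚ}
    (hv : ∀ j, IsZS (∏ i, p i) (N * v j)) (hf : NiceFunctions φ χ)
    (hμd : ∀ i, μd i {y | ∀ j, ‖y j‖ ≤ 1} = 1) (μG : Measure (SLS (m + n) p)) [μG.IsHaarMeasure]
    {δ : ℝ} (hδ : 1 / 2 < δ) :
    ∀ᵐ g ∂μG, ∃ C : ℝ, 0 < C ∧ ∃ (T0R : ℝ) (T0P : Fin s → ℝ),
      ∀ (TR : ℝ) (TP : Fin s → ℝ), 0 ≤ TR → (∀ i, ∃ k : ℤ, TP i = (p i : ℝ) ^ k) →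
        T0R ≤ TR → (∀ i, T0P i ≤ TP i) →
        |(gridCount m n p g {w : Fin (m + n) → ℚ | ∀ j, IsZS (∏ i, p i) (w j - v j)}
            (Efull m n p φ χ TR TP) : ℝ) -
          (((volume : Measure (Fin (m + n) → ℝ)).prod (Measure.pi μd))
            (Efull m n p φ χ TR TP)).toReal| ≤
        C * (((volume : Measure (Fin (m + n) → ℝ)).prod (Measure.pi μd))
            (Efull m n p φ χ TR TP)).toReal ^ δ := by
  have hcompl : ∀ K, μG.inv (ballSLS p K) ≠ ⊤ := fun K => by
    rw [Measure.inv_apply]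
    exact (isCompact_ballSLS (p := p) (d := m + n) K).inv.measure_lt_top.ne
  have hσ : SigmaFinite μG := by
    have : SigmaCompactSpace (SLS (m + n) p) := ⟨⟨fun k : ℕ => ballSLS p k,
      fun k => isCompact_ballSLS _, iUnion_ballSLS⟩⟩
    infer_instance
  have hae := ae_discrepancy_localPoints μd hpinj hm hn hd hN hNS hv hf hμd μG.inv hcompl hδ
  filter_upwards [(absolutelyContinuous_inv μG).ae_le hae] with g ⟨C, hC, hg⟩
  exact abs_gridCount_sub_measure_le μd hpinj hm hn hf hμd v g hC (by linarith) hg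

end Main

end

/-- **S-arithmetic analogue of Schmidt's counting theorem, first assertion.**
With `ψ'_∞(t) = ψ_∞(N^n t)/N^m`, `ψ'_p = ψ_p`, `T'_∞ = T_∞/N^n`, `T'_p = T_p`,
for almost every `g ∈ SL_d(ℚ_S)` (`d = m + n ≥ 3`) there are `C > 0` and `T'_0`
such that `|#(g(ℤ_S^d + v_d/N) ∩ E_{ψ'}(T')) − vol(E_{ψ'}(T'))| ≤ C·vol(E_{ψ'}(T'))^δ`
for all `T' ⪰ T'_0`. -/
theorem s_arithmetic_schmidt_counting_first
    (m n : ℕ) (hm : 0 < m) (hn : 0 < n) (hd : 3 ≤ m + n)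
    (s : ℕ) (p : Fin s → ℕ) [∀ i, Fact (p i).Prime] (hpinj : Function.Injective p)
    [∀ i, MeasurableSpace ℚ_[p i]] [∀ i, BorelSpace ℚ_[p i]]
    (ψ : ApproxFamily m n s p)
    (N : ℕ) (hN : 0 < N) (hNS : Nat.Coprime N (∏ i, p i))
    (vd : Fin (m + n) → ℚ) (hvd : ∀ j, IsZS (∏ i, p i) (vd j))
    (δ : ℝ) (hδ₁ : 2 / 3 < δ) (hδ₂ : δ < 1)
    -- Haar measure on `ℚ_S^d`, normalized so that `ℤ_p^d` has measure one at each
    -- finite place: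
    (μd : ∀ i, Measure (Fin (m + n) → ℚ_[p i])) [∀ i, (μd i).IsAddHaarMeasure]
    (hμd : ∀ i, μd i {y | ∀ j, ‖y j‖ ≤ 1} = 1)
    -- the topological group `SL_d(ℚ_S)`, with its Borel structure and a Haar
    -- measure on it:
    [tSLR : TopologicalSpace (SpecialLinearGroup (Fin (m + n)) ℝ)]
    (htSLR : tSLR = TopologicalSpace.induced
      ((↑) : SpecialLinearGroup (Fin (m + n)) ℝ → Matrix (Fin (m + n)) (Fin (m + n)) ℝ)
      inferInstance)
    [tSLP : ∀ i, TopologicalSpace (SpecialLinearGroup (Fin (m + n)) ℚ_[p i])]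
    (htSLP : ∀ i, tSLP i = TopologicalSpace.induced
      ((↑) : SpecialLinearGroup (Fin (m + n)) ℚ_[p i] →
        Matrix (Fin (m + n)) (Fin (m + n)) ℚ_[p i])
      inferInstance)
    [mSLR : MeasurableSpace (SpecialLinearGroup (Fin (m + n)) ℝ)]
    (hmSLR : mSLR = borel _)
    [mSLP : ∀ i, MeasurableSpace (SpecialLinearGroup (Fin (m + n)) ℚ_[p i])]
    (hmSLP : ∀ i, mSLP i = borel _)
    (μG : Measure ((SpecialLinearGroup (Fin (m + n)) ℝ) ×
      ∀ i, SpecialLinearGroup (Fin (m + n)) ℚ_[p i]))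
    [μG.IsHaarMeasure] :
    ∀ᵐ g ∂μG, ∃ C : ℝ, 0 < C ∧ ∃ (T0R : ℝ) (T0P : Fin s → ℝ),
      ∀ (TR : ℝ) (TP : Fin s → ℝ), 0 ≤ TR → (∀ i, ∃ k : ℤ, TP i = (p i : ℝ) ^ k) →
        T0R ≤ TR → (∀ i, T0P i ≤ TP i) →
        |(gridCount m n p g
              {w : Fin (m + n) → ℚ | ∀ j, IsZS (∏ i, p i) (w j - vd j / N)}
              (Efull m n p (fun t => ψ.psiR ((N : ℝ) ^ n * t) / (N : ℝ) ^ m) ψ.psiP TR TP)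
            : ℝ)
          - (((volume : Measure (Fin (m + n) → ℝ)).prod (Measure.pi μd))
              (Efull m n p (fun t => ψ.psiR ((N : ℝ) ^ n * t) / (N : ℝ) ^ m) ψ.psiP TR TP)).toReal|
        ≤ C * (((volume : Measure (Fin (m + n) → ℝ)).prod (Measure.pi μd))
              (Efull m n p (fun t => ψ.psiR ((N : ℝ) ^ n * t) / (N : ℝ) ^ m) ψ.psiP TR TP)).toReal
            ^ δ := by
  subst htSLR
  obtain rfl : tSLP = fun i => TopologicalSpace.induced _ inferInstance := funext htSLP
  have : BorelSpace (Matrix.SpecialLinearGroup (Fin (m + n)) ℝ) := ⟨hmSLR⟩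
  have : ∀ i, BorelSpace (Matrix.SpecialLinearGroup (Fin (m + n)) ℚ_[p i]) := fun i => ⟨hmSLP i⟩
  have : μG.IsHaarMeasure := by assumption
  refine ae_abs_gridCount_sub_measure_le μd hpinj hm hn hd hN hNS (v := fun j => vd j / N)
    (fun j => ?_) (ψ.niceFunctions hN) hμd μG (by linarith)
  rw [mul_div_cancel₀ (vd j) (show (N : ℚ) ≠ 0 by exact_mod_cast hN.ne')]
  exact hvd j

end
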